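/- arXiv:0708.2539 — 2 statements merged into one kernel-verified Lean document; each statement's English description precedes it below -/
import Mathlib

section
/- There exists an absolute constant C > 0 such that for every positive even integer N and every sufficiently large real x, the number of integers q with q ≤ x − N such that both q ∈ P₂* and q + N ∈ P₂* is at most C · (x·(log log x)² / (log x)²) · ∏_{p | N, p prime} (1 + 1/p). -/
open scoped Classical

/-- `P₂*`: all primes together with all products `p₁ * p₂` of primes with `p₁² < p₂`. -/
def P2star (n : ℕ) : Prop :=
  n.Prime ∨ ∃ p q : ℕ, p.Prime ∧ q.Prime ∧ p ^ 2 < q ∧ n = p * q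

section SelbergUpperBound

open BoundingSieve Finset ArithmeticFunction
open scoped ArithmeticFunction.Moebius

theorem sum_moebius_between {P m l : ℕ} (hP : Squarefree P) (hm : m ∣ P) (hl : l ∣ P) :
    (∑ d ∈ P.divisors, if l ∣ d ∧ d ∣ m then (μ d : ℝ) else 0) = if l = m then (μ l : ℝ) else 0 := by
  have hP0 : P ≠ 0 := hP.ne_zero
  have hm0 : m ≠ 0 := ne_zero_of_dvd_ne_zero hP0 hm
  have hl0 : l ≠ 0 := ne_zero_of_dvd_ne_zero hP0 hl
  by_cases hlm : l ∣ m
  · obtain ⟨k, rfl⟩ := hlm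
    have hk0 : k ≠ 0 := right_ne_zero_of_mul hm0
    have hsq : Squarefree (l * k) := hP.squarefree_of_dvd hm
    have hco : l.Coprime k := Nat.coprime_of_squarefree_mul hsq
    have h1 : (∑ d ∈ P.divisors, if l ∣ d ∧ d ∣ l * k then (μ d : ℝ) else 0)
        = ∑ e ∈ k.divisors, (μ (l * e) : ℝ) := by
      rw [← sum_filter]
      symm
      refine sum_bij (fun e _ => l * e) ?_ ?_ ?_ ?_
      · intro e he
        have he' := Nat.dvd_of_mem_divisors he
        simp only [mem_filter, Nat.mem_divisors]
        exact ⟨⟨(mul_dvd_mul_left l he').trans hm, hP0⟩, dvd_mul_right _ _, mul_dvd_mul_left l he'⟩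
      · intro a _ b _ h
        exact Nat.eq_of_mul_eq_mul_left (Nat.pos_of_ne_zero hl0) h
      · intro d hd
        simp only [mem_filter, Nat.mem_divisors] at hd
        obtain ⟨-, ⟨e, rfl⟩, h2⟩ := hd
        exact ⟨e, Nat.mem_divisors.2 ⟨Nat.dvd_of_mul_dvd_mul_left (Nat.pos_of_ne_zero hl0) h2, hk0⟩,
          rfl⟩
      · intro _ _; rfl
    have h2 : ∑ e ∈ k.divisors, (μ (l * e) : ℝ) = μ l * ∑ e ∈ k.divisors, (μ e : ℝ) := by
      rw [mul_sum]
      refine sum_congr rfl fun e he => ?_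
      rw [isMultiplicative_moebius.map_mul_of_coprime
        (hco.coprime_dvd_right (Nat.dvd_of_mem_divisors he))]
      push_cast; rfl
    have h3 : ∑ e ∈ k.divisors, (μ e : ℝ) = if k = 1 then 1 else 0 := by
      have := congrArg (fun f => f k) ArithmeticFunction.moebius_mul_coe_zeta
      simp only [ArithmeticFunction.coe_mul_zeta_apply, ArithmeticFunction.one_apply] at this
      exact_mod_cast this
    rw [h1, h2, h3]
    by_cases hk : k = 1
    · simp [hk]
    · have : l ≠ l * k := by
        intro h
        exact hk (Nat.eq_of_mul_eq_mul_left (Nat.pos_of_ne_zero hl0) (by omega))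
      simp [hk, this]
  · rw [if_neg (fun h : l = m => hlm (h ▸ dvd_rfl))]
    refine sum_eq_zero fun d _ => if_neg fun h => hlm (h.1.trans h.2)

/-- The sum of the Selberg terms up to `y`, whose inverse is the density in Selberg's sieve. -/
noncomputable def selbergSum (s : BoundingSieve) (y : ℝ) : ℝ :=
  ∑ l ∈ s.prodPrimes.divisors, if (l : ℝ) ≤ y then s.selbergTerms l else 0

/-- The optimal Selberg weights of level `y`. -/
noncomputable def selbergWeight (s : BoundingSieve) (y : ℝ) (d : ℕ) : ℝ :=
  (s.nu d)⁻¹ * (μ d / selbergSum s y *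
    ∑ l ∈ s.prodPrimes.divisors, if d ∣ l ∧ (l : ℝ) ≤ y then s.selbergTerms l else 0)

variable {s : BoundingSieve} {y : ℝ}

theorem selbergSum_pos (hy : 1 ≤ y) : 0 < selbergSum s y := by
  refine sum_pos' (fun l hl => ?_) ⟨1, by simp [s.prodPrimes_squarefree.ne_zero], ?_⟩
  · split_ifs
    · exact (selbergTerms_pos (Nat.dvd_of_mem_divisors hl)).le
    · rfl
  · rw [if_pos (by simpa using hy)]
    exact selbergTerms_pos (one_dvd _)

theorem sum_nu_mul_selbergWeight {l : ℕ} (hl : l ∣ s.prodPrimes) :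
    (∑ d ∈ s.prodPrimes.divisors, if l ∣ d then s.nu d * selbergWeight s y d else 0) =
      if (l : ℝ) ≤ y then μ l * s.selbergTerms l / selbergSum s y else 0 := by
  have h1 : ∀ d ∈ s.prodPrimes.divisors,
      (if l ∣ d then s.nu d * selbergWeight s y d else 0) =
      ∑ m ∈ s.prodPrimes.divisors, (if (m : ℝ) ≤ y then s.selbergTerms m / selbergSum s y else 0) *
        (if l ∣ d ∧ d ∣ m then (μ d : ℝ) else 0) := by
    intro d hd
    have hnu := nu_ne_zero (s := s) (Nat.dvd_of_mem_divisors hd)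
    by_cases hld : l ∣ d
    · rw [if_pos hld, selbergWeight, mul_inv_cancel_left₀ hnu, mul_sum]
      refine sum_congr rfl fun m _ => ?_
      by_cases h1 : d ∣ m <;> by_cases h2 : (m : ℝ) ≤ y <;> simp [h1, h2, hld]
      ring
    · simp [hld]
  rw [sum_congr rfl h1, sum_comm]
  have h2 : ∀ m ∈ s.prodPrimes.divisors,
      (∑ d ∈ s.prodPrimes.divisors,
        (if (m : ℝ) ≤ y then s.selbergTerms m / selbergSum s y else 0) *
        (if l ∣ d ∧ d ∣ m then (μ d : ℝ) else 0)) =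
      if l = m then (if (m : ℝ) ≤ y then s.selbergTerms m / selbergSum s y else 0) * μ l else 0 := by
    intro m hm
    rw [← mul_sum, sum_moebius_between s.prodPrimes_squarefree (Nat.dvd_of_mem_divisors hm) hl]
    split_ifs <;> simp
  rw [sum_congr rfl h2, sum_ite_eq, if_pos (Nat.mem_divisors.2 ⟨hl, s.prodPrimes_squarefree.ne_zero⟩)]
  split_ifs <;> ring

theorem mainSum_selbergWeight (hy : 1 ≤ y) :
    s.mainSum (lambdaSquared (selbergWeight s y)) = (selbergSum s y)⁻¹ := by
  have hL := selbergSum_pos (s := s) hy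
  rw [mainSum_lambdaSquared_eq_sum_mul_sum_sq]
  have : ∀ l ∈ s.prodPrimes.divisors, (s.selbergTerms l)⁻¹ *
        (∑ d ∈ s.prodPrimes.divisors, if l ∣ d then s.nu d * selbergWeight s y d else 0) ^ 2 =
      (if (l : ℝ) ≤ y then s.selbergTerms l else 0) * (selbergSum s y ^ 2)⁻¹ := by
    intro l hl
    have hlP := Nat.dvd_of_mem_divisors hl
    rw [sum_nu_mul_selbergWeight hlP]
    have hg := (selbergTerms_pos (s := s) hlP).ne'
    have hmu : (μ l : ℝ) ^ 2 = 1 := by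
      have := moebius_sq_eq_one_of_squarefree (s.prodPrimes_squarefree.squarefree_of_dvd hlP)
      exact_mod_cast this
    split_ifs
    · field_simp
      linear_combination hmu
    · simp
  rw [sum_congr rfl this, ← sum_mul, ← selbergSum]
  field_simp

theorem selbergWeight_one (hy : 1 ≤ y) : selbergWeight s y 1 = 1 := by
  have hL := selbergSum_pos (s := s) hy
  simp only [selbergWeight, one_dvd, true_and]
  rw [← selbergSum, s.nu_mult.map_one]
  simp [hL.ne']

theorem abs_selbergWeight_le (hy : 1 ≤ y) {d : ℕ} (hd : d ∣ s.prodPrimes) :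
    |selbergWeight s y d| ≤ if (d : ℝ) ≤ y then (s.nu d)⁻¹ else 0 := by
  have hL := selbergSum_pos (s := s) hy
  have hnu := nu_pos_of_dvd_prodPrimes hd
  have hpos : ∀ l ∈ s.prodPrimes.divisors, 0 < s.selbergTerms l := fun l hl =>
    selbergTerms_pos (Nat.dvd_of_mem_divisors hl)
  split_ifs with hdy
  · have h0 : 0 ≤ ∑ l ∈ s.prodPrimes.divisors,
        if d ∣ l ∧ (l : ℝ) ≤ y then s.selbergTerms l else 0 :=
      sum_nonneg fun l hl => by split_ifs <;> [exact (hpos l hl).le; rfl]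
    have h1 : (∑ l ∈ s.prodPrimes.divisors,
        if d ∣ l ∧ (l : ℝ) ≤ y then s.selbergTerms l else 0) ≤ selbergSum s y := by
      refine sum_le_sum fun l hl => ?_
      have := (hpos l hl).le
      by_cases h1 : d ∣ l <;> by_cases h2 : (l : ℝ) ≤ y <;> simp [h1, h2, this]
    have hmu : |(μ d : ℝ)| ≤ 1 := by exact_mod_cast abs_moebius_le_one (n := d)
    rw [selbergWeight, abs_mul, abs_of_pos (inv_pos.2 hnu)]
    refine mul_le_of_le_one_right (inv_pos.2 hnu).le ?_
    rw [abs_mul, abs_div, abs_of_pos hL, abs_of_nonneg h0, div_mul_eq_mul_div, div_le_one hL]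
    nlinarith [abs_nonneg (μ d : ℝ)]
  · have : (∑ l ∈ s.prodPrimes.divisors,
        if d ∣ l ∧ (l : ℝ) ≤ y then s.selbergTerms l else 0) = 0 := by
      refine sum_eq_zero fun l hl => if_neg fun h => hdy (le_trans ?_ h.2)
      exact_mod_cast Nat.le_of_dvd (Nat.pos_of_mem_divisors hl) h.1
    simp [selbergWeight, this]

theorem errSum_lambdaSquared_le (w : ℕ → ℝ) (hrem : ∀ d : ℕ, d ∣ s.prodPrimes → |s.rem d| ≤ d) :
    s.errSum (lambdaSquared w) ≤ (∑ d ∈ s.prodPrimes.divisors, |w d| * d) ^ 2 := by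
  have h1 : ∀ d ∈ s.prodPrimes.divisors, |lambdaSquared w d| * |s.rem d| ≤
      ∑ d1 ∈ s.prodPrimes.divisors, ∑ d2 ∈ s.prodPrimes.divisors,
        if d = Nat.lcm d1 d2 then (|w d1| * d1) * (|w d2| * d2) else 0 := by
    intro d hd
    have hdP := Nat.dvd_of_mem_divisors hd
    have hsub : d.divisors ⊆ s.prodPrimes.divisors :=
      Nat.divisors_subset_of_dvd s.prodPrimes_squarefree.ne_zero hdP
    calc |lambdaSquared w d| * |s.rem d|
        ≤ (∑ d1 ∈ d.divisors, ∑ d2 ∈ d.divisors,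
          |if d = Nat.lcm d1 d2 then w d1 * w d2 else 0|) * d := by
          gcongr
          · refine (abs_sum_le_sum_abs _ _).trans (sum_le_sum fun _ _ => abs_sum_le_sum_abs _ _)
          · exact hrem d hdP
      _ ≤ ∑ d1 ∈ d.divisors, ∑ d2 ∈ d.divisors,
        if d = Nat.lcm d1 d2 then (|w d1| * d1) * (|w d2| * d2) else 0 := by
          rw [sum_mul]
          refine sum_le_sum fun d1 _ => ?_
          rw [sum_mul]
          refine sum_le_sum fun d2 _ => ?_
          split_ifs with h
          · rw [abs_mul]
            have : (d : ℝ) ≤ d1 * d2 := by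
              by_cases h0 : d1 * d2 = 0
              · rcases Nat.mul_eq_zero.1 h0 with h0 | h0 <;> simp [h, h0]
              · rw [h]
                exact_mod_cast Nat.le_of_dvd (Nat.pos_of_ne_zero h0) (Nat.lcm_dvd_mul d1 d2)
            calc |w d1| * |w d2| * d ≤ |w d1| * |w d2| * (d1 * d2) := by gcongr
              _ = _ := by ring
          · simp
      _ ≤ _ := by
          have hnn : ∀ d1 d2 : ℕ,
              0 ≤ if d = Nat.lcm d1 d2 then (|w d1| * d1) * (|w d2| * d2) else 0 := by
            intro d1 d2; split_ifs <;> positivity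
          refine (sum_le_sum fun d1 _ => sum_le_sum_of_subset_of_nonneg hsub
            fun d2 _ _ => hnn d1 d2).trans ?_
          exact sum_le_sum_of_subset_of_nonneg hsub
            fun d1 _ _ => sum_nonneg fun d2 _ => hnn d1 d2
  refine (sum_le_sum h1).trans ?_
  rw [sum_comm, sq, sum_mul]
  refine sum_le_sum fun d1 h1 => ?_
  rw [sum_comm, mul_sum]
  refine sum_le_sum fun d2 h2 => ?_
  rw [sum_ite_eq']
  split_ifs
  · rfl
  · positivity

theorem siftedSum_le_selberg (hy : 1 ≤ y) (hnu : ∀ d : ℕ, d ∣ s.prodPrimes → (s.nu d)⁻¹ ≤ d)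
    (hrem : ∀ d : ℕ, d ∣ s.prodPrimes → |s.rem d| ≤ d) :
    s.siftedSum ≤ s.totalMass / selbergSum s y + y ^ 6 := by
  refine (siftedSum_le_mainSum_errSum_of_upperMoebius _
    (upperMoebius_lambdaSquared _ (selbergWeight_one (s := s) hy))).trans ?_
  rw [mainSum_selbergWeight hy, div_eq_mul_inv]
  gcongr
  refine (errSum_lambdaSquared_le _ hrem).trans ?_
  have hnn : 0 ≤ ∑ d ∈ s.prodPrimes.divisors, |selbergWeight s y d| * d := by positivity
  have hle : ∑ d ∈ s.prodPrimes.divisors, |selbergWeight s y d| * d ≤ y ^ 3 := by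
    calc ∑ d ∈ s.prodPrimes.divisors, |selbergWeight s y d| * d
        ≤ ∑ d ∈ s.prodPrimes.divisors, if (d : ℝ) ≤ y then y ^ 2 else 0 := by
          refine sum_le_sum fun d hd => ?_
          have hdP := Nat.dvd_of_mem_divisors hd
          have h := abs_selbergWeight_le (s := s) hy hdP
          split_ifs at h ⊢ with hdy
          · calc |selbergWeight s y d| * d ≤ d * d := by gcongr; exact h.trans (hnu d hdP)
              _ ≤ y * y := by gcongr
              _ = y ^ 2 := by ring
          · rw [le_antisymm h (abs_nonneg _)]; simp
      _ = #{d ∈ s.prodPrimes.divisors | ((d : ℕ) : ℝ) ≤ y} * y ^ 2 := by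
          rw [← sum_filter, sum_const, nsmul_eq_mul]
      _ ≤ y * y ^ 2 := by
          gcongr
          have : #{d ∈ s.prodPrimes.divisors | ((d : ℕ) : ℝ) ≤ y} ≤ #(Icc 1 ⌊y⌋₊) := by
            refine card_le_card fun d hd => ?_
            simp only [mem_filter] at hd
            exact mem_Icc.2 ⟨Nat.pos_of_mem_divisors hd.1, Nat.le_floor hd.2⟩
          rw [Nat.card_Icc, Nat.add_sub_cancel] at this
          exact (Nat.cast_le.2 this).trans (Nat.floor_le (by linarith))
      _ = y ^ 3 := by ring
  calc _ ≤ (y ^ 3) ^ 2 := by gcongr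
    _ = y ^ 6 := by ring

end SelbergUpperBound

section TruncatedProduct

open Finset

/-- The part of the expansion of `∏ p ∈ S, (1 + g p)` indexed by the products of elements of `S`
that are at most `y`. -/
noncomputable def truncSum (S : Finset ℕ) (g : ℕ → ℝ) (y : ℝ) : ℝ :=
  ∑ t ∈ S.powerset, if (∏ p ∈ t, (p : ℝ)) ≤ y then ∏ p ∈ t, g p else 0

variable {S : Finset ℕ} {g h c : ℕ → ℝ} {y z : ℝ}

theorem truncSum_nonneg (hg : ∀ p ∈ S, 0 ≤ g p) : 0 ≤ truncSum S g y := by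
  refine sum_nonneg fun t ht => ?_
  split_ifs
  · exact prod_nonneg fun p hp => hg p (mem_powerset.1 ht hp)
  · rfl

theorem truncSum_mono (hg : ∀ p ∈ S, 0 ≤ g p) (hyz : y ≤ z) : truncSum S g y ≤ truncSum S g z := by
  refine sum_le_sum fun t ht => ?_
  have := prod_nonneg fun p hp => hg p (mem_powerset.1 ht hp)
  split_ifs with h1 h2 h2
  · rfl
  · exact absurd (h1.trans hyz) h2
  · exact this
  · rfl

theorem truncSum_insert {p : ℕ} (hp : p ∉ S) (hp0 : 0 < p) :
    truncSum (insert p S) g y = truncSum S g y + g p * truncSum S g (y / p) := by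
  have hp0' : (0 : ℝ) < p := by exact_mod_cast hp0
  rw [truncSum, sum_powerset_insert hp, truncSum, truncSum, mul_sum]
  congr 1
  refine sum_congr rfl fun t ht => ?_
  have hpt : p ∉ t := fun h => hp (mem_powerset.1 ht h)
  rw [prod_insert hpt, prod_insert hpt, mul_ite, mul_zero]
  simp only [le_div_iff₀' hp0']

theorem truncSum_div_le (hg : ∀ p ∈ S, 0 ≤ g p) {p : ℕ} (hp : 0 < p) (hy : 0 ≤ y) :
    truncSum S g (y / p) ≤ truncSum S g y :=
  truncSum_mono hg (div_le_self hy (by exact_mod_cast hp))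

theorem truncSum_le_prod_mul (hS : ∀ p ∈ S, 0 < p) (hg : ∀ p ∈ S, 0 ≤ g p) (hh : ∀ p ∈ S, 0 ≤ h p)
    (hc : ∀ p ∈ S, 1 ≤ c p) (hgh : ∀ p ∈ S, 1 + h p ≤ c p * (1 + g p)) (hy : 0 ≤ y) :
    truncSum S h y ≤ (∏ p ∈ S, c p) * truncSum S g y := by
  induction S using Finset.induction_on generalizing y with
  | empty => simp [truncSum]
  | insert p S hp ih =>
    simp only [forall_mem_insert] at hS hg hh hc hgh
    replace ih := fun y (hy : 0 ≤ y) => @ih y hS.2 hg.2 hh.2 hc.2 hgh.2 hy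
    have hp0 : (0 : ℝ) < p := by exact_mod_cast hS.1
    rw [truncSum_insert hp hS.1, truncSum_insert hp hS.1, prod_insert hp]
    have hC : 0 ≤ ∏ p ∈ S, c p := prod_nonneg fun q hq => zero_le_one.trans (hc.2 q hq)
    have hF := truncSum_div_le hg.2 hS.1 hy
    have hF0 := truncSum_nonneg (y := y / p) hg.2
    calc truncSum S h y + h p * truncSum S h (y / p)
        ≤ (∏ p ∈ S, c p) * truncSum S g y + h p * ((∏ p ∈ S, c p) * truncSum S g (y / p)) := by
          gcongr
          · exact ih y hy
          · exact hh.1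
          · exact ih _ (by positivity)
      _ = (∏ p ∈ S, c p) * (truncSum S g y + h p * truncSum S g (y / p)) := by ring
      _ ≤ (∏ p ∈ S, c p) * (c p * (truncSum S g y + g p * truncSum S g (y / p))) := by
          gcongr
          nlinarith [mul_nonneg (sub_nonneg.2 hc.1) (sub_nonneg.2 hF),
            mul_nonneg (sub_nonneg.2 hgh.1) hF0]
      _ = _ := by ring

theorem truncSum_mul_le (hS : ∀ p ∈ S, 0 < p) (hg : ∀ p ∈ S, 0 ≤ g p) (hy : 0 ≤ y) (hz : 0 ≤ z) :
    truncSum S g y * truncSum S g z ≤ truncSum S (fun p => 2 * g p + g p ^ 2) (y * z) := by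
  induction S using Finset.induction_on generalizing y z with
  | empty =>
    have h0 : ∀ (g : ℕ → ℝ) (y : ℝ), truncSum ∅ g y = if 1 ≤ y then 1 else 0 := by
      intro g y
      by_cases h : 1 ≤ y <;> simp [truncSum, h]
    rw [h0, h0, h0]
    by_cases h1 : 1 ≤ y
    · by_cases h2 : 1 ≤ z
      · simp [h1, h2, one_le_mul_of_one_le_of_one_le h1 h2]
      · rw [if_neg h2, mul_zero]
        split_ifs <;> norm_num
    · rw [if_neg h1, zero_mul]
      split_ifs <;> norm_num
  | insert p S hp ih =>
    simp only [forall_mem_insert] at hS hg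
    replace ih := fun y z (hy : 0 ≤ y) (hz : 0 ≤ z) => @ih y z hS.2 hg.2 hy hz
    have hp0 : (0 : ℝ) < p := by exact_mod_cast hS.1
    have hG : ∀ p ∈ S, 0 ≤ 2 * g p + g p ^ 2 := fun q hq => by
      have := hg.2 q hq
      positivity
    rw [truncSum_insert hp hS.1, truncSum_insert hp hS.1, truncSum_insert hp hS.1]
    set F := truncSum S fun p => 2 * g p + g p ^ 2 with hF
    have h1 := ih y z hy hz
    have h2 : truncSum S g (y / p) * truncSum S g z ≤ F (y * z / p) := by
      convert ih (y / p) z (by positivity) hz using 2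
      ring
    have h3 : truncSum S g y * truncSum S g (z / p) ≤ F (y * z / p) := by
      convert ih y (z / p) hy (by positivity) using 2
      ring
    have h4 : truncSum S g (y / p) * truncSum S g (z / p) ≤ F (y * z / p) := by
      refine (ih (y / p) (z / p) (by positivity) (by positivity)).trans ?_
      have := truncSum_div_le (y := y * z / p) hG hS.1 (by positivity)
      rwa [show y / p * (z / p) = y * z / p / p by ring]
    nlinarith [mul_le_mul_of_nonneg_left h2 hg.1, mul_le_mul_of_nonneg_left h3 hg.1,
      mul_le_mul_of_nonneg_left h4 (sq_nonneg (g p))]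

theorem truncSum_eq_of_subset {T : Finset ℕ} (hST : S ⊆ T) (hg : ∀ p ∈ T, p ∉ S → g p = 0) :
    truncSum S g y = truncSum T g y := by
  refine sum_subset (powerset_mono.2 hST) fun t ht hts => ?_
  rw [mem_powerset] at ht hts
  obtain ⟨p, hpt, hpS⟩ := not_subset.1 hts
  rw [prod_eq_zero hpt (hg p (ht hpt) hpS), ite_self]

theorem truncSum_congr (hgh : ∀ p ∈ S, g p = h p) : truncSum S g y = truncSum S h y := by
  refine sum_congr rfl fun t ht => ?_
  rw [prod_congr rfl fun p hp => hgh p (mem_powerset.1 ht hp)]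

theorem log_le_two_mul_truncSum (hS : ∀ p : ℕ, p.Prime → (p : ℝ) ≤ y → p ∈ S) (hy : 1 ≤ y) :
    Real.log y ≤ 2 * truncSum S (fun p => (p : ℝ)⁻¹) y := by
  have hy0 : 0 ≤ y := by linarith
  refine (log_le_harmonic_floor y hy0).trans ?_
  choose a b hab using Nat.sq_mul_squarefree
  set n := ⌊y⌋₊ with hn
  have hmem : ∀ m ∈ Icc 1 n, (b m, (a m).primeFactors) ∈ (Ioo 0 (n + 1)) ×ˢ S.powerset ∧
      ∏ p ∈ (a m).primeFactors, (p : ℝ) = a m ∧ (a m : ℝ) ≤ y := by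
    intro m hm
    rw [mem_Icc] at hm
    obtain ⟨h1, h2⟩ := hab m
    have hb0 : 0 < b m := by
      rcases Nat.eq_zero_or_pos (b m) with h | h
      · rw [h] at h1; simp at h1; omega
      · exact h
    have ha0 : 0 < a m := Nat.pos_of_ne_zero h2.ne_zero
    have ham : a m ≤ m := by
      calc a m = 1 * a m := (one_mul _).symm
        _ ≤ b m ^ 2 * a m := Nat.mul_le_mul_right _ (Nat.one_le_pow _ _ hb0)
        _ = m := h1
    have hbm : b m ≤ m := by
      calc b m = b m * 1 := (mul_one _).symm
        _ ≤ b m ^ 2 * a m := Nat.mul_le_mul (Nat.le_self_pow two_ne_zero _) ha0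
        _ = m := h1
    have hay : (a m : ℝ) ≤ y := (Nat.cast_le.2 (ham.trans hm.2)).trans (Nat.floor_le hy0)
    refine ⟨?_, ?_, hay⟩
    · rw [mem_product, mem_Ioo, mem_powerset]
      refine ⟨⟨hb0, by dsimp only; omega⟩, fun p hp => hS p (Nat.prime_of_mem_primeFactors hp) ?_⟩
      exact (Nat.cast_le.2 (Nat.le_of_mem_primeFactors hp)).trans hay
    · rw [← Nat.cast_prod, Nat.prod_primeFactors_of_squarefree h2]
  set f : ℕ × Finset ℕ → ℝ := fun q =>
    ((q.1 : ℝ) ^ 2)⁻¹ * if (∏ p ∈ q.2, (p : ℝ)) ≤ y then ∏ p ∈ q.2, (p : ℝ)⁻¹ else 0 with hf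
  have hf0 : ∀ q, 0 ≤ f q := by
    intro q
    simp only [hf]
    split_ifs <;> positivity
  have hval : ∀ m ∈ Icc 1 n, (m : ℝ)⁻¹ = f (b m, (a m).primeFactors) := by
    intro m hm
    obtain ⟨-, h1, h2⟩ := hmem m hm
    simp only [hf]
    rw [prod_inv_distrib, h1, if_pos h2, ← mul_inv]
    congr 1
    exact_mod_cast (hab m).1.symm
  have hinj : Set.InjOn (fun m => (b m, (a m).primeFactors)) (Icc 1 n : Finset ℕ) := by
    intro m hm m' hm' h
    rw [Prod.mk.injEq] at h
    rw [← (hab m).1, ← (hab m').1, h.1, ← Nat.prod_primeFactors_of_squarefree (hab m).2,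
      ← Nat.prod_primeFactors_of_squarefree (hab m').2, h.2]
  have hharm : ((harmonic n : ℚ) : ℝ) = ∑ m ∈ Icc 1 n, (m : ℝ)⁻¹ := by
    rw [harmonic_eq_sum_Icc]; push_cast; rfl
  rw [hharm, sum_congr rfl hval, ← sum_image (f := f) hinj]
  refine (sum_le_sum_of_subset_of_nonneg (t := (Ioo 0 (n + 1)) ×ˢ S.powerset) ?_
    fun q _ _ => hf0 q).trans ?_
  · intro q hq
    obtain ⟨m, hm, rfl⟩ := mem_image.1 hq
    exact (hmem m hm).1
  · rw [sum_product]
    simp only [hf]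
    simp_rw [← mul_sum]
    rw [← sum_mul]
    refine mul_le_mul_of_nonneg_right ?_ (truncSum_nonneg fun p _ => by positivity)
    have := sum_Ioo_inv_sq_le (α := ℝ) 0 (n + 1)
    simpa using this

end TruncatedProduct
section CountingResidues

open Finset

variable {A B : ℕ → Prop} [DecidablePred A] [DecidablePred B] {m k : ℕ}

theorem card_filter_range_mul_of_coprime (hm : m ≠ 0) (hk : k ≠ 0) (hmk : m.Coprime k)
    (hA : ∀ n, A (n % m) ↔ A n) (hB : ∀ n, B (n % k) ↔ B n) :
    #{n ∈ range (m * k) | A n ∧ B n} = #{n ∈ range m | A n} * #{n ∈ range k | B n} := by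
  rw [← card_product]
  refine card_bij (fun n _ => (n % m, n % k)) ?_ ?_ ?_
  · intro n hn
    simp only [mem_filter, mem_range, mem_product] at hn ⊢
    exact ⟨⟨Nat.mod_lt _ (Nat.pos_of_ne_zero hm), (hA n).2 hn.2.1⟩,
      Nat.mod_lt _ (Nat.pos_of_ne_zero hk), (hB n).2 hn.2.2⟩
  · intro n hn n' hn' h
    simp only [mem_filter, mem_range] at hn hn'
    rw [Prod.mk.injEq] at h
    exact Nat.ModEq.eq_of_lt_of_lt ((Nat.modEq_and_modEq_iff_modEq_mul hmk).1 ⟨h.1, h.2⟩)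
      hn.1 hn'.1
  · rintro ⟨u, v⟩ huv
    simp only [mem_filter, mem_range, mem_product] at huv
    have hlt := Nat.chineseRemainder_lt_mul hmk u v hm hk
    obtain ⟨h1, h2⟩ := (Nat.chineseRemainder hmk u v).2
    set n : ℕ := (Nat.chineseRemainder hmk u v).1
    have h1' : n % m = u := by rw [h1, Nat.mod_eq_of_lt huv.1.1]
    have h2' : n % k = v := by rw [h2, Nat.mod_eq_of_lt huv.2.1]
    refine ⟨n, ?_, by rw [h1', h2']⟩
    simp only [mem_filter, mem_range]
    exact ⟨hlt, (hA n).1 (h1' ▸ huv.1.2), (hB n).1 (h2' ▸ huv.2.2)⟩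

theorem card_filter_Icc_mul (hA : ∀ n, A (n % m) ↔ A n) (q : ℕ) :
    #{n ∈ Icc 1 (m * q) | A n} = q * #{n ∈ range m | A n} := by
  have hper : Function.Periodic A m := fun n => propext <| by
    rw [← hA (n + m), ← hA n, Nat.add_mod_right]
  induction q with
  | zero => simp
  | succ q ih =>
    have h1 : Icc 1 (m * (q + 1)) = Icc 1 (m * q) ∪ Ico (m * q + 1) (m * q + 1 + m) := by
      ext n
      simp only [mem_Icc, mem_union, mem_Ico, mul_add, mul_one]
      have := Nat.zero_le (m * q)
      omega
    have h2 : Disjoint (Icc 1 (m * q)) (Ico (m * q + 1) (m * q + 1 + m)) := by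
      rw [disjoint_left]
      intro n hn hn'
      simp only [mem_Icc, mem_Ico] at hn hn'
      omega
    rw [h1, filter_union, card_union_of_disjoint (disjoint_filter_filter h2), ih,
      Nat.filter_Ico_card_eq_of_periodic _ _ _ hper, Nat.count_eq_card_filter_range]
    ring

theorem abs_card_filter_Icc_sub_le (hm : m ≠ 0) (hA : ∀ n, A (n % m) ↔ A n) {x : ℝ} (hx : 0 ≤ x) :
    |(#{n ∈ Icc 1 ⌊x⌋₊ | A n} : ℝ) - #{n ∈ range m | A n} * (x / m)| ≤
      #{n ∈ range m | A n} := by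
  have hm0 : (0 : ℝ) < m := by exact_mod_cast Nat.pos_of_ne_zero hm
  set q := ⌊x / m⌋₊ with hq
  have hq1 : (q : ℝ) ≤ x / m := Nat.floor_le (by positivity)
  have hq2 : x / m < q + 1 := Nat.lt_floor_add_one _
  have h1 : m * q ≤ ⌊x⌋₊ := by
    refine Nat.le_floor ?_
    rw [le_div_iff₀ hm0] at hq1
    push_cast
    linarith
  have h2 : ⌊x⌋₊ ≤ m * (q + 1) := by
    have : (⌊x⌋₊ : ℝ) ≤ m * (q + 1) := by
      rw [div_lt_iff₀ hm0] at hq2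
      linarith [Nat.floor_le hx]
    exact_mod_cast this
  have h3 : (q * #{n ∈ range m | A n} : ℝ) ≤ #{n ∈ Icc 1 ⌊x⌋₊ | A n} := by
    rw [← Nat.cast_mul, ← card_filter_Icc_mul hA q, Nat.cast_le]
    exact card_le_card (filter_subset_filter _ (Icc_subset_Icc_right h1))
  have h4 : (#{n ∈ Icc 1 ⌊x⌋₊ | A n} : ℝ) ≤ (q + 1) * #{n ∈ range m | A n} := by
    have := card_filter_Icc_mul hA (q + 1)
    rw [← Nat.cast_add_one, ← Nat.cast_mul, ← this, Nat.cast_le]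
    exact card_le_card (filter_subset_filter _ (Icc_subset_Icc_right h2))
  have hc : (0 : ℝ) ≤ #{n ∈ range m | A n} := by positivity
  rw [abs_le]
  constructor <;> nlinarith

end CountingResidues

section ShiftedPairs

open Finset

/-- The number of residue classes `n` modulo `d` with `d ∣ n * (n + M)`. -/
def shiftRoots (M d : ℕ) : ℕ := #{n ∈ range d | d ∣ n * (n + M)}

variable {M : ℕ}

theorem dvd_mul_add_mod_iff (M d n : ℕ) : d ∣ n % d * (n % d + M) ↔ d ∣ n * (n + M) := by
  have h : n % d * (n % d + M) ≡ n * (n + M) [MOD d] :=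
    (Nat.mod_modEq n d).mul ((Nat.mod_modEq n d).add_right M)
  exact h.dvd_iff dvd_rfl

theorem dvd_add_mod_iff (M d n : ℕ) : d ∣ n % d + M ↔ d ∣ n + M :=
  ((Nat.mod_modEq n d).add_right M).dvd_iff dvd_rfl

theorem shiftRoots_mul {m k : ℕ} (hm : m ≠ 0) (hk : k ≠ 0) (hmk : m.Coprime k) :
    shiftRoots M (m * k) = shiftRoots M m * shiftRoots M k := by
  rw [shiftRoots, shiftRoots, shiftRoots, ← card_filter_range_mul_of_coprime hm hk hmk
    (dvd_mul_add_mod_iff M m) (dvd_mul_add_mod_iff M k)]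
  congr 1
  refine filter_congr fun n _ => ?_
  exact ⟨fun h => ⟨(dvd_mul_right m k).trans h, (dvd_mul_left k m).trans h⟩,
    fun h => hmk.mul_dvd_of_dvd_of_dvd h.1 h.2⟩

theorem shiftRoots_le (M d : ℕ) : shiftRoots M d ≤ d :=
  (card_filter_le _ _).trans (card_range d).le

theorem shiftRoots_pos {d : ℕ} (hd : 0 < d) : 0 < shiftRoots M d :=
  card_pos.2 ⟨0, by simp [hd]⟩

theorem two_le_shiftRoots {p : ℕ} (hp : p.Prime) (hpM : ¬ p ∣ M) : 2 ≤ shiftRoots M p := by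
  have hr : M % p ≠ 0 := fun h => hpM (Nat.dvd_of_mod_eq_zero h)
  have hlt := Nat.mod_lt M hp.pos
  have hsub : ({0, p - M % p} : Finset ℕ) ⊆ {n ∈ range p | p ∣ n * (n + M)} := by
    intro n hn
    rw [mem_insert, mem_singleton] at hn
    rw [mem_filter, mem_range]
    rcases hn with rfl | rfl
    · simp [hp.pos]
    · refine ⟨by omega, Dvd.dvd.mul_left ?_ _⟩
      refine ⟨M / p + 1, ?_⟩
      have := Nat.div_add_mod M p
      rw [mul_add, mul_one]
      omega
  have h2 : #({0, p - M % p} : Finset ℕ) = 2 := card_pair (by omega)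
  exact h2 ▸ card_le_card hsub

theorem shiftRoots_lt {p : ℕ} (hp : p.Prime) (hM : Even M) : shiftRoots M p < p := by
  obtain ⟨r, hrp, hr⟩ : ∃ r < p, ¬ p ∣ r * (r + M) := by
    by_cases h1 : p ∣ 1 * (1 + M)
    · have hp2 : p ≠ 2 := by
        rintro rfl
        have := hM.two_dvd
        omega
      have hlt : 2 < p := lt_of_le_of_ne hp.two_le (Ne.symm hp2)
      refine ⟨2, hlt, fun h => ?_⟩
      rcases (Nat.Prime.dvd_mul hp).1 h with h | h
      · exact absurd (Nat.le_of_dvd two_pos h) (by omega)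
      · have h3 : p ∣ (2 + M) - 1 * (1 + M) := Nat.dvd_sub h h1
        rw [show (2 + M) - 1 * (1 + M) = 1 by omega] at h3
        exact hp.one_lt.ne' (Nat.dvd_one.1 h3)
    · exact ⟨1, hp.one_lt, h1⟩
  calc shiftRoots M p < #(range p) := card_lt_card (filter_ssubset.2 ⟨r, mem_range.2 hrp, hr⟩)
    _ = p := card_range p

/-- The density `d ↦ shiftRoots M d / d`. -/
noncomputable def shiftDensity (M : ℕ) : ArithmeticFunction ℝ :=
  ⟨fun d => shiftRoots M d / d, by simp⟩

theorem shiftDensity_apply (M d : ℕ) : shiftDensity M d = shiftRoots M d / d := rfl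

theorem shiftDensity_isMultiplicative (M : ℕ) : (shiftDensity M).IsMultiplicative := by
  rw [ArithmeticFunction.IsMultiplicative.iff_ne_zero]
  constructor
  · simp [shiftDensity_apply, shiftRoots]
  · intro m k hm hk hmk
    rw [shiftDensity_apply, shiftDensity_apply, shiftDensity_apply, shiftRoots_mul hm hk hmk]
    push_cast
    ring

/-- The integers `n ≤ x` with `a ∣ n` and `b ∣ n + M`. -/
noncomputable def shiftSet (M a b : ℕ) (x : ℝ) : Finset ℕ :=
  {n ∈ Icc 1 ⌊x⌋₊ | a ∣ n ∧ b ∣ n + M}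

theorem abs_card_shiftSet_sub_le {a b d : ℕ} (ha : a ≠ 0) (hb : b ≠ 0) (hd : d ≠ 0)
    (hab : a.Coprime b) (habd : (a * b).Coprime d) {x : ℝ} (hx : 0 ≤ x) :
    |(#{n ∈ shiftSet M a b x | d ∣ n * (n + M)} : ℝ) - shiftDensity M d * (x / (a * b))| ≤ d := by
  have hA : ∀ n, a ∣ n % a ↔ a ∣ n := fun n => (Nat.mod_modEq n a).dvd_iff dvd_rfl
  have hab0 : a * b ≠ 0 := mul_ne_zero ha hb
  have hAB : ∀ n, (a ∣ n % (a * b) ∧ b ∣ n % (a * b) + M) ↔ (a ∣ n ∧ b ∣ n + M) := by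
    intro n
    have h := Nat.mod_modEq n (a * b)
    exact and_congr (h.dvd_iff (dvd_mul_right a b))
      ((h.add_right M).dvd_iff (dvd_mul_left b a))
  have hABD : ∀ n, ((a ∣ n % (a * b * d) ∧ b ∣ n % (a * b * d) + M) ∧
      d ∣ n % (a * b * d) * (n % (a * b * d) + M)) ↔
      ((a ∣ n ∧ b ∣ n + M) ∧ d ∣ n * (n + M)) := by
    intro n
    have h := Nat.mod_modEq n (a * b * d)
    exact and_congr (and_congr (h.dvd_iff (Dvd.intro _ (mul_assoc a b d).symm))
      ((h.add_right M).dvd_iff ((dvd_mul_left b a).mul_right d)))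
      ((h.mul (h.add_right M)).dvd_iff (dvd_mul_left d _))
  have h1 : #{n ∈ range a | a ∣ n} = 1 := by
    rw [card_eq_one]
    refine ⟨0, ?_⟩
    ext n
    simp only [mem_filter, mem_range, mem_singleton]
    refine ⟨fun h => Nat.eq_zero_of_dvd_of_lt h.2 h.1, ?_⟩
    rintro rfl
    exact ⟨Nat.pos_of_ne_zero ha, dvd_zero a⟩
  have h2 : #{n ∈ range b | b ∣ n + M} = 1 := by
    have hbp := Nat.pos_of_ne_zero hb
    have hmod := Nat.mod_lt M hbp
    have hdiv := Nat.div_add_mod M b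
    rw [card_eq_one]
    refine ⟨(b - M % b) % b, ?_⟩
    ext n
    simp only [mem_filter, mem_range, mem_singleton]
    constructor
    · rintro ⟨hn, hbn⟩
      have h3 : n + M ≡ (b - M % b) + M [MOD b] := by
        have h4 : b ∣ (b - M % b) + M := ⟨M / b + 1, by rw [mul_add, mul_one]; omega⟩
        exact ((Nat.modEq_zero_iff_dvd.2 hbn).trans (Nat.modEq_zero_iff_dvd.2 h4).symm)
      have h5 := Nat.ModEq.add_right_cancel' M h3
      rw [Nat.ModEq, Nat.mod_eq_of_lt hn] at h5
      exact h5
    · rintro rfl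
      refine ⟨Nat.mod_lt _ hbp, ?_⟩
      rw [dvd_add_mod_iff]
      exact ⟨M / b + 1, by rw [mul_add, mul_one]; omega⟩
  have h3 : #{n ∈ range (a * b * d) | (a ∣ n ∧ b ∣ n + M) ∧ d ∣ n * (n + M)} =
      shiftRoots M d := by
    rw [card_filter_range_mul_of_coprime (A := fun n => a ∣ n ∧ b ∣ n + M)
      (B := fun n => d ∣ n * (n + M)) hab0 hd habd hAB (dvd_mul_add_mod_iff M d),
      card_filter_range_mul_of_coprime (A := fun n => a ∣ n) (B := fun n => b ∣ n + M) ha hb hab hA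
        (dvd_add_mod_iff M b), h1, h2, one_mul, one_mul, shiftRoots]
  have h4 := abs_card_filter_Icc_sub_le
    (A := fun n => (a ∣ n ∧ b ∣ n + M) ∧ d ∣ n * (n + M)) (mul_ne_zero hab0 hd) hABD hx
  rw [h3] at h4
  have h5 : (shiftRoots M d : ℝ) ≤ d := by exact_mod_cast shiftRoots_le M d
  refine le_trans (le_of_eq ?_) (h4.trans h5)
  rw [shiftSet, filter_filter, shiftDensity_apply]
  congr 2
  push_cast
  have : (d : ℝ) ≠ 0 := by exact_mod_cast hd
  field_simp

/-- The primes up to `y` that do not divide `k`. -/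
noncomputable def siftingPrimes (k : ℕ) (y : ℝ) : Finset ℕ :=
  {p ∈ range (⌊y⌋₊ + 1) | p.Prime ∧ ¬ p ∣ k}

theorem prime_of_mem_siftingPrimes {k p : ℕ} {y : ℝ} (hp : p ∈ siftingPrimes k y) : p.Prime :=
  (mem_filter.1 hp).2.1

theorem primeFactors_prod_siftingPrimes (k : ℕ) (y : ℝ) :
    (∏ p ∈ siftingPrimes k y, p).primeFactors = siftingPrimes k y :=
  Nat.primeFactors_prod fun _ hp => prime_of_mem_siftingPrimes hp

theorem squarefree_prod_siftingPrimes (k : ℕ) (y : ℝ) :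
    Squarefree (∏ p ∈ siftingPrimes k y, p) := by
  refine Finset.squarefree_prod_of_pairwise_isCoprime ?_ fun p hp =>
    (prime_of_mem_siftingPrimes hp).squarefree
  intro p hp q hq hpq
  exact Nat.coprime_iff_isRelPrime.1 ((Nat.coprime_primes (prime_of_mem_siftingPrimes hp)
    (prime_of_mem_siftingPrimes hq)).2 hpq)

theorem coprime_of_dvd_prod_siftingPrimes {k d : ℕ} {y : ℝ}
    (hd : d ∣ ∏ p ∈ siftingPrimes k y, p) : k.Coprime d := by
  refine Nat.Coprime.coprime_dvd_right hd (Nat.Coprime.prod_right fun p hp => ?_)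
  exact (((prime_of_mem_siftingPrimes hp).coprime_iff_not_dvd).2 (mem_filter.1 hp).2.2).symm

/-- The sieve problem of sifting the values `n * (n + M)`, for `n` in `shiftSet M a b x`, by the
primes up to `y` not dividing `a * b`. -/
noncomputable def shiftSieve (M : ℕ) (hM : Even M) (a b : ℕ) (x y : ℝ) : BoundingSieve where
  support := (shiftSet M a b x).image fun n => n * (n + M)
  prodPrimes := ∏ p ∈ siftingPrimes (a * b) y, p
  prodPrimes_squarefree := squarefree_prod_siftingPrimes _ _
  weights := fun _ => 1
  weights_nonneg := fun _ => zero_le_one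
  totalMass := x / (a * b)
  nu := shiftDensity M
  nu_mult := shiftDensity_isMultiplicative M
  nu_pos_of_prime := fun p hp _ => by
    have h1 : (0 : ℝ) < shiftRoots M p := by exact_mod_cast shiftRoots_pos hp.pos
    have h2 : (0 : ℝ) < p := by exact_mod_cast hp.pos
    rw [shiftDensity_apply]
    positivity
  nu_lt_one_of_prime := fun p hp _ => by
    have h2 : (0 : ℝ) < p := by exact_mod_cast hp.pos
    rw [shiftDensity_apply, div_lt_one h2]
    exact_mod_cast shiftRoots_lt hp hM

theorem injective_mul_add (M : ℕ) : Function.Injective fun n : ℕ => n * (n + M) := by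
  refine StrictMono.injective fun m n (h : m < n) => ?_
  change m * (m + M) < n * (n + M)
  nlinarith

theorem siftedSum_shiftSieve (M : ℕ) (hM : Even M) (a b : ℕ) (x y : ℝ) :
    (shiftSieve M hM a b x y).siftedSum = #{n ∈ shiftSet M a b x |
      ∀ p : ℕ, p.Prime → (p : ℝ) ≤ y → ¬ p ∣ a * b → ¬ p ∣ n * (n + M)} := by
  rw [BoundingSieve.siftedSum]
  change (∑ d ∈ (shiftSet M a b x).image fun n => n * (n + M),
    if (∏ p ∈ siftingPrimes (a * b) y, p).Coprime d then (1 : ℝ) else 0) = _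
  rw [sum_image (injective_mul_add M).injOn, sum_boole]
  congr 2
  refine filter_congr fun n _ => ?_
  rw [Nat.coprime_prod_left_iff]
  constructor
  · intro h p hp hpy hpab
    refine (hp.coprime_iff_not_dvd).1 (h p (mem_filter.2 ⟨?_, hp, hpab⟩))
    rw [mem_range, Nat.lt_succ_iff]
    exact Nat.le_floor hpy
  · intro h p hp
    obtain ⟨h1, h2, h3⟩ := mem_filter.1 hp
    refine (h2.coprime_iff_not_dvd).2 (h p h2 ?_ h3)
    rw [mem_range, Nat.lt_succ_iff] at h1
    exact (Nat.le_floor_iff' h2.ne_zero).1 h1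

theorem abs_rem_shiftSieve_le (hM : Even M) {a b : ℕ} (ha : a ≠ 0) (hb : b ≠ 0)
    (hab : a.Coprime b) {x y : ℝ} (hx : 0 ≤ x) (d : ℕ)
    (hd : d ∣ (shiftSieve M hM a b x y).prodPrimes) :
    |(shiftSieve M hM a b x y).rem d| ≤ d := by
  have hd0 : d ≠ 0 := ne_zero_of_dvd_ne_zero
    (shiftSieve M hM a b x y).prodPrimes_squarefree.ne_zero hd
  refine le_trans (le_of_eq ?_) (abs_card_shiftSet_sub_le (M := M) ha hb hd0 hab
    (coprime_of_dvd_prod_siftingPrimes hd) hx)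
  rw [BoundingSieve.rem, BoundingSieve.multSum]
  change |(∑ n ∈ (shiftSet M a b x).image fun n => n * (n + M),
    if d ∣ n then (1 : ℝ) else 0) - _| = _
  rw [sum_image (injective_mul_add M).injOn, sum_boole]
  rfl

end ShiftedPairs
section SelbergSumLowerBound

open Finset BoundingSieve

theorem selbergSum_eq_truncSum (s : BoundingSieve) (y : ℝ) :
    selbergSum s y = truncSum s.prodPrimes.primeFactors s.selbergTerms y := by
  have hsq := s.prodPrimes_squarefree
  symm
  refine sum_bij' (fun t _ => ∏ p ∈ t, p) (fun d _ => d.primeFactors) ?_ ?_ ?_ ?_ ?_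
  · intro t ht
    rw [mem_powerset] at ht
    refine Nat.mem_divisors.2 ⟨?_, hsq.ne_zero⟩
    calc ∏ p ∈ t, p ∣ ∏ p ∈ s.prodPrimes.primeFactors, p := prod_dvd_prod_of_subset _ _ _ ht
      _ = s.prodPrimes := Nat.prod_primeFactors_of_squarefree hsq
  · intro d hd
    exact mem_powerset.2 (Nat.primeFactors_mono (Nat.dvd_of_mem_divisors hd) hsq.ne_zero)
  · intro t ht
    exact Nat.primeFactors_prod fun p hp => Nat.prime_of_mem_primeFactors (mem_powerset.1 ht hp)
  · intro d hd
    exact Nat.prod_primeFactors_of_squarefree (hsq.squarefree_of_dvd (Nat.dvd_of_mem_divisors hd))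
  · intro t ht
    have hp : ∀ p ∈ t, p.Prime := fun p hp => Nat.prime_of_mem_primeFactors (mem_powerset.1 ht hp)
    rw [selbergTerms_isMultiplicative.map_prod_of_prime t hp, Nat.cast_prod]

variable {M a b : ℕ}

theorem selbergTerms_shiftSieve_prime (hM : Even M) (x y : ℝ) {p : ℕ} (hp : p.Prime) :
    1 + (shiftSieve M hM a b x y).selbergTerms p = p / (p - shiftRoots M p) := by
  have hp0 : (0 : ℝ) < p := by exact_mod_cast hp.pos
  have hlt : (shiftRoots M p : ℝ) < p := by exact_mod_cast shiftRoots_lt hp hM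
  rw [selbergTerms_apply, hp.primeFactors, prod_singleton]
  simp only [shiftSieve, shiftDensity_apply]
  have : (p : ℝ) - shiftRoots M p ≠ 0 := by linarith
  field_simp
  ring

theorem log_sq_le_selbergSum (hM : Even M) (hM0 : M ≠ 0) (ha : a = 1 ∨ a.Prime)
    (hb : b = 1 ∨ b.Prime) (x : ℝ) {y : ℝ} (hy : 1 ≤ y) :
    Real.log y ^ 2 ≤ 256 * (∏ p ∈ M.primeFactors, (1 + 1 / (p : ℝ))) *
      selbergSum (shiftSieve M hM a b x y) y := by
  set s := shiftSieve M hM a b x y with hs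
  set T := siftingPrimes 1 y with hT
  have hTprime : ∀ p ∈ T, p.Prime := fun p hp => prime_of_mem_siftingPrimes hp
  have hTmem : ∀ p : ℕ, p.Prime → (p : ℝ) ≤ y → p ∈ T := by
    intro p hp hpy
    refine mem_filter.2 ⟨?_, hp, hp.not_dvd_one⟩
    rw [mem_range, Nat.lt_succ_iff]
    exact Nat.le_floor hpy
  have hTpos : ∀ p ∈ T, 0 < p := fun p hp => (hTprime p hp).pos
  set S := siftingPrimes (a * b) y with hS
  have hST : S ⊆ T := fun p hp => by
    obtain ⟨h1, h2, -⟩ := mem_filter.1 hp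
    exact mem_filter.2 ⟨h1, h2, h2.not_dvd_one⟩
  have hSP : s.prodPrimes.primeFactors = S := primeFactors_prod_siftingPrimes _ _
  have hterm_pos : ∀ p ∈ S, 0 ≤ s.selbergTerms p := fun p hp =>
    (selbergTerms_pos (Nat.dvd_of_mem_primeFactors (hSP ▸ hp))).le
  set g : ℕ → ℝ := fun p => if p ∈ S then s.selbergTerms p else 0 with hg
  have hg0 : ∀ p ∈ T, 0 ≤ g p := by
    intro p _
    by_cases h : p ∈ S
    · simpa [hg, h] using hterm_pos p h
    · simp [hg, h]
  have hL : selbergSum s y = truncSum T g y := by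
    rw [selbergSum_eq_truncSum, hSP,
      ← truncSum_eq_of_subset hST (g := g) fun p _ hp => by simp [hg, hp]]
    exact truncSum_congr fun p hp => by simp [hg, hp]
  set c1 : ℕ → ℝ := fun p => if p ∣ M then 1 + 1 / (p : ℝ) else 1 with hc1
  set c2 : ℕ → ℝ := fun p => if p ∣ a * b then 4 else 1 with hc2
  have hc1' : ∀ p, 1 ≤ c1 p := by
    intro p
    simp only [hc1]
    split_ifs
    · exact le_add_of_nonneg_right (by positivity)
    · rfl
  have hc2' : ∀ p, 1 ≤ c2 p := by
    intro p
    simp only [hc2]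
    split_ifs <;> norm_num
  have hprod1 : ∏ p ∈ T, c1 p ≤ ∏ p ∈ M.primeFactors, (1 + 1 / (p : ℝ)) := by
    rw [← prod_filter]
    refine prod_le_prod_of_subset_of_one_le (fun p hp => ?_) (fun p _ => by positivity)
      fun p _ _ => le_add_of_nonneg_right (by positivity)
    rw [mem_filter] at hp
    exact Nat.mem_primeFactors.2 ⟨hTprime p hp.1, hp.2, hM0⟩
  have hprod2 : ∏ p ∈ T, c2 p ≤ 16 := by
    rw [← prod_filter, prod_const]
    have hcard : #{p ∈ T | p ∣ a * b} ≤ 2 := by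
      refine (card_le_card (t := {a, b}) fun p hp => ?_).trans card_le_two
      rw [mem_filter] at hp
      have hpp := hTprime p hp.1
      have key : ∀ e : ℕ, (e = 1 ∨ e.Prime) → p ∣ e → p = e := by
        rintro e (rfl | he) hpe
        · exact absurd hpe hpp.not_dvd_one
        · exact (Nat.prime_dvd_prime_iff_eq hpp he).1 hpe
      rw [mem_insert, mem_singleton]
      exact ((Nat.Prime.dvd_mul hpp).1 hp.2).imp (key a ha) (key b hb)
    calc (4 : ℝ) ^ #{p ∈ T | p ∣ a * b} ≤ 4 ^ 2 := pow_le_pow_right₀ (by norm_num) hcard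
      _ = 16 := by norm_num
  have hcmp : ∀ p ∈ T, 1 + (2 * (p : ℝ)⁻¹ + (p : ℝ)⁻¹ ^ 2) ≤ c1 p * c2 p * (1 + g p) := by
    intro p hp
    have hpp := hTprime p hp
    have hp2 : (2 : ℝ) ≤ p := by exact_mod_cast hpp.two_le
    have hp0 : (0 : ℝ) < p := by linarith
    have hlhs : 1 + (2 * (p : ℝ)⁻¹ + (p : ℝ)⁻¹ ^ 2) = ((p + 1) / p) ^ 2 := by
      field_simp
      ring
    rw [hlhs]
    by_cases hpab : p ∣ a * b
    · have h1 : (4 : ℝ) ≤ c1 p * c2 p := by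
        have : c2 p = 4 := by simp [hc2, hpab]
        rw [this]
        linarith [hc1' p]
      have h2 : ((p : ℝ) + 1) / p ≤ 2 := by
        rw [div_le_iff₀ hp0]
        linarith
      have h3 : 0 ≤ ((p : ℝ) + 1) / p := by positivity
      nlinarith [mul_nonneg (show 0 ≤ c1 p * c2 p by linarith) (hg0 p hp)]
    · have hpS : p ∈ S := by
        obtain ⟨h1, h2, -⟩ := mem_filter.1 hp
        exact mem_filter.2 ⟨h1, h2, hpab⟩
      have hgp : 1 + g p = p / (p - shiftRoots M p) := by
        rw [← selbergTerms_shiftSieve_prime (a := a) (b := b) hM x y hpp]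
        simp [hg, hpS, hs]
      have hlt : (shiftRoots M p : ℝ) < p := by exact_mod_cast shiftRoots_lt hpp hM
      have hsub : (0 : ℝ) < p - shiftRoots M p := by linarith
      have hc2p : c2 p = 1 := by simp [hc2, hpab]
      rw [hgp, hc2p, mul_one, div_pow, ← mul_div_assoc, div_le_div_iff₀ (by positivity) hsub]
      by_cases hpM : p ∣ M
      · have hρ : (1 : ℝ) ≤ shiftRoots M p := by exact_mod_cast shiftRoots_pos hpp.pos
        have hc1p : c1 p * p = p + 1 := by
          simp only [hc1, hpM, if_true]
          field_simp
        rw [hc1p]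
        nlinarith [mul_le_mul_of_nonneg_left hρ (sq_nonneg ((p : ℝ) + 1))]
      · have hρ : (2 : ℝ) ≤ shiftRoots M p := by exact_mod_cast two_le_shiftRoots hpp hpM
        have hc1p : c1 p = 1 := by simp [hc1, hpM]
        rw [hc1p, one_mul]
        nlinarith [mul_le_mul_of_nonneg_left hρ (sq_nonneg ((p : ℝ) + 1))]
  have hw1 : 1 ≤ √y := Real.one_le_sqrt.2 hy
  have hy0 : 0 ≤ y := by linarith
  have hwy : √y ≤ y := by nlinarith [Real.sq_sqrt hy0]
  have hlog := log_le_two_mul_truncSum (S := T)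
    (fun p hp hpy => hTmem p hp (hpy.trans hwy)) hw1
  have hlog' : Real.log √y = Real.log y / 2 := Real.log_sqrt hy0
  have hinv : ∀ p ∈ T, (0 : ℝ) ≤ (p : ℝ)⁻¹ := fun p _ => by positivity
  have hmul := truncSum_mul_le hTpos hinv (Real.sqrt_nonneg y) (Real.sqrt_nonneg y)
  rw [Real.mul_self_sqrt hy0] at hmul
  have hle := truncSum_le_prod_mul (c := fun p => c1 p * c2 p) hTpos hg0
    (fun p _ => by positivity) (fun p _ => one_le_mul_of_one_le_of_one_le (hc1' p) (hc2' p))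
    hcmp hy0
  rw [prod_mul_distrib] at hle
  have hF0 : 0 ≤ truncSum T g y := truncSum_nonneg hg0
  have hc2nn : 0 ≤ ∏ p ∈ T, c2 p := prod_nonneg fun p _ => zero_le_one.trans (hc2' p)
  have hP0 : 0 ≤ ∏ p ∈ M.primeFactors, (1 + 1 / (p : ℝ)) := by positivity
  set U := truncSum T (fun p => (p : ℝ)⁻¹) √y
  have hlog0 : 0 ≤ Real.log y := Real.log_nonneg hy
  rw [hL]
  calc Real.log y ^ 2 ≤ 16 * (U * U) := by nlinarith
    _ ≤ 16 * ((∏ p ∈ T, c1 p) * (∏ p ∈ T, c2 p) * truncSum T g y) := by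
        linarith
    _ ≤ 16 * ((∏ p ∈ M.primeFactors, (1 + 1 / (p : ℝ))) * 16 * truncSum T g y) := by gcongr
    _ = _ := by ring

theorem card_sifted_shiftSet_le (hM : Even M) (hM0 : M ≠ 0) (ha : a = 1 ∨ a.Prime)
    (hb : b = 1 ∨ b.Prime) (hab : a.Coprime b) {x y : ℝ} (hx : 0 ≤ x) (hy : 1 < y) :
    (#{n ∈ shiftSet M a b x |
      ∀ p : ℕ, p.Prime → (p : ℝ) ≤ y → ¬ p ∣ a * b → ¬ p ∣ n * (n + M)} : ℝ) ≤
    256 * (∏ p ∈ M.primeFactors, (1 + 1 / (p : ℝ))) * (x / Real.log y ^ 2) *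
      ((a : ℝ)⁻¹ * (b : ℝ)⁻¹) + y ^ 6 := by
  have ha0 : a ≠ 0 := by rcases ha with rfl | h <;> [exact one_ne_zero; exact h.ne_zero]
  have hb0 : b ≠ 0 := by rcases hb with rfl | h <;> [exact one_ne_zero; exact h.ne_zero]
  have hrem := abs_rem_shiftSieve_le hM ha0 hb0 hab (y := y) hx
  have hlog := log_sq_le_selbergSum hM hM0 ha hb x hy.le
  have hL := selbergSum_pos (s := shiftSieve M hM a b x y) hy.le
  rw [← siftedSum_shiftSieve M hM a b x y]
  refine (siftedSum_le_selberg hy.le (fun d hd => ?_) hrem).trans ?_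
  · have hd0 : d ≠ 0 := ne_zero_of_dvd_ne_zero
      (shiftSieve M hM a b x y).prodPrimes_squarefree.ne_zero hd
    change (shiftDensity M d)⁻¹ ≤ d
    have : (1 : ℝ) ≤ shiftRoots M d := by exact_mod_cast shiftRoots_pos (Nat.pos_of_ne_zero hd0)
    rw [shiftDensity_apply, inv_div]
    exact div_le_self (by positivity) this
  · gcongr
    change x / (a * b) / _ ≤ _
    have hlogpos : 0 < Real.log y := Real.log_pos hy
    have hab0 : (0 : ℝ) ≤ x / (a * b) := by positivity
    set s := shiftSieve M hM a b x y
    set Q := ∏ p ∈ M.primeFactors, (1 + 1 / (p : ℝ))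
    have h1 : (selbergSum s y)⁻¹ ≤ 256 * Q / Real.log y ^ 2 := by
      rw [inv_le_iff_one_le_mul₀ hL, div_mul_eq_mul_div, one_le_div (by positivity)]
      exact hlog
    calc x / (a * b) / selbergSum s y = x / (a * b) * (selbergSum s y)⁻¹ := div_eq_mul_inv _ _
      _ ≤ x / (a * b) * (256 * Q / Real.log y ^ 2) := by gcongr
      _ = _ := by rw [div_eq_mul_inv x, mul_inv]; ring

end SelbergSumLowerBound

section PrimeReciprocals

open Finset

theorem sum_inv_primes_dyadic_le {K : ℕ} (hK : 1 ≤ K) :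
    ∑ p ∈ Ioc ((2 : ℕ) ^ K) ((2 : ℕ) ^ (K + 1)) with p.Prime, (p : ℝ)⁻¹ ≤ 4 * (K : ℝ)⁻¹ := by
  have hlog2 : 0 < Real.log 2 := Real.log_pos one_lt_two
  have hK0 : (0 : ℝ) < K := by exact_mod_cast hK
  have hD : (0 : ℝ) < 2 ^ K * (K * Real.log 2) := by positivity
  have h1 : ∀ p ∈ {p ∈ Ioc ((2 : ℕ) ^ K) ((2 : ℕ) ^ (K + 1)) | p.Prime},
      (p : ℝ)⁻¹ ≤ Real.log p / (2 ^ K * (K * Real.log 2)) := by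
    intro p hp
    rw [mem_filter, mem_Ioc] at hp
    have hp1 : (2 : ℝ) ^ K ≤ p := by exact_mod_cast hp.1.1.le
    have hp0 : (0 : ℝ) < p := lt_of_lt_of_le (by positivity) hp1
    have hlog : K * Real.log 2 ≤ Real.log p := by
      rw [← Real.log_pow]
      exact Real.log_le_log (by positivity) hp1
    rw [inv_eq_one_div, div_le_div_iff₀ hp0 hD, one_mul, mul_comm]
    exact mul_le_mul hlog hp1 (by positivity) (Real.log_natCast_nonneg p)
  have hθ : ∑ p ∈ Ioc ((2 : ℕ) ^ K) ((2 : ℕ) ^ (K + 1)) with p.Prime, Real.log p ≤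
      Real.log 4 * 2 ^ (K + 1) := by
    refine le_trans ?_ (Chebyshev.theta_le_log4_mul_x (x := 2 ^ (K + 1)) (by positivity))
    rw [Chebyshev.theta_eq_sum_Icc]
    refine sum_le_sum_of_subset_of_nonneg (fun p hp => ?_) fun p _ _ => Real.log_natCast_nonneg p
    rw [mem_filter, mem_Ioc] at hp
    rw [mem_filter, mem_Icc]
    refine ⟨⟨Nat.zero_le _, Nat.le_floor ?_⟩, hp.2⟩
    exact_mod_cast hp.1.2
  have hlog4 : Real.log 4 = 2 * Real.log 2 := by
    rw [show (4 : ℝ) = 2 ^ 2 by norm_num, Real.log_pow]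
    norm_num
  calc ∑ p ∈ Ioc ((2 : ℕ) ^ K) ((2 : ℕ) ^ (K + 1)) with p.Prime, (p : ℝ)⁻¹
      ≤ ∑ p ∈ Ioc ((2 : ℕ) ^ K) ((2 : ℕ) ^ (K + 1)) with p.Prime,
        Real.log p / (2 ^ K * (K * Real.log 2)) := sum_le_sum h1
    _ = (∑ p ∈ Ioc ((2 : ℕ) ^ K) ((2 : ℕ) ^ (K + 1)) with p.Prime, Real.log p) /
        (2 ^ K * (K * Real.log 2)) := by rw [sum_div]
    _ ≤ Real.log 4 * 2 ^ (K + 1) / (2 ^ K * (K * Real.log 2)) := by gcongr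
    _ = 4 * (K : ℝ)⁻¹ := by
        rw [hlog4]
        field_simp
        ring

theorem sum_inv_primes_two_pow_le (K : ℕ) :
    ∑ p ∈ Icc (1 : ℕ) ((2 : ℕ) ^ (K + 1)) with p.Prime, (p : ℝ)⁻¹ ≤ 1 + 4 * harmonic K := by
  induction K with
  | zero =>
    have : {p ∈ Icc (1 : ℕ) ((2 : ℕ) ^ (0 + 1)) | p.Prime} = {2} := by
      ext p
      simp only [mem_filter, mem_Icc, mem_singleton]
      constructor
      · rintro ⟨h, hp⟩
        have := hp.two_le
        omega
      · rintro rfl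
        exact ⟨by norm_num, Nat.prime_two⟩
    rw [this]
    norm_num
  | succ K ih =>
    have hsplit : {p ∈ Icc (1 : ℕ) ((2 : ℕ) ^ (K + 1 + 1)) | p.Prime} =
        {p ∈ Icc (1 : ℕ) ((2 : ℕ) ^ (K + 1)) | p.Prime} ∪
          {p ∈ Ioc ((2 : ℕ) ^ (K + 1)) ((2 : ℕ) ^ (K + 1 + 1)) | p.Prime} := by
      rw [← filter_union]
      congr 1
      ext n
      have h1 : 1 ≤ 2 ^ (K + 1) := Nat.one_le_two_pow
      have h2 : 2 ^ (K + 1) ≤ 2 ^ (K + 1 + 1) := Nat.pow_le_pow_right two_pos (Nat.le_succ _)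
      simp only [mem_Icc, mem_union, mem_Ioc]
      omega
    have hdisj : Disjoint {p ∈ Icc (1 : ℕ) ((2 : ℕ) ^ (K + 1)) | p.Prime}
        {p ∈ Ioc ((2 : ℕ) ^ (K + 1)) ((2 : ℕ) ^ (K + 1 + 1)) | p.Prime} := by
      rw [disjoint_left]
      intro n hn hn'
      rw [mem_filter, mem_Icc] at hn
      rw [mem_filter, mem_Ioc] at hn'
      omega
    rw [hsplit, sum_union hdisj]
    have := sum_inv_primes_dyadic_le (K := K + 1) (by omega)
    rw [harmonic_succ]
    push_cast at this ih ⊢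
    linarith

theorem sum_inv_one_or_prime_le {x : ℝ} (hx : 1 ≤ Real.log (Real.log x)) {n : ℕ}
    (hn : (n : ℝ) ≤ x) :
    ∑ p ∈ Icc (1 : ℕ) n with p = 1 ∨ p.Prime, (p : ℝ)⁻¹ ≤ 20 * Real.log (Real.log x) := by
  rcases Nat.eq_zero_or_pos n with rfl | hn0
  · simp only [Icc_eq_empty (by norm_num : ¬ (1 : ℕ) ≤ 0), filter_empty, sum_empty]
    linarith
  have hx1 : 1 ≤ x := le_trans (by exact_mod_cast hn0) hn
  have hx0 : 0 < x := by linarith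
  have hL1 : 1 ≤ Real.log x := by
    by_contra! h
    have := Real.log_nonpos (Real.log_nonneg hx1) h.le
    linarith
  have hlog2 : 0.6931471803 < Real.log 2 := Real.log_two_gt_d9
  set K := ⌈Real.log x / Real.log 2⌉₊ with hKdef
  have hK1 : Real.log x / Real.log 2 ≤ K := Nat.le_ceil _
  have hK2 : (K : ℝ) < Real.log x / Real.log 2 + 1 := Nat.ceil_lt_add_one (by positivity)
  have hK3 : (K : ℝ) ≤ 3 * Real.log x := by
    have : Real.log x / Real.log 2 ≤ 2 * Real.log x := by
      rw [div_le_iff₀ (by linarith)]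
      nlinarith
    linarith
  have hK0 : (0 : ℝ) < K := lt_of_lt_of_le (by apply div_pos <;> linarith) hK1
  have hxK : x ≤ 2 ^ K := by
    rw [div_le_iff₀ (by linarith), ← Real.log_pow] at hK1
    exact (Real.log_le_log_iff hx0 (by positivity)).mp hK1
  have hnK : n ≤ 2 ^ (K + 1) := by
    have h : n ≤ 2 ^ K := by exact_mod_cast hn.trans hxK
    exact h.trans (Nat.pow_le_pow_right two_pos (Nat.le_succ K))
  have hlogK : Real.log K ≤ 2 + Real.log (Real.log x) := by
    calc Real.log K ≤ Real.log (3 * Real.log x) := Real.log_le_log hK0 hK3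
      _ = Real.log 3 + Real.log (Real.log x) := Real.log_mul (by norm_num) (by linarith)
      _ ≤ 2 + Real.log (Real.log x) := by
        have := Real.log_le_sub_one_of_pos (show (0 : ℝ) < 3 by norm_num)
        linarith
  have hsub : {p ∈ Icc (1 : ℕ) n | p = 1 ∨ p.Prime} ⊆
      insert 1 {p ∈ Icc (1 : ℕ) ((2 : ℕ) ^ (K + 1)) | p.Prime} := by
    intro p hp
    rw [mem_filter, mem_Icc] at hp
    rw [mem_insert, mem_filter, mem_Icc]
    rcases hp.2 with h | h
    · exact Or.inl h
    · exact Or.inr ⟨⟨hp.1.1, hp.1.2.trans hnK⟩, h⟩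
  have h1 := sum_inv_primes_two_pow_le K
  have h2 := harmonic_le_one_add_log K
  calc ∑ p ∈ Icc (1 : ℕ) n with p = 1 ∨ p.Prime, (p : ℝ)⁻¹
      ≤ ∑ p ∈ insert 1 {p ∈ Icc (1 : ℕ) ((2 : ℕ) ^ (K + 1)) | p.Prime}, (p : ℝ)⁻¹ :=
        sum_le_sum_of_subset_of_nonneg hsub fun p _ _ => by positivity
    _ = 1 + ∑ p ∈ Icc (1 : ℕ) ((2 : ℕ) ^ (K + 1)) with p.Prime, (p : ℝ)⁻¹ := by
        rw [sum_insert (by simp [Nat.not_prime_one])]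
        norm_num
    _ ≤ 20 * Real.log (Real.log x) := by linarith

end PrimeReciprocals

section TwinCount

open Finset

theorem P2star.exists_mul {n : ℕ} (h : P2star n) :
    ∃ a p : ℕ, (a = 1 ∨ a.Prime) ∧ p.Prime ∧ a ^ 2 < p ∧ n = a * p := by
  rcases h with h | ⟨a, p, ha, hp, hap, rfl⟩
  · exact ⟨1, n, Or.inl rfl, h, by simpa using h.one_lt, (one_mul n).symm⟩
  · exact ⟨a, p, Or.inr ha, hp, hap, rfl⟩

theorem pow_eight_lt_of_sq_lt {a p : ℕ} {y : ℝ} (hap : a ^ 2 < p)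
    (h : y ^ 12 < (a * p : ℕ)) : y ^ 8 < p := by
  have h1 : (a : ℝ) ^ 2 ≤ p := by exact_mod_cast hap.le
  refine lt_of_pow_lt_pow_left₀ 3 (Nat.cast_nonneg p) ?_
  calc (y ^ 8) ^ 3 = (y ^ 12) ^ 2 := by ring
    _ < ((a * p : ℕ) : ℝ) ^ 2 := pow_lt_pow_left₀ h (by positivity) two_ne_zero
    _ = (a : ℝ) ^ 2 * p ^ 2 := by push_cast; ring
    _ ≤ p * p ^ 2 := by gcongr
    _ = (p : ℝ) ^ 3 := by ring

theorem le_pow_eight_of_sq_lt {a p : ℕ} {y : ℝ} (hap : a ^ 2 < p)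
    (h : ((a * p : ℕ) : ℝ) ≤ y ^ 24) : (a : ℝ) ≤ y ^ 8 := by
  have h1 : (a : ℝ) ^ 2 ≤ p := by exact_mod_cast hap.le
  refine le_of_pow_le_pow_left₀ three_ne_zero (by positivity) ?_
  calc (a : ℝ) ^ 3 = a * a ^ 2 := by ring
    _ ≤ (a : ℝ) * p := by gcongr
    _ ≤ y ^ 24 := by exact_mod_cast h
    _ = (y ^ 8) ^ 3 := by ring

/-- The `n ≤ x` with `a ∣ n` and `b ∣ n + M` such that no prime `p ≤ y` outside `a * b`
divides `n * (n + M)`. -/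
noncomputable def siftedShiftSet (M a b : ℕ) (x y : ℝ) : Finset ℕ :=
  {n ∈ shiftSet M a b x | ∀ p : ℕ, p.Prime → (p : ℝ) ≤ y → ¬ p ∣ a * b → ¬ p ∣ n * (n + M)}

theorem mem_siftedShiftSet {M a b n : ℕ} {x y : ℝ} :
    n ∈ siftedShiftSet M a b x y ↔ ((1 ≤ n ∧ n ≤ ⌊x⌋₊) ∧ a ∣ n ∧ b ∣ n + M) ∧
      ∀ p : ℕ, p.Prime → (p : ℝ) ≤ y → ¬ p ∣ a * b → ¬ p ∣ n * (n + M) := by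
  rw [siftedShiftSet, shiftSet, mem_filter, mem_filter, mem_Icc]

theorem mul_mem_siftedShiftSet {N a b p r : ℕ} {x y : ℝ} (ha : a ≠ 0) (hp : p.Prime)
    (hr : r.Prime) (hN : a * p + N = b * r) (hpy : y < p) (hry : y < r) (hx : (b * r : ℕ) ≤ x) :
    a * p ∈ siftedShiftSet N a b x y := by
  rw [mem_siftedShiftSet]
  refine ⟨⟨⟨Nat.mul_pos (Nat.pos_of_ne_zero ha) hp.pos, ?_⟩, dvd_mul_right _ _,
    hN ▸ dvd_mul_right _ _⟩, ?_⟩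
  · refine Nat.le_floor (le_trans ?_ hx)
    exact_mod_cast hN ▸ Nat.le_add_right _ _
  · intro l hl hly hlab hdvd
    rw [hN] at hdvd
    have hlp : ∀ s : ℕ, s.Prime → y < s → ¬ l ∣ s := by
      intro s hs hys hls
      rw [(Nat.prime_dvd_prime_iff_eq hl hs).mp hls] at hly
      linarith
    have hla : ¬ l ∣ a := fun h => hlab (h.mul_right b)
    have hlb : ¬ l ∣ b := fun h => hlab (h.mul_left a)
    simp only [hl.dvd_mul] at hdvd
    rcases hdvd with (h | h) | (h | h)
    exacts [hla h, hlp p hp hpy h, hlb h, hlp r hr hry h]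

theorem twin_P2star_subset {N : ℕ} (hN : Even N) (hN0 : N ≠ 0) {x y : ℝ} (hy : 2 ≤ y)
    (hxy : x = y ^ 24) :
    {q ∈ Icc 1 ⌊x⌋₊ | ((q : ℕ) : ℝ) ≤ x - N ∧ P2star q ∧ P2star (q + N)} ⊆
      Icc 1 ⌊y ^ 12⌋₊ ∪
      (({p ∈ Icc (1 : ℕ) ⌊y ^ 8⌋₊ | p = 1 ∨ p.Prime} ×ˢ
          {p ∈ Icc (1 : ℕ) ⌊y ^ 8⌋₊ | p = 1 ∨ p.Prime}).filter
            fun ab : ℕ × ℕ => ab.1.Coprime ab.2).biUnion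
          (fun ab => siftedShiftSet N ab.1 ab.2 x y) ∪
      {a ∈ N.primeFactors | Even (N / a)}.biUnion
          (fun a => (siftedShiftSet (N / a) 1 1 x y).image (a * ·)) := by
  intro q hq
  rw [mem_filter, mem_Icc] at hq
  obtain ⟨⟨hq1, -⟩, hqx, hqP, hqN⟩ := hq
  rw [mem_union, mem_union]
  by_cases hq12 : (q : ℝ) ≤ y ^ 12
  · exact Or.inl (Or.inl (mem_Icc.mpr ⟨hq1, Nat.le_floor hq12⟩))
  rw [not_le] at hq12
  obtain ⟨a, p, ha, hp, hap, rfl⟩ := hqP.exists_mul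
  obtain ⟨b, r, hb, hr, hbr, hbrq⟩ := hqN.exists_mul
  have hbrx : ((b * r : ℕ) : ℝ) ≤ x := by
    rw [← hbrq]
    push_cast at hqx ⊢
    linarith
  have hle : a * p ≤ b * r := hbrq ▸ Nat.le_add_right _ _
  have hle' : ((a * p : ℕ) : ℝ) ≤ (b * r : ℕ) := by exact_mod_cast hle
  have hy8 : y ≤ y ^ 8 := le_self_pow₀ (by linarith) (by norm_num)
  have hpy : y < p := hy8.trans_lt (pow_eight_lt_of_sq_lt hap hq12)
  have hry : y < r := hy8.trans_lt (pow_eight_lt_of_sq_lt hbr (hq12.trans_le hle'))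
  have ha8 : (a : ℝ) ≤ y ^ 8 := le_pow_eight_of_sq_lt hap ((hle'.trans hbrx).trans hxy.le)
  have hb8 : (b : ℝ) ≤ y ^ 8 := le_pow_eight_of_sq_lt hbr (hbrx.trans hxy.le)
  have ha1 : 1 ≤ a := by
    rcases ha with rfl | h
    exacts [le_rfl, h.one_le]
  have hb1 : 1 ≤ b := by
    rcases hb with rfl | h
    exacts [le_rfl, h.one_le]
  by_cases hab : a.Coprime b
  · refine Or.inl (Or.inr (mem_biUnion.mpr ⟨(a, b), ?_, ?_⟩))
    · simp only [mem_filter, mem_product, mem_Icc]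
      exact ⟨⟨⟨⟨ha1, Nat.le_floor ha8⟩, ha⟩, ⟨hb1, Nat.le_floor hb8⟩, hb⟩, hab⟩
    · exact mul_mem_siftedShiftSet (by omega) hp hr hbrq hpy hry hbrx
  · have haP : a.Prime := ha.resolve_left fun h => hab (h ▸ Nat.coprime_one_left b)
    have hbP : b.Prime := hb.resolve_left fun h => hab (h ▸ Nat.coprime_one_right a)
    obtain rfl : a = b := by
      by_contra h
      exact hab ((Nat.coprime_primes haP hbP).mpr h)
    have haN : a ∣ N := (Nat.dvd_add_right (dvd_mul_right a p)).mp (hbrq ▸ dvd_mul_right a r)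
    obtain ⟨M, rfl⟩ := haN
    have hpr : p + M = r := by
      rw [← mul_add] at hbrq
      exact Nat.eq_of_mul_eq_mul_left (by omega) hbrq
    have hodd : ∀ s : ℕ, s.Prime → y < s → Odd s := by
      intro s hs hys
      refine hs.odd_of_ne_two ?_
      rintro rfl
      push_cast at hys
      linarith
    have hMeven : Even M := by
      have h1 := hodd p hp hpy
      have h2 := hodd r hr hry
      rw [← hpr] at h2
      rcases Nat.even_or_odd M with h | h
      · exact h
      · exact absurd (h1.add_odd h) (Nat.not_even_iff_odd.mpr h2)
    have hMdiv : a * M / a = M := Nat.mul_div_cancel_left M (by omega)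
    refine Or.inr (mem_biUnion.mpr ⟨a, ?_, ?_⟩)
    · rw [mem_filter, Nat.mem_primeFactors, hMdiv]
      exact ⟨⟨haP, dvd_mul_right _ _, hN0⟩, hMeven⟩
    · rw [hMdiv, mem_image]
      refine ⟨p, ?_, rfl⟩
      have hrx : ((1 * r : ℕ) : ℝ) ≤ x := by
        refine le_trans ?_ hbrx
        exact_mod_cast Nat.mul_le_mul_right r hb1
      have := mul_mem_siftedShiftSet (N := M) (a := 1) (b := 1) one_ne_zero hp hr
        (by simpa using hpr) hpy hry hrx
      simpa using this

theorem card_siftedShiftSet_le {M a b : ℕ} (hM : Even M) (hM0 : M ≠ 0)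
    (ha : a = 1 ∨ a.Prime) (hb : b = 1 ∨ b.Prime) (hab : a.Coprime b) {x y : ℝ} (hx : 0 ≤ x)
    (hy : 1 < y) : (#(siftedShiftSet M a b x y) : ℝ) ≤
      256 * (∏ p ∈ M.primeFactors, (1 + 1 / (p : ℝ))) * (x / Real.log y ^ 2) *
        ((a : ℝ)⁻¹ * (b : ℝ)⁻¹) + y ^ 6 :=
  card_sifted_shiftSet_le hM hM0 ha hb hab hx hy

theorem sum_card_siftedShiftSet_le {N : ℕ} (hN : Even N) (hN0 : N ≠ 0) {x y : ℝ} (hx : 0 ≤ x)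
    (hy : 1 < y) {A : Finset ℕ} (hA : ∀ a ∈ A, a = 1 ∨ a.Prime) :
    ∑ ab ∈ (A ×ˢ A).filter (fun ab : ℕ × ℕ => ab.1.Coprime ab.2),
      (#(siftedShiftSet N ab.1 ab.2 x y) : ℝ) ≤
      256 * (∏ p ∈ N.primeFactors, (1 + 1 / (p : ℝ))) * (x / Real.log y ^ 2) *
        (∑ a ∈ A, (a : ℝ)⁻¹) ^ 2 + (#A : ℝ) ^ 2 * y ^ 6 := by
  set G := 256 * (∏ p ∈ N.primeFactors, (1 + 1 / (p : ℝ))) * (x / Real.log y ^ 2) with hG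
  have hG0 : 0 ≤ G := by positivity
  calc ∑ ab ∈ (A ×ˢ A).filter (fun ab : ℕ × ℕ => ab.1.Coprime ab.2),
        (#(siftedShiftSet N ab.1 ab.2 x y) : ℝ)
      ≤ ∑ ab ∈ (A ×ˢ A).filter (fun ab : ℕ × ℕ => ab.1.Coprime ab.2),
        (G * ((ab.1 : ℝ)⁻¹ * (ab.2 : ℝ)⁻¹) + y ^ 6) := by
        refine sum_le_sum fun ab hab => ?_
        rw [mem_filter, mem_product] at hab
        exact card_siftedShiftSet_le hN hN0 (hA _ hab.1.1) (hA _ hab.1.2) hab.2 hx hy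
    _ ≤ ∑ ab ∈ A ×ˢ A, (G * ((ab.1 : ℝ)⁻¹ * (ab.2 : ℝ)⁻¹) + y ^ 6) :=
        sum_le_sum_of_subset_of_nonneg (filter_subset _ _) fun ab _ _ => by positivity
    _ = G * (∑ a ∈ A, (a : ℝ)⁻¹) ^ 2 + (#A : ℝ) ^ 2 * y ^ 6 := by
        rw [sum_add_distrib, ← mul_sum, sum_const, card_product, sq (∑ a ∈ A, (a : ℝ)⁻¹),
          sum_mul_sum, ← sum_product', nsmul_eq_mul]
        push_cast
        ring

theorem prod_primeFactors_div_le {N a : ℕ} (hN0 : N ≠ 0) (ha : a ∣ N) :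
    ∏ p ∈ (N / a).primeFactors, (1 + 1 / (p : ℝ)) ≤ ∏ p ∈ N.primeFactors, (1 + 1 / (p : ℝ)) := by
  refine prod_le_prod_of_subset_of_one_le (Nat.primeFactors_mono (Nat.div_dvd_of_dvd ha) hN0)
    (fun p _ => by positivity) fun p _ _ => le_add_of_nonneg_right (by positivity)

theorem card_twin_P2star_le {N : ℕ} (hN : Even N) (hN0 : N ≠ 0) {x y : ℝ} (hy : 2 ≤ y)
    (hxy : x = y ^ 24) (hll : 1 ≤ Real.log (Real.log x)) (hlogy : Real.log x ≤ y)
    (hωll : (#N.primeFactors : ℝ) ≤ Real.log (Real.log x) ^ 2)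
    (hωy : (#N.primeFactors : ℝ) ≤ y) :
    (#{q ∈ Icc 1 ⌊x⌋₊ | ((q : ℕ) : ℝ) ≤ x - N ∧ P2star q ∧ P2star (q + N)} : ℝ) ≤
      (256 * 576 * 401 + 3) * (x * Real.log (Real.log x) ^ 2 / Real.log x ^ 2) *
        ∏ p ∈ N.primeFactors, (1 + 1 / (p : ℝ)) := by
  have hy0 : 0 < y := by linarith
  have hy1 : 1 < y := by linarith
  have hx0 : 0 < x := hxy ▸ by positivity
  have hlogx : Real.log x = 24 * Real.log y := by
    rw [hxy, Real.log_pow]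
    norm_num
  have hlogy0 : 0 < Real.log y := Real.log_pos hy1
  have hlogx0 : 0 < Real.log x := by rw [hlogx]; positivity
  set Q := ∏ p ∈ N.primeFactors, (1 + 1 / (p : ℝ)) with hQ
  set ll := Real.log (Real.log x) with hlldef
  set ω := (#N.primeFactors : ℝ) with hω
  set A := {p ∈ Icc (1 : ℕ) ⌊y ^ 8⌋₊ | p = 1 ∨ p.Prime} with hA
  set X := x / Real.log x ^ 2 with hX
  have hX0 : 0 < X := by positivity
  have hQ1 : 1 ≤ Q := by
    exact Finset.one_le_prod fun p _ => le_add_of_nonneg_right (by positivity)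
  have hXy : x / Real.log y ^ 2 = 576 * X := by
    rw [hX, hlogx]
    field_simp
    norm_num
  have hAll : ∑ a ∈ A, (a : ℝ)⁻¹ ≤ 20 * ll := by
    refine sum_inv_one_or_prime_le hll ((Nat.floor_le (by positivity)).trans ?_)
    rw [hxy]
    exact pow_le_pow_right₀ hy1.le (by norm_num)
  have hA0 : 0 ≤ ∑ a ∈ A, (a : ℝ)⁻¹ := sum_nonneg fun a _ => by positivity
  have hAcard : (#A : ℝ) ≤ y ^ 8 := by
    have h1 : #A ≤ ⌊y ^ 8⌋₊ := (card_filter_le _ _).trans (by simp)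
    exact le_trans (by exact_mod_cast h1) (Nat.floor_le (by positivity))
  have hy22 : y ^ 22 ≤ X := by
    rw [hX, le_div_iff₀ (by positivity), hxy]
    rw [hxy] at hlogy hlogx0
    calc y ^ 22 * Real.log (y ^ 24) ^ 2 ≤ y ^ 22 * y ^ 2 := by gcongr
      _ = y ^ 24 := by ring
  have hfirst : (#(Icc 1 ⌊y ^ 12⌋₊) : ℝ) ≤ y ^ 22 := by
    rw [Nat.card_Icc, Nat.add_sub_cancel]
    exact (Nat.floor_le (by positivity)).trans (pow_le_pow_right₀ hy1.le (by norm_num))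
  have hsecond : ∑ ab ∈ (A ×ˢ A).filter (fun ab : ℕ × ℕ => ab.1.Coprime ab.2),
      (#(siftedShiftSet N ab.1 ab.2 x y) : ℝ) ≤ 256 * 576 * 400 * Q * X * ll ^ 2 + y ^ 22 := by
    refine (sum_card_siftedShiftSet_le hN hN0 hx0.le hy1 fun a ha => (mem_filter.mp ha).2).trans ?_
    rw [hXy]
    calc 256 * Q * (576 * X) * (∑ a ∈ A, (a : ℝ)⁻¹) ^ 2 + (#A : ℝ) ^ 2 * y ^ 6
        ≤ 256 * Q * (576 * X) * (20 * ll) ^ 2 + (y ^ 8) ^ 2 * y ^ 6 := by gcongr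
      _ = 256 * 576 * 400 * Q * X * ll ^ 2 + y ^ 22 := by ring
  have hthird : ∑ a ∈ N.primeFactors with Even (N / a),
      (#((siftedShiftSet (N / a) 1 1 x y).image (a * ·)) : ℝ) ≤
      256 * 576 * Q * X * ll ^ 2 + y ^ 22 := by
    have hterm : ∀ a ∈ {a ∈ N.primeFactors | Even (N / a)},
        (#((siftedShiftSet (N / a) 1 1 x y).image (a * ·)) : ℝ) ≤
          256 * 576 * Q * X + y ^ 6 := by
      intro a ha
      rw [mem_filter, Nat.mem_primeFactors] at ha
      obtain ⟨⟨haP, haN, -⟩, hev⟩ := ha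
      have hM0 : N / a ≠ 0 :=
        (Nat.div_pos (Nat.le_of_dvd (Nat.pos_of_ne_zero hN0) haN) haP.pos).ne'
      have h1 := card_siftedShiftSet_le hev hM0 (Or.inl rfl) (Or.inl rfl)
        (Nat.coprime_one_left 1) hx0.le hy1
      have h2 : (#((siftedShiftSet (N / a) 1 1 x y).image (a * ·)) : ℝ) ≤
          #(siftedShiftSet (N / a) 1 1 x y) := by exact_mod_cast card_image_le
      have h3 := prod_primeFactors_div_le hN0 haN
      rw [hXy] at h1
      refine h2.trans (h1.trans ?_)
      calc _ = 256 * 576 * (∏ p ∈ (N / a).primeFactors, (1 + 1 / (p : ℝ))) * X + y ^ 6 := by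
            push_cast
            ring
        _ ≤ 256 * 576 * Q * X + y ^ 6 := by gcongr
    refine (sum_le_sum hterm).trans ?_
    rw [sum_const, nsmul_eq_mul]
    have hcard : (#{a ∈ N.primeFactors | Even (N / a)} : ℝ) ≤ ω :=
      Nat.cast_le.mpr (card_filter_le _ _)
    calc (#{a ∈ N.primeFactors | Even (N / a)} : ℝ) * (256 * 576 * Q * X + y ^ 6)
        ≤ ω * (256 * 576 * Q * X + y ^ 6) := by gcongr
      _ = 256 * 576 * Q * X * ω + ω * y ^ 6 := by ring
      _ ≤ 256 * 576 * Q * X * ll ^ 2 + y * y ^ 6 := by gcongr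
      _ ≤ 256 * 576 * Q * X * ll ^ 2 + y ^ 22 := by
        rw [← pow_succ']
        gcongr
        · exact hy1.le
        · norm_num
  have hcover := card_le_card (twin_P2star_subset hN hN0 hy hxy)
  have hcover2 : (#{q ∈ Icc 1 ⌊x⌋₊ | ((q : ℕ) : ℝ) ≤ x - N ∧ P2star q ∧ P2star (q + N)} : ℝ) ≤
      #(Icc 1 ⌊y ^ 12⌋₊) +
      ∑ ab ∈ (A ×ˢ A).filter (fun ab : ℕ × ℕ => ab.1.Coprime ab.2),
        (#(siftedShiftSet N ab.1 ab.2 x y) : ℝ) +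
      ∑ a ∈ N.primeFactors with Even (N / a),
        (#((siftedShiftSet (N / a) 1 1 x y).image (a * ·)) : ℝ) := by
    refine le_trans (Nat.cast_le.mpr hcover) ?_
    refine le_trans (Nat.cast_le.mpr ((card_union_le _ _).trans (add_le_add
      ((card_union_le _ _).trans (add_le_add le_rfl card_biUnion_le)) card_biUnion_le))) ?_
    push_cast
    exact le_rfl
  have hllQ : X ≤ X * ll ^ 2 * Q := by
    rw [mul_assoc]
    exact le_mul_of_one_le_right hX0.le (one_le_mul_of_one_le_of_one_le (one_le_pow₀ hll) hQ1)
  have hfinal : (256 * 576 * 401 + 3) * (x * ll ^ 2 / Real.log x ^ 2) * Q =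
      256 * 576 * 401 * (X * ll ^ 2 * Q) + 3 * (X * ll ^ 2 * Q) := by
    rw [hX]
    ring
  rw [hfinal]
  have e1 : 256 * 576 * 400 * Q * X * ll ^ 2 = 256 * 576 * 400 * (X * ll ^ 2 * Q) := by ring
  have e2 : 256 * 576 * Q * X * ll ^ 2 = 256 * 576 * (X * ll ^ 2 * Q) := by ring
  linarith

theorem eventually_twin_conditions (ω : ℝ) : ∀ᶠ x : ℝ in Filter.atTop,
    0 ≤ x ∧ 2 ≤ x ^ (1 / 24 : ℝ) ∧ 1 ≤ Real.log (Real.log x) ∧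
      Real.log x ≤ x ^ (1 / 24 : ℝ) ∧ ω ≤ Real.log (Real.log x) ^ 2 ∧
      ω ≤ x ^ (1 / 24 : ℝ) := by
  have hpow : Filter.Tendsto (fun x : ℝ => x ^ (1 / 24 : ℝ)) Filter.atTop Filter.atTop :=
    tendsto_rpow_atTop (by norm_num)
  have hll : Filter.Tendsto (fun x : ℝ => Real.log (Real.log x)) Filter.atTop Filter.atTop :=
    Real.tendsto_log_atTop.comp Real.tendsto_log_atTop
  have hll2 : Filter.Tendsto (fun x : ℝ => Real.log (Real.log x) ^ 2) Filter.atTop Filter.atTop :=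
    (Filter.tendsto_pow_atTop two_ne_zero).comp hll
  have hlog := (isLittleO_log_rpow_atTop (show (0 : ℝ) < 1 / 24 by norm_num)).bound one_pos
  filter_upwards [Filter.eventually_ge_atTop 0, hpow.eventually_ge_atTop 2,
    hll.eventually_ge_atTop 1, hlog, hll2.eventually_ge_atTop ω, hpow.eventually_ge_atTop ω]
    with x h0 h1 h2 h3 h4 h5
  refine ⟨h0, h1, h2, ?_, h4, h5⟩
  rw [one_mul, Real.norm_of_nonneg (Real.rpow_nonneg h0 _)] at h3
  exact (le_abs_self _).trans h3

end TwinCount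

/-- Sieve bound: for every positive even `N` and all sufficiently large `x`, the number of
`q ≤ x - N` with `q ∈ P₂*` and `q + N ∈ P₂*` is at most
`C · x (log log x)² / (log x)² · ∏_{p ∣ N} (1 + 1/p)`, with `C` absolute. -/
theorem twin_P2star_upper : ∃ C : ℝ, 0 < C ∧ ∀ N : ℕ, 0 < N → Even N →
    ∃ x₀ : ℝ, ∀ x : ℝ, x₀ ≤ x →
      (((Finset.Icc 1 ⌊x⌋₊).filter
        (fun q : ℕ => (q : ℝ) ≤ x - N ∧ P2star q ∧ P2star (q + N))).card : ℝ) ≤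
      C * (x * (Real.log (Real.log x)) ^ 2 / (Real.log x) ^ 2) *
        ∏ p ∈ N.primeFactors, (1 + 1 / (p : ℝ)) := by
  refine ⟨256 * 576 * 401 + 3, by norm_num, fun N hN0 hN => ?_⟩
  obtain ⟨x₀, hx₀⟩ :=
    Filter.eventually_atTop.mp (eventually_twin_conditions (N.primeFactors.card : ℝ))
  refine ⟨x₀, fun x hx => ?_⟩
  obtain ⟨h0, h1, h2, h3, h4, h5⟩ := hx₀ x hx
  have hxy : x = (x ^ (1 / 24 : ℝ)) ^ 24 := by
    rw [← Real.rpow_natCast, ← Real.rpow_mul h0]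
    norm_num
  exact card_twin_P2star_le hN hN0.ne' h1 hxy h2 h3 h4 h5
end

section
/- There exist a constant C > 0 and x₀ such that for all real x ≥ x₀, ∑_{n ≤ x} r(n)² ≤ C·x, where r(n) = #{(p, q) : p prime, q ∈ P₂*, n = 2^p + q}. Equivalently, the number of quadruples (p₁, p₂, q₁, q₂) with p₁, p₂ primes, q₁, q₂ ∈ P₂*, and 2^{p₁} + q₁ = 2^{p₂} + q₂ ≤ x is O(x). -/
open scoped Classical

/-- `r n` is the number of representations `n = 2 ^ p + q` with `p` prime and `q ∈ P₂*`. -/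
noncomputable def r (n : ℕ) : ℕ :=
  Set.ncard {pq : ℕ × ℕ | pq.1.Prime ∧ P2star pq.2 ∧ n = 2 ^ pq.1 + pq.2}

/-- Inclusion–exclusion sum over the sublists of `l` of length at most `k`, each weighted by
`(-1) ^ length` times the product of the values of `ν`. -/
def truncSieve (ν : ℕ → ℝ) : List ℕ → ℕ → ℝ
  | [], _ => 1
  | _ :: _, 0 => 1
  | p :: l, k + 1 => truncSieve ν l (k + 1) - ν p * truncSieve ν l k

@[simp] lemma truncSieve_zero (ν : ℕ → ℝ) (l : List ℕ) : truncSieve ν l 0 = 1 := by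
  cases l <;> rfl

lemma list_prod_one_sub_mem_Icc {ν : ℕ → ℝ} {l : List ℕ} (h : ∀ p ∈ l, 0 ≤ ν p ∧ ν p ≤ 1) :
    0 ≤ (l.map fun p => 1 - ν p).prod ∧ (l.map fun p => 1 - ν p).prod ≤ 1 := by
  induction l with
  | nil => simp
  | cons p l ih =>
    obtain ⟨h0, h1⟩ := ih fun q hq => h q (List.mem_cons_of_mem _ hq)
    obtain ⟨hp0, hp1⟩ := h p List.mem_cons_self
    simp only [List.map_cons, List.prod_cons]
    exact ⟨mul_nonneg (by linarith) h0, by nlinarith⟩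

lemma pow_succ_add_mul_pow_le {s t : ℝ} (hs : 0 ≤ s) (ht : 0 ≤ t) (n : ℕ) :
    s ^ (n + 1) + (n + 1) * t * s ^ n ≤ (s + t) ^ (n + 1) := by
  induction n with
  | zero => simp
  | succ n ih =>
    have h1 : (s + t) ^ (n + 1 + 1) = (s + t) * (s + t) ^ (n + 1) := by ring
    have h2 := mul_le_mul_of_nonneg_left ih (add_nonneg hs ht)
    have h3 : 0 ≤ (n + 1) * t * s ^ n * t := by positivity
    rw [h1]
    refine le_trans ?_ h2
    push_cast
    have h4 : (s + t) * (s ^ (n + 1) + (n + 1) * t * s ^ n) =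
        s ^ (n + 1 + 1) + (n + 1 + 1) * t * s ^ (n + 1) + (n + 1) * t * s ^ n * t := by ring
    linarith

/-- Bonferroni's inequalities for `truncSieve`, with the size of the truncation error. -/
lemma bonferroni {ν : ℕ → ℝ} {l : List ℕ} (h : ∀ p ∈ l, 0 ≤ ν p ∧ ν p ≤ 1) (k : ℕ) :
    0 ≤ (-1) ^ k * (truncSieve ν l k - (l.map fun p => 1 - ν p).prod) ∧
      (-1) ^ k * (truncSieve ν l k - (l.map fun p => 1 - ν p).prod) ≤
        (l.map ν).sum ^ (k + 1) / (k + 1).factorial := by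
  induction l generalizing k with
  | nil => cases k <;> simp [truncSieve]
  | cons p l ih =>
    have hl : ∀ q ∈ l, 0 ≤ ν q ∧ ν q ≤ 1 := fun q hq => h q (List.mem_cons_of_mem _ hq)
    obtain ⟨hp0, hp1⟩ := h p List.mem_cons_self
    obtain ⟨hP0, hP1⟩ := list_prod_one_sub_mem_Icc hl
    have hs : 0 ≤ (l.map ν).sum := List.sum_nonneg (by simpa using fun q hq => (hl q hq).1)
    simp only [List.map_cons, List.prod_cons, List.sum_cons]
    cases k with
    | zero =>
      have := ih hl 0
      simp only [truncSieve_zero, pow_zero, one_mul, zero_add, pow_one, Nat.factorial_one,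
        Nat.cast_one, div_one] at this ⊢
      constructor <;> nlinarith
    | succ k =>
      obtain ⟨a0, a1⟩ := ih hl (k + 1)
      obtain ⟨b0, b1⟩ := ih hl k
      have key : (-1 : ℝ) ^ (k + 1) * (truncSieve ν (p :: l) (k + 1) -
          (1 - ν p) * (l.map fun p => 1 - ν p).prod) =
          (-1) ^ (k + 1) * (truncSieve ν l (k + 1) - (l.map fun p => 1 - ν p).prod) +
          ν p * ((-1) ^ k * (truncSieve ν l k - (l.map fun p => 1 - ν p).prod)) := by
        simp only [truncSieve]; ring
      rw [key]
      refine ⟨add_nonneg a0 (mul_nonneg hp0 b0), ?_⟩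
      refine (add_le_add a1 (mul_le_mul_of_nonneg_left b1 hp0)).trans ?_
      have h3 := pow_succ_add_mul_pow_le hs hp0 (k + 1)
      have hf : ((k + 1 + 1).factorial : ℝ) = (k + 1 + 1) * (k + 1).factorial := by
        rw [Nat.factorial_succ]; push_cast; ring
      have hfp : (0 : ℝ) < (k + 1).factorial := by positivity
      have : (l.map ν).sum ^ (k + 1 + 1) / (k + 1 + 1).factorial +
          ν p * ((l.map ν).sum ^ (k + 1) / (k + 1).factorial) =
          ((l.map ν).sum ^ (k + 1 + 1) + ((k + 1 : ℕ) + 1) * ν p * (l.map ν).sum ^ (k + 1)) /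
            (k + 1 + 1).factorial := by
        rw [hf]; field_simp; push_cast; ring
      rw [this, add_comm (ν p)]
      gcongr

/-- The recursion for the total weight of `truncSieve` when every prime carries weight `2`. -/
def truncErr : List ℕ → ℕ → ℝ
  | [], _ => 1
  | _ :: _, 0 => 1
  | _ :: l, k + 1 => truncErr l (k + 1) + 2 * truncErr l k

@[simp] lemma truncErr_zero (l : List ℕ) : truncErr l 0 = 1 := by
  cases l <;> rfl

lemma truncErr_nonneg (l : List ℕ) (k : ℕ) : 0 ≤ truncErr l k := by
  induction l generalizing k with
  | nil => simp [truncErr]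
  | cons p l ih =>
    cases k with
    | zero => simp
    | succ k => simp only [truncErr]; linarith [ih k, ih (k + 1)]

lemma truncErr_le (l : List ℕ) (k : ℕ) : truncErr l k ≤ (1 + 2 * l.length : ℝ) ^ k := by
  induction l generalizing k with
  | nil => simp [truncErr]
  | cons p l ih =>
    cases k with
    | zero => simp
    | succ k =>
      have h := pow_succ_add_mul_pow_le (s := 1 + 2 * l.length) (t := 2) (by positivity)
        (by norm_num) k
      have h2 : 0 ≤ (k : ℝ) * 2 * (1 + 2 * l.length) ^ k := by positivity
      have h1 := ih (k + 1)
      have h0 := ih k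
      simp only [truncErr, List.length_cons]
      push_cast
      rw [show (1 + 2 * ((l.length : ℝ) + 1)) = 1 + 2 * l.length + 2 by ring]
      nlinarith

/-- `f` has mean value `M` on every progression whose modulus is coprime to the members of `S`,
with error at most `E` for the sum over an initial segment. -/
def HasMeanOn (S : Set ℕ) (f : ℕ → ℝ) (M E : ℝ) : Prop :=
  ∀ Q : ℕ, 0 < Q → (∀ p ∈ S, Q.Coprime p) → ∀ a N : ℕ,
    |∑ n ∈ (Finset.range N).filter (fun n => n ≡ a [MOD Q]), f n - N / Q * M| ≤ E

lemma HasMeanOn.mono {S T : Set ℕ} {f : ℕ → ℝ} {M E : ℝ} (h : HasMeanOn S f M E) (hST : S ⊆ T) :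
    HasMeanOn T f M E :=
  fun Q hQ hc a N => h Q hQ (fun p hp => hc p (hST hp)) a N

lemma hasMeanOn_one : HasMeanOn ∅ (fun _ => 1) 1 1 := by
  intro Q hQ _ a N
  rw [Finset.sum_const, nsmul_eq_mul, mul_one, mul_one, ← Nat.count_eq_card_filter_range,
    Nat.count_modEq_card _ hQ]
  have h1 : (N : ℝ) / Q = (N / Q : ℕ) + ((N % Q : ℕ) : ℝ) / Q := by
    have hQ' : (Q : ℝ) ≠ 0 := by positivity
    field_simp
    exact_mod_cast (Nat.div_add_mod N Q).symm
  have h2 : ((N % Q : ℕ) : ℝ) / Q ≤ 1 := by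
    rw [div_le_one (by positivity)]; exact_mod_cast (Nat.mod_lt _ hQ).le
  have h3 : 0 ≤ ((N % Q : ℕ) : ℝ) / Q := by positivity
  rw [h1]
  push_cast
  split_ifs <;> rw [abs_le] <;> constructor <;> linarith

lemma HasMeanOn.sub {S : Set ℕ} {f g : ℕ → ℝ} {M M' E E' : ℝ} (hf : HasMeanOn S f M E)
    (hg : HasMeanOn S g M' E') : HasMeanOn S (fun n => f n - g n) (M - M') (E + E') := by
  intro Q hQ hc a N
  have h1 := hf Q hQ hc a N
  have h2 := hg Q hQ hc a N
  rw [Finset.sum_sub_distrib]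
  rw [abs_le] at *
  constructor <;> linarith [h1.1, h1.2, h2.1, h2.2, mul_sub ((N : ℝ) / Q) M M']

/-- Indicator of the residue of `n` modulo `p` lying in `Ω p`. -/
noncomputable def residueInd (Ω : ℕ → Finset ℕ) (n p : ℕ) : ℝ := if n % p ∈ Ω p then 1 else 0

lemma HasMeanOn.residueInd_mul {S : Set ℕ} {f : ℕ → ℝ} {M E : ℝ} (hf : HasMeanOn S f M E)
    {Ω : ℕ → Finset ℕ} {p : ℕ} (hp : p.Prime) (hpS : ∀ q ∈ S, p.Coprime q)
    (hΩ : ∀ c ∈ Ω p, c < p) (hcard : (Ω p).card ≤ 2) (hE : 0 ≤ E) :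
    HasMeanOn (insert p S) (fun n => residueInd Ω n p * f n) ((Ω p).card / p * M) (2 * E) := by
  intro Q hQ hc a N
  have hQp : Q.Coprime p := hc p (Set.mem_insert _ _)
  have hsum : ∑ n ∈ (Finset.range N).filter (fun n => n ≡ a [MOD Q]), residueInd Ω n p * f n =
      ∑ c ∈ Ω p, ∑ n ∈ (Finset.range N).filter
        (fun n => n ≡ Nat.chineseRemainder hQp a c [MOD Q * p]), f n := by
    have : ∀ c ∈ Ω p, ∑ n ∈ (Finset.range N).filter
        (fun n => n ≡ Nat.chineseRemainder hQp a c [MOD Q * p]), f n =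
        ∑ n ∈ (Finset.range N).filter (fun n => n ≡ a [MOD Q]),
          (if c = n % p then f n else 0) := by
      intro c hcΩ
      rw [← Finset.sum_filter, Finset.filter_filter]
      refine Finset.sum_congr (Finset.filter_congr fun n _ => ?_) fun _ _ => rfl
      rw [← Nat.modEq_and_modEq_iff_modEq_mul hQp]
      have h1 := (Nat.chineseRemainder hQp a c).2.1
      have h2 := (Nat.chineseRemainder hQp a c).2.2
      have h3 : c % p = c := Nat.mod_eq_of_lt (hΩ c hcΩ)
      constructor
      · rintro ⟨u, v⟩
        exact ⟨u.trans h1, by rw [← h3]; exact (v.trans h2).symm⟩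
      · rintro ⟨u, v⟩
        refine ⟨u.trans h1.symm, Nat.ModEq.trans ?_ h2.symm⟩
        change n % p = c % p
        rw [h3, v]
    rw [Finset.sum_congr rfl this, Finset.sum_comm]
    refine Finset.sum_congr rfl fun n _ => ?_
    rw [Finset.sum_ite_eq' ]
    simp [residueInd]
  have hb : ∀ c ∈ Ω p, |∑ n ∈ (Finset.range N).filter
      (fun n => n ≡ Nat.chineseRemainder hQp a c [MOD Q * p]), f n -
        N / (Q * p : ℕ) * M| ≤ E := by
    intro c _
    refine hf (Q * p) (Nat.mul_pos hQ hp.pos) (fun q hq => ?_) _ N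
    exact Nat.Coprime.mul_left (hc q (Set.mem_insert_of_mem _ hq)) (hpS q hq)
  have hmain : (N : ℝ) / Q * ((Ω p).card / p * M) = ∑ c ∈ Ω p, (N : ℝ) / (Q * p : ℕ) * M := by
    have hp0 : (p : ℝ) ≠ 0 := by exact_mod_cast hp.ne_zero
    have hQ0 : (Q : ℝ) ≠ 0 := by positivity
    rw [Finset.sum_const, nsmul_eq_mul]
    push_cast
    field_simp
  rw [hsum, hmain, ← Finset.sum_sub_distrib]
  refine (Finset.abs_sum_le_sum_abs _ _).trans ((Finset.sum_le_sum hb).trans ?_)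
  rw [Finset.sum_const, nsmul_eq_mul]
  have : ((Ω p).card : ℝ) ≤ 2 := by exact_mod_cast hcard
  nlinarith

/-- Proportion of the residue classes modulo `p` that lie in `Ω p`. -/
noncomputable def residueDensity (Ω : ℕ → Finset ℕ) (p : ℕ) : ℝ := (Ω p).card / p

lemma HasMeanOn.truncSieve_mul {S : Set ℕ} {f : ℕ → ℝ} {M E : ℝ} (hf : HasMeanOn S f M E)
    {Ω : ℕ → Finset ℕ} (hE : 0 ≤ E) {l : List ℕ} (hnd : l.Nodup) (hl : ∀ p ∈ l, p.Prime)
    (hlS : ∀ p ∈ l, ∀ q ∈ S, p.Coprime q) (hΩ : ∀ p ∈ l, ∀ c ∈ Ω p, c < p)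
    (hcard : ∀ p ∈ l, (Ω p).card ≤ 2) (k : ℕ) :
    HasMeanOn ({p | p ∈ l} ∪ S) (fun n => truncSieve (residueInd Ω n) l k * f n)
      (truncSieve (residueDensity Ω) l k * M) (truncErr l k * E) := by
  induction l generalizing k with
  | nil => simpa [truncSieve, truncErr] using hf
  | cons p l ih =>
    cases k with
    | zero => simpa using hf.mono Set.subset_union_right
    | succ k =>
      simp only [List.mem_cons, forall_eq_or_imp] at hl hlS hΩ hcard
      rw [List.nodup_cons] at hnd
      have ih' := ih hnd.2 hl.2 hlS.2 hΩ.2 hcard.2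
      have h1 := (ih' k).residueInd_mul (Ω := Ω) hl.1 ?_ hΩ.1 hcard.1
        (mul_nonneg (truncErr_nonneg _ _) hE)
      · have h2 := ((ih' (k + 1)).mono (Set.subset_insert p _)).sub h1
        have hset : ({q | q ∈ p :: l} ∪ S : Set ℕ) = insert p ({q | q ∈ l} ∪ S) := by
          ext q; simp [or_assoc]
        rw [hset]
        convert h2 using 1
        · funext n; simp only [truncSieve]; ring
        · simp only [truncSieve, residueDensity]; ring
        · simp only [truncErr]; ring
      · rintro q (hq | hq)
        · rw [Nat.coprime_primes hl.1 (hl.2 q hq)]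
          rintro rfl
          exact hnd.1 hq
        · exact hlS.1 q hq

lemma Nat.Prime.pow_div_dvd_factorial {p : ℕ} (hp : p.Prime) (n : ℕ) :
    p ^ (n / p) ∣ n.factorial := by
  rw [hp.pow_dvd_factorial_iff (b := Nat.log p n + 2) (by omega)]
  have h := Finset.single_le_sum (s := Finset.Ico 1 (Nat.log p n + 2)) (f := fun i => n / p ^ i)
    (fun _ _ => Nat.zero_le _) (show 1 ∈ Finset.Ico 1 (Nat.log p n + 2) by simp)
  simpa using h

/-- One half of Mertens' first theorem. -/
lemma sum_log_div_prime_le {n : ℕ} (hn : 0 < n) :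
    ∑ p ∈ (Finset.range (n + 1)).filter Nat.Prime, Real.log p / p ≤ Real.log n + Real.log 4 := by
  set s := (Finset.range (n + 1)).filter Nat.Prime with hs
  have hprime : ∀ p ∈ s, p.Prime := fun p hp => (Finset.mem_filter.1 hp).2
  have hdvd : ∏ p ∈ s, p ^ (n / p) ∣ n.factorial := by
    refine Finset.prod_dvd_of_isRelPrime ?_ fun p hp => (hprime p hp).pow_div_dvd_factorial n
    intro p hp q hq hpq
    exact Nat.coprime_iff_isRelPrime.1
      (Nat.Coprime.pow _ _ ((Nat.coprime_primes (hprime p hp) (hprime q hq)).2 hpq))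
  have hle : ∏ p ∈ s, p ^ (n / p) ≤ n ^ n :=
    (Nat.le_of_dvd n.factorial_pos hdvd).trans (Nat.factorial_le_pow n)
  have hlog : ∑ p ∈ s, (n / p : ℕ) * Real.log p ≤ n * Real.log n := by
    have h1 : ((∏ p ∈ s, p ^ (n / p) : ℕ) : ℝ) ≤ (n : ℝ) ^ n := by exact_mod_cast hle
    have h2 := Real.log_le_log (by
      exact_mod_cast Finset.prod_pos fun p hp => pow_pos (hprime p hp).pos _) h1
    rw [Nat.cast_prod, Real.log_prod (fun p hp => by
      exact_mod_cast (pow_pos (hprime p hp).pos _).ne'), Real.log_pow] at h2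
    simpa [Real.log_pow] using h2
  have htheta : ∑ p ∈ s, Real.log p ≤ Real.log 4 * n := by
    have := Chebyshev.theta_le_log4_mul_x (x := n) (by positivity)
    rw [Chebyshev.theta_eq_sum_primesLE_log] at this
    convert this using 2
    ext p
    simp [hs, Nat.mem_primesLE]
  have hn0 : (0 : ℝ) < n := by exact_mod_cast hn
  have hterm : ∀ p ∈ s, n * (Real.log p / p) ≤ (n / p : ℕ) * Real.log p + Real.log p := by
    intro p hp
    have hp0 : (0 : ℝ) < p := by exact_mod_cast (hprime p hp).pos
    have h1 : (n : ℝ) / p ≤ (n / p : ℕ) + 1 := by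
      rw [div_le_iff₀ hp0]
      have := (Nat.lt_div_mul_add (a := n) (hprime p hp).pos).le
      have h2 : (n : ℝ) ≤ (n / p : ℕ) * p + p := by exact_mod_cast this
      linarith
    have h0 : 0 ≤ Real.log p := Real.log_natCast_nonneg p
    have : (n : ℝ) * (Real.log p / p) = n / p * Real.log p := by ring
    rw [this]
    nlinarith
  have hfin := Finset.sum_le_sum hterm
  rw [← Finset.mul_sum, Finset.sum_add_distrib] at hfin
  have : n * ∑ p ∈ s, Real.log p / p ≤ n * (Real.log n + Real.log 4) := by linarith
  exact le_of_mul_le_mul_left this hn0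

/-- The sum of reciprocals of primes over a doubly dyadic block is at most `4`. -/
lemma sum_inv_prime_block_le (i : ℕ) (s : Finset ℕ)
    (hs : ∀ p ∈ s, p.Prime ∧ 2 ^ 2 ^ i ≤ p ∧ p < 2 ^ 2 ^ (i + 1)) :
    ∑ p ∈ s, (1 : ℝ) / p ≤ 4 := by
  have h2 : (0 : ℝ) < Real.log 2 := Real.log_pos (by norm_num)
  have h1 := sum_log_div_prime_le (n := 2 ^ 2 ^ (i + 1)) (by positivity)
  have h3 : ∑ p ∈ s, Real.log p / p ≤ ∑ p ∈ (Finset.range (2 ^ 2 ^ (i + 1) + 1)).filter Nat.Prime,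
      Real.log p / p := by
    refine Finset.sum_le_sum_of_subset_of_nonneg (fun p hp => ?_) fun p _ _ =>
      div_nonneg (Real.log_natCast_nonneg p) (by positivity)
    have := hs p hp
    simp only [Finset.mem_filter, Finset.mem_range]
    exact ⟨by omega, this.1⟩
  have h4 : ∀ p ∈ s, 2 ^ i * Real.log 2 * ((1 : ℝ) / p) ≤ Real.log p / p := by
    intro p hp
    have hp0 : (0 : ℝ) < p := by exact_mod_cast (hs p hp).1.pos
    rw [mul_one_div]
    refine div_le_div_of_nonneg_right ?_ hp0.le
    have h5 : ((2 : ℝ) ^ 2 ^ i) ≤ p := by exact_mod_cast (hs p hp).2.1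
    have := Real.log_le_log (by positivity) h5
    rw [Real.log_pow] at this
    exact_mod_cast this
  have h5 := (Finset.sum_le_sum h4).trans (h3.trans h1)
  rw [← Finset.mul_sum] at h5
  push_cast at h5
  rw [Real.log_pow, show Real.log 4 = 2 * Real.log 2 by
    rw [show (4 : ℝ) = 2 ^ 2 by norm_num, Real.log_pow]; norm_num] at h5
  push_cast at h5
  have h6 : (1 : ℝ) ≤ 2 ^ i := one_le_pow₀ (by norm_num)
  have h7 : 2 ^ i * Real.log 2 * ∑ p ∈ s, (1 : ℝ) / p ≤ 2 ^ i * Real.log 2 * 4 := by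
    refine h5.trans ?_
    rw [pow_succ]
    nlinarith
  exact le_of_mul_le_mul_left h7 (by positivity)

/-- The doubly dyadic block containing `p`. -/
lemma exists_block {p : ℕ} (hp : 2 ≤ p) : ∃ i, 2 ^ 2 ^ i ≤ p ∧ p < 2 ^ 2 ^ (i + 1) := by
  have hl : Nat.log 2 p ≠ 0 := (Nat.log_pos (by norm_num) hp).ne'
  refine ⟨Nat.log 2 (Nat.log 2 p), ?_, ?_⟩
  · exact (Nat.pow_le_pow_right (by norm_num) (Nat.pow_log_le_self 2 hl)).trans
      (Nat.pow_log_le_self 2 (by omega))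
  · refine (Nat.lt_pow_succ_log_self (by norm_num : 1 < 2) p).trans_le
      (Nat.pow_le_pow_right (by norm_num) ?_)
    exact Nat.lt_pow_succ_log_self (by norm_num : 1 < 2) _

lemma sum_inv_prime_le (J : ℕ) (s : Finset ℕ) (hs : ∀ p ∈ s, p.Prime ∧ p < 2 ^ 2 ^ J) :
    ∑ p ∈ s, (1 : ℝ) / p ≤ 4 * J := by
  induction J generalizing s with
  | zero =>
    rw [Finset.sum_eq_zero fun p hp => ?_]
    · simp
    · have := (hs p hp).1.two_le
      have := (hs p hp).2
      norm_num at this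
      omega
  | succ J ih =>
    rw [← Finset.sum_filter_add_sum_filter_not s (fun p => p < 2 ^ 2 ^ J)]
    have h1 := ih (s.filter fun p => p < 2 ^ 2 ^ J) fun p hp => by
      rw [Finset.mem_filter] at hp; exact ⟨(hs p hp.1).1, hp.2⟩
    have h2 := sum_inv_prime_block_le J (s.filter fun p => ¬ p < 2 ^ 2 ^ J) fun p hp => by
      rw [Finset.mem_filter] at hp; exact ⟨(hs p hp.1).1, by omega, (hs p hp.1).2⟩
    push_cast
    linarith

/-- Mertens' product: an upper bound for the product of `1 - 1 / p` over `p < N`. -/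
lemma log_mul_prod_primesBelow_le (N : ℕ) (hN : 0 < N) :
    Real.log N * ∏ p ∈ Nat.primesBelow N, (1 - (1 : ℝ) / p) ≤ 1 := by
  let f : ℕ →* ℝ :=
    { toFun := fun n => (n : ℝ)⁻¹, map_one' := by simp, map_mul' := fun a b => by
        push_cast; rw [mul_inv] }
  have hf : ∀ {p : ℕ}, p.Prime → ‖f p‖ < 1 := by
    intro p hp
    have : (1 : ℝ) < p := by exact_mod_cast hp.one_lt
    change ‖(p : ℝ)⁻¹‖ < 1
    rw [Real.norm_of_nonneg (by positivity)]
    exact inv_lt_one_of_one_lt₀ this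
  obtain ⟨-, h⟩ := EulerProduct.summable_and_hasSum_smoothNumbers_prod_primesBelow_geometric
    (f := f) hf N
  have hharm : ∑ n ∈ Finset.Ico 1 N, (n : ℝ)⁻¹ ≤ ∏ p ∈ Nat.primesBelow N, (1 - f p)⁻¹ := by
    have hmem : ∀ n ∈ Finset.Ico 1 N, n ∈ Nat.smoothNumbers N := by
      intro n hn
      rw [Finset.mem_Ico] at hn
      exact Nat.mem_smoothNumbers_of_lt (by omega) hn.2
    rw [← Finset.sum_attach]
    have := sum_le_hasSum ((Finset.Ico 1 N).attach.map
      ⟨fun n => (⟨n.1, hmem n.1 n.2⟩ : Nat.smoothNumbers N), fun a b hab => by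
        apply Subtype.ext; simpa using hab⟩)
      (fun _ _ => by change 0 ≤ ((_ : ℕ) : ℝ)⁻¹; positivity) h
    rw [Finset.sum_map] at this
    exact this
  have hlog : Real.log N ≤ ∑ n ∈ Finset.Ico 1 N, (n : ℝ)⁻¹ := by
    obtain ⟨M, rfl⟩ : ∃ M, N = M + 1 := ⟨N - 1, by omega⟩
    refine (log_add_one_le_harmonic M).trans (le_of_eq ?_)
    rw [harmonic_eq_sum_Icc]
    push_cast
    rfl
  have hpos : 0 < ∏ p ∈ Nat.primesBelow N, (1 - (1 : ℝ) / p) := by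
    refine Finset.prod_pos fun p hp => ?_
    have : (1 : ℝ) < p := by exact_mod_cast (Nat.prime_of_mem_primesBelow hp).one_lt
    rw [sub_pos, div_lt_one (by linarith)]
    exact this
  have heq : ∏ p ∈ Nat.primesBelow N, (1 - f p)⁻¹ =
      (∏ p ∈ Nat.primesBelow N, (1 - (1 : ℝ) / p))⁻¹ := by
    rw [← Finset.prod_inv_distrib]
    refine Finset.prod_congr rfl fun p _ => ?_
    rw [one_div]; rfl
  rw [heq] at hharm
  calc _ ≤ (∏ p ∈ Nat.primesBelow N, (1 - (1 : ℝ) / p))⁻¹ *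
        ∏ p ∈ Nat.primesBelow N, (1 - (1 : ℝ) / p) := by
        gcongr; exact hlog.trans hharm
    _ = 1 := inv_mul_cancel₀ hpos.ne'

/-- The members of `P` in the `i`-th doubly dyadic block. -/
noncomputable def primeBlock (P : Finset ℕ) (i : ℕ) : List ℕ :=
  (P.filter fun p => 2 ^ 2 ^ i ≤ p ∧ p < 2 ^ 2 ^ (i + 1)).toList

lemma mem_primeBlock {P : Finset ℕ} {i p : ℕ} :
    p ∈ primeBlock P i ↔ p ∈ P ∧ 2 ^ 2 ^ i ≤ p ∧ p < 2 ^ 2 ^ (i + 1) := by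
  simp [primeBlock]

lemma prod_primeBlock {P : Finset ℕ} (hP : ∀ p ∈ P, 2 ≤ p) (g : ℕ → ℝ) (t : ℕ) :
    ∏ i ∈ Finset.range t, ((primeBlock P i).map g).prod =
      ∏ p ∈ P.filter (fun p => p < 2 ^ 2 ^ t), g p := by
  induction t with
  | zero =>
    rw [Finset.filter_false_of_mem]
    · simp
    · intro p hp; have := hP p hp; norm_num; omega
  | succ t ih =>
    rw [Finset.prod_range_succ, ih, primeBlock, Finset.prod_map_toList, ← Finset.prod_union]
    · refine Finset.prod_congr ?_ fun _ _ => rfl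
      ext p
      have : 2 ^ 2 ^ t ≤ 2 ^ 2 ^ (t + 1) :=
        Nat.pow_le_pow_right (by norm_num) (Nat.pow_le_pow_right (by norm_num) (by omega))
      simp only [Finset.mem_union, Finset.mem_filter]
      constructor
      · rintro (⟨h1, h2⟩ | ⟨h1, h2, h3⟩)
        · exact ⟨h1, by omega⟩
        · exact ⟨h1, h3⟩
      · rintro ⟨h1, h2⟩
        by_cases h : p < 2 ^ 2 ^ t
        · exact Or.inl ⟨h1, h⟩
        · exact Or.inr ⟨h1, by omega, h2⟩
    · rw [Finset.disjoint_left]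
      intro p h1 h2
      rw [Finset.mem_filter] at h1 h2
      omega

lemma hasMeanOn_prod_truncSieve {P : Finset ℕ} (hP : ∀ p ∈ P, p.Prime) {Ω : ℕ → Finset ℕ}
    (hΩ : ∀ p ∈ P, ∀ c ∈ Ω p, c < p) (hcard : ∀ p ∈ P, (Ω p).card ≤ 2) (k : ℕ → ℕ) (t : ℕ) :
    HasMeanOn {p | p ∈ P ∧ p < 2 ^ 2 ^ t}
      (fun n => ∏ i ∈ Finset.range t, truncSieve (residueInd Ω n) (primeBlock P i) (k i))
      (∏ i ∈ Finset.range t, truncSieve (residueDensity Ω) (primeBlock P i) (k i))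
      (∏ i ∈ Finset.range t, truncErr (primeBlock P i) (k i)) := by
  induction t with
  | zero => simpa using hasMeanOn_one.mono (Set.empty_subset _)
  | succ t ih =>
    have h := ih.truncSieve_mul (Ω := Ω)
      (Finset.prod_nonneg fun _ _ => truncErr_nonneg _ _) (l := primeBlock P t)
      (Finset.nodup_toList _) (fun p hp => hP p (mem_primeBlock.1 hp).1) ?_
      (fun p hp => hΩ p (mem_primeBlock.1 hp).1) (fun p hp => hcard p (mem_primeBlock.1 hp).1) (k t)
    · simp only [Finset.prod_range_succ_comm]
      refine h.mono ?_
      have : 2 ^ 2 ^ t ≤ 2 ^ 2 ^ (t + 1) :=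
        Nat.pow_le_pow_right (by norm_num) (Nat.pow_le_pow_right (by norm_num) (by omega))
      rintro p (hp | hp)
      · exact ⟨(mem_primeBlock.1 hp).1, (mem_primeBlock.1 hp).2.2⟩
      · exact ⟨hp.1, hp.2.trans_le this⟩
    · intro p hp q hq
      have hp' := mem_primeBlock.1 hp
      rw [Nat.coprime_primes (hP p hp'.1) (hP q hq.1)]
      rintro rfl
      exact absurd hq.2 (by omega)

/-- Bounds for a block with an even truncation level. -/
lemma truncSieve_block_le {P : Finset ℕ} (hP : ∀ p ∈ P, p.Prime ∧ 3 ≤ p) {Ω : ℕ → Finset ℕ}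
    (hcard : ∀ p ∈ P, (Ω p).card ≤ 2) (i b : ℕ) :
    0 ≤ truncSieve (residueDensity Ω) (primeBlock P i) (2 * b) ∧
    truncSieve (residueDensity Ω) (primeBlock P i) (2 * b) ≤
      ((primeBlock P i).map fun p => 1 - residueDensity Ω p).prod *
        Real.exp (Real.exp 16 * (8 ^ (2 * b + 1) / (2 * b + 1).factorial)) := by
  have hdens : ∀ p ∈ P, residueDensity Ω p ≤ 2 * (1 / p) := by
    intro p hp
    have : ((Ω p).card : ℝ) ≤ 2 := by exact_mod_cast hcard p hp
    rw [residueDensity, mul_one_div]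
    gcongr
  have hinv : ∀ p ∈ P, (1 : ℝ) / p ≤ 1 / 3 := by
    intro p hp
    have : (3 : ℝ) ≤ p := by exact_mod_cast (hP p hp).2
    exact one_div_le_one_div_of_le (by norm_num) this
  have h01 : ∀ p ∈ primeBlock P i, 0 ≤ residueDensity Ω p ∧ residueDensity Ω p ≤ 1 := by
    intro p hp
    have hp' := (mem_primeBlock.1 hp).1
    refine ⟨by unfold residueDensity; positivity, ?_⟩
    linarith [hdens p hp', hinv p hp']
  obtain ⟨h0, h1⟩ := bonferroni h01 (2 * b)
  rw [pow_mul, neg_one_sq, one_pow, one_mul] at h0 h1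
  set V := ((primeBlock P i).map fun p => 1 - residueDensity Ω p).prod with hV
  have hsum : ((primeBlock P i).map (residueDensity Ω)).sum ≤ 8 := by
    rw [primeBlock, Finset.sum_map_toList]
    have h4 := sum_inv_prime_block_le i
      (P.filter fun p => 2 ^ 2 ^ i ≤ p ∧ p < 2 ^ 2 ^ (i + 1)) fun p hp => by
        rw [Finset.mem_filter] at hp; exact ⟨(hP p hp.1).1, hp.2⟩
    refine (Finset.sum_le_sum fun p hp => hdens p (Finset.mem_filter.1 hp).1).trans ?_
    rw [← Finset.mul_sum]
    linarith
  have hsum0 : 0 ≤ ((primeBlock P i).map (residueDensity Ω)).sum :=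
    List.sum_nonneg (by simpa using fun q hq => (h01 q hq).1)
  have hexp : ∀ u : ℝ, 0 ≤ u → u ≤ 2 / 3 → Real.exp (-(2 * u)) ≤ 1 - u := by
    intro u hu0 hu
    have h3 : 1 + 2 * u + (2 * u) ^ 2 / 2 ≤ Real.exp (2 * u) :=
      Real.quadratic_le_exp_of_nonneg (by linarith)
    rw [Real.exp_neg, inv_le_comm₀ (Real.exp_pos _) (by linarith)]
    refine le_trans ?_ h3
    rw [inv_le_iff_one_le_mul₀ (by linarith)]
    nlinarith [mul_nonneg hu0 (sub_nonneg.2 hu), mul_nonneg (mul_nonneg hu0 hu0) (sub_nonneg.2 hu)]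
  have hVlow : Real.exp (-16) ≤ V := by
    calc Real.exp (-16) ≤ Real.exp (-(2 * ((primeBlock P i).map (residueDensity Ω)).sum)) := by
          apply Real.exp_le_exp.2; linarith
      _ ≤ V := by
        rw [hV, primeBlock, Finset.sum_map_toList, Finset.prod_map_toList, Finset.mul_sum,
          ← Finset.sum_neg_distrib, Real.exp_sum]
        refine Finset.prod_le_prod (fun _ _ => (Real.exp_pos _).le) fun p hp => ?_
        have hp' := (Finset.mem_filter.1 hp).1
        refine hexp _ (by unfold residueDensity; positivity) ?_
        linarith [hdens p hp', hinv p hp']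
  have hV0 : 0 < V := (Real.exp_pos _).trans_le hVlow
  refine ⟨by linarith, ?_⟩
  set e : ℝ := 8 ^ (2 * b + 1) / (2 * b + 1).factorial with he
  have he0 : 0 ≤ e := by positivity
  have h2 : ((primeBlock P i).map (residueDensity Ω)).sum ^ (2 * b + 1) / (2 * b + 1).factorial
      ≤ e := by rw [he]; gcongr
  have h3 : 1 ≤ V * Real.exp 16 := by
    have := mul_le_mul_of_nonneg_right hVlow (Real.exp_pos 16).le
    rwa [← Real.exp_add, neg_add_cancel, Real.exp_zero] at this
  have h4 : Real.exp 16 * e + 1 ≤ Real.exp (Real.exp 16 * e) := Real.add_one_le_exp _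
  nlinarith [mul_le_mul_of_nonneg_left h4 hV0.le]

lemma truncErr_primeBlock_le (P : Finset ℕ) (i k : ℕ) :
    truncErr (primeBlock P i) k ≤ ((2 : ℝ) ^ 2 ^ (i + 2)) ^ k := by
  refine (truncErr_le _ _).trans (pow_le_pow_left₀ (by positivity) ?_ _)
  have h1 : (primeBlock P i).length ≤ 2 ^ 2 ^ (i + 1) := by
    rw [primeBlock, Finset.length_toList]
    refine (Finset.card_le_card (t := Finset.range (2 ^ 2 ^ (i + 1))) fun p hp => ?_).trans
      (by simp)
    simp only [Finset.mem_filter] at hp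
    simpa using hp.2.2
  have h2 : 1 + 2 * 2 ^ 2 ^ (i + 1) ≤ 2 ^ 2 ^ (i + 2) := by
    have h3 : 2 ^ 2 ^ (i + 2) = 2 ^ 2 ^ (i + 1) * 2 ^ 2 ^ (i + 1) := by
      rw [← pow_add]; ring_nf
    have h4 : 2 ^ 2 ^ 1 ≤ 2 ^ 2 ^ (i + 1) :=
      Nat.pow_le_pow_right (by norm_num) (Nat.pow_le_pow_right (by norm_num) (by omega))
    rw [h3]
    norm_num at h4
    nlinarith
  exact_mod_cast (by omega : 1 + 2 * (primeBlock P i).length ≤ 2 ^ 2 ^ (i + 2))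

lemma sum_two_pow_mul_le (J : ℕ) :
    ∑ i ∈ Finset.range J, 2 ^ (i + 2) * (2 * (J - 1 - i)) + 8 * J + 8 = 8 * 2 ^ J := by
  induction J with
  | zero => simp
  | succ J ih =>
    rw [Finset.sum_range_succ']
    have : ∀ i, 2 ^ (i + 1 + 2) * (2 * (J + 1 - 1 - (i + 1))) =
        2 * (2 ^ (i + 2) * (2 * (J - 1 - i))) := by
      intro i
      rw [show J + 1 - 1 - (i + 1) = J - 1 - i by omega]
      ring
    simp only [this, ← Finset.mul_sum]
    rw [pow_succ]
    simp only [Nat.sub_zero, Nat.add_sub_cancel]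
    omega

/-- An upper-bound sieve of Brun–Hooley type: sieving a progression by at most two classes modulo
each prime of `P`. -/
theorem card_sifted_le {J : ℕ} {P : Finset ℕ}
    (hP : ∀ p ∈ P, p.Prime ∧ 3 ≤ p ∧ p < 2 ^ 2 ^ J) {Ω : ℕ → Finset ℕ}
    (hΩ : ∀ p ∈ P, ∀ c ∈ Ω p, c < p) (hcard : ∀ p ∈ P, (Ω p).card ≤ 2)
    {Q : ℕ} (hQ : 0 < Q) (hQP : ∀ p ∈ P, Q.Coprime p) (a N : ℕ) :
    (((Finset.range N).filter fun n => n ≡ a [MOD Q] ∧ ∀ p ∈ P, n % p ∉ Ω p).card : ℝ) ≤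
      Real.exp (Real.exp 24) * (N / Q) * ∏ p ∈ P, (1 - residueDensity Ω p) +
        ((2 : ℝ) ^ 2 ^ J) ^ 8 := by
  set k : ℕ → ℕ := fun i => 2 * (J - 1 - i) with hk
  have hmean := hasMeanOn_prod_truncSieve (fun p hp => (hP p hp).1) hΩ hcard k J Q hQ
    (fun p hp => hQP p hp.1) a N
  set F : ℕ → ℝ := fun n =>
    ∏ i ∈ Finset.range J, truncSieve (residueInd Ω n) (primeBlock P i) (k i) with hF
  have hblock : ∀ n i, 0 ≤ truncSieve (residueInd Ω n) (primeBlock P i) (k i) ∧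
      ((∀ p ∈ P, n % p ∉ Ω p) → 1 ≤ truncSieve (residueInd Ω n) (primeBlock P i) (k i)) := by
    intro n i
    have h01 : ∀ p ∈ primeBlock P i, 0 ≤ residueInd Ω n p ∧ residueInd Ω n p ≤ 1 := by
      intro p _
      unfold residueInd
      split_ifs <;> norm_num
    have h1 := (bonferroni h01 (k i)).1
    rw [hk, pow_mul, neg_one_sq, one_pow, one_mul] at h1
    have h2 := (list_prod_one_sub_mem_Icc h01).1
    refine ⟨by linarith, fun hn => ?_⟩
    have h3 : ((primeBlock P i).map fun p => 1 - residueInd Ω n p).prod = 1 := by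
      refine List.prod_eq_one fun x hx => ?_
      obtain ⟨p, hp, rfl⟩ := List.mem_map.1 hx
      simp [residueInd, hn p (mem_primeBlock.1 hp).1]
    linarith
  have hle : (((Finset.range N).filter fun n => n ≡ a [MOD Q] ∧ ∀ p ∈ P, n % p ∉ Ω p).card : ℝ) ≤
      ∑ n ∈ (Finset.range N).filter (fun n => n ≡ a [MOD Q]), F n := by
    rw [← Finset.filter_filter, Finset.card_eq_sum_ones, Nat.cast_sum, Finset.sum_filter]
    refine Finset.sum_le_sum fun n _ => ?_
    split_ifs with h
    · rw [Nat.cast_one, hF]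
      exact Finset.one_le_prod (fun i _ => (hblock n i).2 h)
    · exact Finset.prod_nonneg fun i _ => (hblock n i).1
  have herr : ∏ i ∈ Finset.range J, truncErr (primeBlock P i) (k i) ≤ ((2 : ℝ) ^ 2 ^ J) ^ 8 := by
    calc _ ≤ ∏ i ∈ Finset.range J, ((2 : ℝ) ^ 2 ^ (i + 2)) ^ (k i) :=
          Finset.prod_le_prod (fun _ _ => truncErr_nonneg _ _)
            fun i _ => truncErr_primeBlock_le P i (k i)
      _ = (2 : ℝ) ^ ∑ i ∈ Finset.range J, 2 ^ (i + 2) * k i := by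
          simp only [← pow_mul, Finset.prod_pow_eq_pow_sum]
      _ ≤ (2 : ℝ) ^ (2 ^ J * 8) := by
          refine pow_le_pow_right₀ (by norm_num) ?_
          have := sum_two_pow_mul_le J
          simp only [hk]
          omega
      _ = _ := by rw [pow_mul]
  have hmain : ∏ i ∈ Finset.range J, truncSieve (residueDensity Ω) (primeBlock P i) (k i) ≤
      Real.exp (Real.exp 24) * ∏ p ∈ P, (1 - residueDensity Ω p) := by
    have hPP : ∀ p ∈ P, p.Prime ∧ 3 ≤ p := fun p hp => ⟨(hP p hp).1, (hP p hp).2.1⟩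
    have hprod := prod_primeBlock (fun p hp => (hP p hp).1.two_le)
      (fun p => 1 - residueDensity Ω p) J
    rw [Finset.filter_true_of_mem fun p hp => (hP p hp).2.2] at hprod
    have hprod0 : 0 ≤ ∏ p ∈ P, (1 - residueDensity Ω p) := by
      refine Finset.prod_nonneg fun p hp => ?_
      have h3 : (3 : ℝ) ≤ p := by exact_mod_cast (hP p hp).2.1
      have h2 : ((Ω p).card : ℝ) ≤ 2 := by exact_mod_cast hcard p hp
      rw [residueDensity, sub_nonneg, div_le_one (by linarith)]
      linarith
    have hbd : ∀ i ∈ Finset.range J, _ := fun i _ => truncSieve_block_le hPP hcard i (J - 1 - i)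
    refine (Finset.prod_le_prod (fun i hi => (hbd i hi).1) fun i hi => (hbd i hi).2).trans ?_
    rw [Finset.prod_mul_distrib, hprod, ← Real.exp_sum, mul_comm]
    refine mul_le_mul_of_nonneg_right (Real.exp_le_exp.2 ?_) hprod0
    rw [← Finset.mul_sum, show (24 : ℝ) = 16 + 8 by norm_num, Real.exp_add]
    refine mul_le_mul_of_nonneg_left ?_ (Real.exp_pos _).le
    rw [Finset.sum_range_reflect (fun b => (8 : ℝ) ^ (2 * b + 1) / (2 * b + 1).factorial)]
    refine le_trans ?_ (Real.sum_le_exp_of_nonneg (by norm_num : (0 : ℝ) ≤ 8) (2 * J))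
    rw [← Finset.sum_image (f := fun m : ℕ => (8 : ℝ) ^ m / m.factorial)
      (g := fun b : ℕ => 2 * b + 1) (fun a _ b _ h => by simpa using h)]
    refine Finset.sum_le_sum_of_subset_of_nonneg (fun m hm => ?_) fun _ _ _ => by positivity
    obtain ⟨b, hb, rfl⟩ := Finset.mem_image.1 hm
    rw [Finset.mem_range] at hb ⊢
    omega
  have h1 := (abs_le.1 hmean).2
  have h2 : (N : ℝ) / Q * ∏ i ∈ Finset.range J, truncSieve (residueDensity Ω) (primeBlock P i) (k i)
      ≤ N / Q * (Real.exp (Real.exp 24) * ∏ p ∈ P, (1 - residueDensity Ω p)) :=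
    mul_le_mul_of_nonneg_left hmain (by positivity)
  have h3 : Real.exp (Real.exp 24) * (N / Q : ℝ) * ∏ p ∈ P, (1 - residueDensity Ω p) =
    N / Q * (Real.exp (Real.exp 24) * ∏ p ∈ P, (1 - residueDensity Ω p)) := by ring
  rw [h3]
  linarith

/-- Sum of the reciprocals of the odd primes dividing `h`. -/
noncomputable def oddPrimeSum (h : ℕ) : ℝ :=
  ∑ p ∈ h.primeFactors.filter (fun p => 3 ≤ p), (1 : ℝ) / p

/-- The odd primes below `2 ^ 2 ^ J` other than `m` and `m'`. -/
noncomputable def siftPrimes (J m m' : ℕ) : Finset ℕ :=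
  (Nat.primesBelow (2 ^ 2 ^ J)).filter fun p => 3 ≤ p ∧ p ≠ m ∧ p ≠ m'

lemma mem_siftPrimes {J m m' p : ℕ} : p ∈ siftPrimes J m m' ↔
    p.Prime ∧ 3 ≤ p ∧ p < 2 ^ 2 ^ J ∧ p ≠ m ∧ p ≠ m' := by
  simp only [siftPrimes, Finset.mem_filter, Nat.mem_primesBelow]
  tauto

lemma prod_siftPrimes_le (J m m' : ℕ) :
    ∏ p ∈ siftPrimes J m m', (1 - (1 : ℝ) / p) ≤ 16 / 2 ^ J := by
  set A := Nat.primesBelow (2 ^ 2 ^ J)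
  have hsub : siftPrimes J m m' ⊆ A := Finset.filter_subset _ _
  have hhalf : ∀ p ∈ A, (1 / 2 : ℝ) ≤ 1 - 1 / p := by
    intro p hp
    have : (2 : ℝ) ≤ p := by exact_mod_cast (Nat.prime_of_mem_primesBelow hp).two_le
    have := one_div_le_one_div_of_le (by norm_num) this
    linarith
  have hcard : (A \ siftPrimes J m m').card ≤ 3 := by
    refine (Finset.card_le_card (t := {2, m, m'}) fun p hp => ?_).trans Finset.card_le_three
    simp only [siftPrimes, Finset.mem_sdiff, Finset.mem_filter, not_and, not_not] at hp
    have h2 := (Nat.prime_of_mem_primesBelow hp.1).two_le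
    simp only [Finset.mem_insert, Finset.mem_singleton]
    by_cases h3 : 3 ≤ p
    · by_cases hm : p = m
      · exact Or.inr (Or.inl hm)
      · exact Or.inr (Or.inr (hp.2 hp.1 h3 hm))
    · exact Or.inl (by omega)
  have hrest : (1 / 8 : ℝ) ≤ ∏ p ∈ A \ siftPrimes J m m', (1 - (1 : ℝ) / p) := by
    calc (1 / 8 : ℝ) = (1 / 2) ^ 3 := by norm_num
      _ ≤ (1 / 2) ^ (A \ siftPrimes J m m').card :=
        pow_le_pow_of_le_one (by norm_num) (by norm_num) hcard
      _ = ∏ p ∈ A \ siftPrimes J m m', (1 / 2 : ℝ) := by rw [Finset.prod_const]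
      _ ≤ _ := Finset.prod_le_prod (fun _ _ => by norm_num) fun p hp =>
        hhalf p (Finset.mem_sdiff.1 hp).1
  have hP0 : 0 ≤ ∏ p ∈ siftPrimes J m m', (1 - (1 : ℝ) / p) :=
    Finset.prod_nonneg fun p hp => by linarith [hhalf p (hsub hp)]
  have hA := log_mul_prod_primesBelow_le (2 ^ 2 ^ J) (by positivity)
  rw [← Finset.prod_sdiff hsub] at hA
  push_cast at hA
  rw [Real.log_pow] at hA
  push_cast at hA
  have hlog : (1 / 2 : ℝ) ≤ Real.log 2 := by linarith [Real.log_two_gt_d9]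
  rw [le_div_iff₀ (by positivity)]
  set X := ∏ p ∈ siftPrimes J m m', (1 - (1 : ℝ) / p)
  set Y := ∏ p ∈ A \ siftPrimes J m m', (1 - (1 : ℝ) / p)
  have h2J : (0 : ℝ) < 2 ^ J := by positivity
  have h1 : (1 / 16 : ℝ) ≤ Real.log 2 * Y := by nlinarith
  have h2 : 2 ^ J * X * (1 / 16) ≤ 2 ^ J * X * (Real.log 2 * Y) := by gcongr
  nlinarith

/-- The residue classes modulo `p` of `0` and `-h`. -/
def pairResidues (h p : ℕ) : Finset ℕ := if p ∣ h then {0} else {0, p - h % p}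

lemma card_pairResidues (h : ℕ) {p : ℕ} (hp : 0 < p) :
    (pairResidues h p).card = if p ∣ h then 1 else 2 := by
  unfold pairResidues
  split_ifs with hd
  · simp
  · rw [Finset.card_pair]
    have := Nat.mod_lt h hp
    omega

lemma prod_pair_le {J m m' h : ℕ} (hh : h ≠ 0) :
    ∏ p ∈ siftPrimes J m m', (1 - residueDensity (pairResidues h) p) ≤
      256 / 4 ^ J * Real.exp (2 * oddPrimeSum h) := by
  have hp3 : ∀ p ∈ siftPrimes J m m', (3 : ℝ) ≤ p := fun p hp => by
    exact_mod_cast (mem_siftPrimes.1 hp).2.1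
  have hterm : ∀ p ∈ siftPrimes J m m', 1 - residueDensity (pairResidues h) p ≤
      (1 - (1 : ℝ) / p) ^ 2 * Real.exp (if p ∣ h then 2 * (1 / p) else 0) := by
    intro p hp
    have h3 := one_div_le_one_div_of_le (by norm_num) (hp3 p hp)
    have h0 : (0 : ℝ) ≤ 1 / p := by positivity
    set u : ℝ := 1 / p with hu
    have hd : residueDensity (pairResidues h) p = (if p ∣ h then 1 else 2 : ℕ) * u := by
      rw [residueDensity, card_pairResidues h (mem_siftPrimes.1 hp).1.pos, hu, mul_one_div]
    rw [hd]
    split_ifs with hdvd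
    · have : 1 + 2 * u ≤ Real.exp (2 * u) := by linarith [Real.add_one_le_exp (2 * u)]
      have h4 : (1 - u) ^ 2 * (1 + 2 * u) ≤ (1 - u) ^ 2 * Real.exp (2 * u) := by gcongr
      push_cast
      nlinarith [mul_nonneg h0 (by linarith : (0 : ℝ) ≤ 1 - 3 * u), mul_nonneg h0 h0,
        mul_nonneg (mul_nonneg h0 h0) h0]
    · rw [Real.exp_zero]
      push_cast
      nlinarith
  have hnn : ∀ p ∈ siftPrimes J m m', 0 ≤ 1 - residueDensity (pairResidues h) p := by
    intro p hp
    rw [residueDensity, card_pairResidues h (mem_siftPrimes.1 hp).1.pos, sub_nonneg,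
      div_le_one (by linarith [hp3 p hp])]
    split_ifs <;> push_cast <;> linarith [hp3 p hp]
  refine (Finset.prod_le_prod hnn hterm).trans ?_
  rw [Finset.prod_mul_distrib, ← Real.exp_sum, Finset.prod_pow]
  have hP0 : 0 ≤ ∏ p ∈ siftPrimes J m m', (1 - (1 : ℝ) / p) := Finset.prod_nonneg fun p hp => by
    linarith [one_div_le_one_div_of_le (by norm_num) (hp3 p hp)]
  have h4 : (256 : ℝ) / 4 ^ J = (16 / 2 ^ J) ^ 2 := by
    rw [div_pow, ← pow_mul, mul_comm J, pow_mul]; norm_num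
  rw [h4]
  refine mul_le_mul (pow_le_pow_left₀ hP0 (prod_siftPrimes_le J m m') 2)
    (Real.exp_le_exp.2 ?_) (Real.exp_pos _).le (by positivity)
  rw [← Finset.sum_filter, ← Finset.mul_sum, oddPrimeSum]
  refine mul_le_mul_of_nonneg_left (Finset.sum_le_sum_of_subset_of_nonneg (fun p hp => ?_)
    fun _ _ _ => by positivity) (by norm_num)
  rw [Finset.mem_filter, mem_siftPrimes] at hp
  simp only [Finset.mem_filter, Nat.mem_primeFactors]
  exact ⟨⟨hp.1.1, hp.2, hh⟩, hp.1.2.1⟩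

lemma prod_pair_zero_le (J m m' : ℕ) :
    ∏ p ∈ siftPrimes J m m', (1 - residueDensity (pairResidues 0) p) ≤ 16 / 2 ^ J := by
  convert prod_siftPrimes_le J m m' using 3
  simp [residueDensity, pairResidues]

/-- The set counted by the sieve: `n < N` with `m ∣ n`, `m' ∣ n + h`, and no other odd prime below
`2 ^ 2 ^ J` dividing `n` or `n + h`. -/
noncomputable def siftedPairs (J m m' h N : ℕ) : Finset ℕ :=
  (Finset.range N).filter fun n => m ∣ n ∧ m' ∣ n + h ∧
    ∀ p ∈ siftPrimes J m m', ¬ p ∣ n ∧ ¬ p ∣ n + h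

lemma card_siftedPairs_le {J m m' : ℕ} (hm : m = 1 ∨ m.Prime) (hm' : m' = 1 ∨ m'.Prime)
    (h N : ℕ) : ((siftedPairs J m m' h N).card : ℝ) ≤
      Real.exp (Real.exp 24) * (N / Nat.lcm m m') *
        ∏ p ∈ siftPrimes J m m', (1 - residueDensity (pairResidues h) p) +
        ((2 : ℝ) ^ 2 ^ J) ^ 8 := by
  have hm0 : 0 < m := by rcases hm with rfl | hm; exacts [one_pos, hm.pos]
  have hm0' : 0 < m' := by rcases hm' with rfl | hm; exacts [one_pos, hm.pos]
  have hcop : ∀ p ∈ siftPrimes J m m', (Nat.lcm m m').Coprime p := by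
    intro p hp
    obtain ⟨hpp, -, -, h1, h2⟩ := mem_siftPrimes.1 hp
    have h1 : m.Coprime p := by
      rcases hm with rfl | hm
      · simp
      · exact (Nat.coprime_primes hm hpp).2 h1.symm
    have h2 : m'.Coprime p := by
      rcases hm' with rfl | hm
      · simp
      · exact (Nat.coprime_primes hm hpp).2 h2.symm
    exact Nat.Coprime.coprime_dvd_left (Nat.lcm_dvd_mul m m') (h1.mul_left h2)
  have hΩ : ∀ p ∈ siftPrimes J m m', ∀ c ∈ pairResidues h p, c < p := by
    intro p hp c hc
    have hpp := (mem_siftPrimes.1 hp).1.pos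
    unfold pairResidues at hc
    split_ifs at hc with hd
    · rw [Finset.mem_singleton] at hc; omega
    · rw [Finset.mem_insert, Finset.mem_singleton] at hc
      have : h % p ≠ 0 := fun h0 => hd (Nat.dvd_of_mod_eq_zero h0)
      omega
  rcases (siftedPairs J m m' h N).eq_empty_or_nonempty with he | ⟨n₀, hn₀⟩
  · rw [he, Finset.card_empty, Nat.cast_zero]
    refine add_nonneg (mul_nonneg (by positivity) (Finset.prod_nonneg fun p hp => ?_))
      (by positivity)
    have h3 : (3 : ℝ) ≤ p := by exact_mod_cast (mem_siftPrimes.1 hp).2.1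
    rw [residueDensity, card_pairResidues h (mem_siftPrimes.1 hp).1.pos, sub_nonneg,
      div_le_one (by linarith)]
    split_ifs <;> push_cast <;> linarith
  · refine le_trans ?_ (card_sifted_le (J := J) (P := siftPrimes J m m') (Ω := pairResidues h)
      (fun p hp => ?_) hΩ (fun p hp => ?_) (Nat.lcm_pos hm0 hm0') hcop n₀ N)
    · refine Nat.cast_le.2 (Finset.card_le_card fun n hn => ?_)
      simp only [siftedPairs, Finset.mem_filter, Finset.mem_range] at hn hn₀ ⊢
      obtain ⟨hnN, h1, h2, h3⟩ := hn
      obtain ⟨-, h1', h2', -⟩ := hn₀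
      refine ⟨hnN, ?_, fun p hp hmem => ?_⟩
      · have e1 : n ≡ n₀ [MOD m] :=
          ((Nat.modEq_zero_iff_dvd.2 h1).trans (Nat.modEq_zero_iff_dvd.2 h1').symm)
        have e2 : n ≡ n₀ [MOD m'] := Nat.ModEq.add_right_cancel' h
          ((Nat.modEq_zero_iff_dvd.2 h2).trans (Nat.modEq_zero_iff_dvd.2 h2').symm)
        rw [Nat.modEq_iff_dvd] at e1 e2 ⊢
        exact_mod_cast Int.coe_lcm_dvd e1 e2
      · have hpp := (mem_siftPrimes.1 hp).1.pos
        have hz : n % p = 0 → False := fun h0 => (h3 p hp).1 (Nat.dvd_of_mod_eq_zero h0)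
        unfold pairResidues at hmem
        split_ifs at hmem with hd
        · exact hz (by simpa using hmem)
        · rw [Finset.mem_insert, Finset.mem_singleton] at hmem
          rcases hmem with hmem | hmem
          · exact hz hmem
          · refine (h3 p hp).2 (Nat.dvd_of_mod_eq_zero ?_)
            have := Nat.mod_lt h hpp
            rw [Nat.add_mod, hmem, Nat.sub_add_cancel this.le, Nat.mod_self]
    · have := mem_siftPrimes.1 hp
      exact ⟨this.1, this.2.1, this.2.2.1⟩
    · rw [card_pairResidues h (mem_siftPrimes.1 hp).1.pos]; split_ifs <;> norm_num

/-- A member of `P₂*` has at most one prime factor below the square root of a lower bound. -/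
lemma P2star.exists_small_factor {n z : ℕ} (hn : P2star n) (hz : z ^ 2 ≤ n) (hz1 : 1 < z) :
    ∃ m ∈ insert 1 (Nat.primesBelow z), m ∣ n ∧ ∀ p, p.Prime → p < z → p ≠ m → ¬ p ∣ n := by
  rcases hn with hn | ⟨a, b, ha, hb, hab, rfl⟩
  · refine ⟨1, Finset.mem_insert_self _ _, one_dvd _, fun p hp hpz _ hd => ?_⟩
    rw [Nat.prime_dvd_prime_iff_eq hp hn] at hd
    subst hd
    nlinarith
  · have hab' : a < b := by nlinarith [ha.two_le]
    have hbz : z ≤ b := by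
      by_contra hlt
      push Not at hlt
      nlinarith
    by_cases haz : a < z
    · refine ⟨a, Finset.mem_insert_of_mem (Nat.mem_primesBelow.2 ⟨haz, ha⟩), dvd_mul_right _ _,
        fun p hp hpz hpa hd => ?_⟩
      rcases (hp.dvd_mul).1 hd with h | h
      · exact hpa ((Nat.prime_dvd_prime_iff_eq hp ha).1 h)
      · have := (Nat.prime_dvd_prime_iff_eq hp hb).1 h
        omega
    · refine ⟨1, Finset.mem_insert_self _ _, one_dvd _, fun p hp hpz _ hd => ?_⟩
      rcases (hp.dvd_mul).1 hd with h | h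
      · have := (Nat.prime_dvd_prime_iff_eq hp ha).1 h
        omega
      · have := (Nat.prime_dvd_prime_iff_eq hp hb).1 h
        omega

lemma sum_inv_insert_primesBelow_le (J : ℕ) :
    ∑ m ∈ insert 1 (Nat.primesBelow (2 ^ 2 ^ J)), (1 : ℝ) / m ≤ 1 + 4 * J := by
  rw [Finset.sum_insert (fun h => Nat.not_prime_one (Nat.prime_of_mem_primesBelow h))]
  have := sum_inv_prime_le J (Nat.primesBelow (2 ^ 2 ^ J)) fun p hp =>
    ⟨Nat.prime_of_mem_primesBelow hp, Nat.lt_of_mem_primesBelow hp⟩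
  push_cast
  linarith

lemma card_insert_primesBelow_le {z : ℕ} (hz : 1 < z) :
    (insert 1 (Nat.primesBelow z)).card ≤ z := by
  refine (Finset.card_le_card (t := Finset.range z) fun p hp => ?_).trans (by simp)
  rw [Finset.mem_insert] at hp
  rw [Finset.mem_range]
  rcases hp with rfl | hp
  · exact hz
  · exact Nat.lt_of_mem_primesBelow hp

lemma eq_one_or_prime_of_mem {z m : ℕ} (hm : m ∈ insert 1 (Nat.primesBelow z)) :
    m = 1 ∨ m.Prime := by
  rw [Finset.mem_insert] at hm
  exact hm.imp_right Nat.prime_of_mem_primesBelow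

/-- Powers of `2 ^ 2 ^ J` up to the tenth are negligible against `N / 4 ^ J`. -/
lemma pow_le_div_four_pow {J N e : ℕ} (hN : (2 ^ 2 ^ J) ^ 40 ≤ N) (he : e ≤ 10) :
    ((2 : ℝ) ^ 2 ^ J) ^ e ≤ N / 4 ^ J := by
  have h1 : (1 : ℝ) ≤ 2 ^ 2 ^ J := one_le_pow₀ (by norm_num)
  have h4 : (4 : ℝ) ^ J ≤ (2 ^ 2 ^ J) ^ 2 := by
    have : (2 : ℝ) ^ J ≤ 2 ^ 2 ^ J := pow_le_pow_right₀ (by norm_num) Nat.lt_two_pow_self.le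
    calc (4 : ℝ) ^ J = (2 ^ J) ^ 2 := by rw [← pow_mul, mul_comm, pow_mul]; norm_num
      _ ≤ _ := by gcongr
  rw [le_div_iff₀ (by positivity)]
  calc ((2 : ℝ) ^ 2 ^ J) ^ e * 4 ^ J ≤ (2 ^ 2 ^ J) ^ 10 * (2 ^ 2 ^ J) ^ 2 := by
        gcongr
    _ = (2 ^ 2 ^ J) ^ 12 := by ring
    _ ≤ (2 ^ 2 ^ J) ^ 40 := pow_le_pow_right₀ h1 (by norm_num)
    _ ≤ N := by exact_mod_cast hN

lemma oddPrimeSum_nonneg (h : ℕ) : 0 ≤ oddPrimeSum h :=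
  Finset.sum_nonneg fun _ _ => by positivity

lemma card_P2star_pairs_le {J h N : ℕ} (hJ : 1 ≤ J) (hh : h ≠ 0) (hN : (2 ^ 2 ^ J) ^ 40 ≤ N) :
    (((Finset.range N).filter fun n => P2star n ∧ P2star (n + h)).card : ℝ) ≤
      8000 * Real.exp (Real.exp 24) * (N * J ^ 2 / 4 ^ J) * Real.exp (2 * oddPrimeSum h) := by
  set z := 2 ^ 2 ^ J with hz
  have hz1 : 1 < z := Nat.one_lt_two_pow (by positivity)
  set M := insert 1 (Nat.primesBelow z) with hM
  have hM1 : ∀ m ∈ M, (0 : ℝ) < m := fun m hm => by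
    rcases eq_one_or_prime_of_mem hm with rfl | h
    · norm_num
    · exact_mod_cast h.pos
  have hsub : ((Finset.range N).filter fun n => P2star n ∧ P2star (n + h)) ⊆
      Finset.range (z ^ 2) ∪ (M ×ˢ M).biUnion fun mm => siftedPairs J mm.1 mm.2 h N := by
    intro n hn
    rw [Finset.mem_filter, Finset.mem_range] at hn
    obtain ⟨hnN, h1, h2⟩ := hn
    rw [Finset.mem_union, Finset.mem_range]
    by_cases hnz : n < z ^ 2
    · exact Or.inl hnz
    · push Not at hnz
      obtain ⟨m, hm, hmn, hmp⟩ := h1.exists_small_factor hnz hz1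
      obtain ⟨m', hm', hmn', hmp'⟩ := h2.exists_small_factor (by omega) hz1
      refine Or.inr (Finset.mem_biUnion.2 ⟨(m, m'), Finset.mem_product.2 ⟨hm, hm'⟩, ?_⟩)
      simp only [siftedPairs, Finset.mem_filter, Finset.mem_range]
      refine ⟨hnN, hmn, hmn', fun p hp => ?_⟩
      obtain ⟨a1, -, a3, a4, a5⟩ := mem_siftPrimes.1 hp
      exact ⟨hmp p a1 a3 a4, hmp' p a1 a3 a5⟩
  set K := Real.exp (Real.exp 24) with hK
  have hK1 : 1 ≤ K := Real.one_le_exp (Real.exp_pos _).le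
  set W := 256 / 4 ^ J * Real.exp (2 * oddPrimeSum h) with hW
  have hW0 : 0 ≤ W := by positivity
  have hterm : ∀ mm ∈ M ×ˢ M, ((siftedPairs J mm.1 mm.2 h N).card : ℝ) ≤
      K * N * W * (1 / mm.1 * (1 / mm.2) + if mm.1 = mm.2 then (1 : ℝ) / mm.1 else 0) +
        (z : ℝ) ^ 8 := by
    rintro ⟨m, m'⟩ hmm
    obtain ⟨hm, hm'⟩ := Finset.mem_product.1 hmm
    have c1 := eq_one_or_prime_of_mem hm
    have c2 := eq_one_or_prime_of_mem hm'
    have hlcm : (1 : ℝ) / (Nat.lcm m m' : ℕ) ≤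
        1 / m * (1 / m') + if m = m' then (1 : ℝ) / m else 0 := by
      split_ifs with heq
      · subst heq
        rw [Nat.lcm_self]
        have : (0 : ℝ) ≤ 1 / m * (1 / m) := by positivity
        linarith
      · have : Nat.lcm m m' = m * m' := by
          apply Nat.Coprime.lcm_eq_mul
          rcases c1 with rfl | c1
          · simp
          · rcases c2 with rfl | c2
            · simp
            · exact (Nat.coprime_primes c1 c2).2 heq
        rw [this]
        push_cast
        rw [one_div_mul_one_div, add_zero]
    have := card_siftedPairs_le (J := J) c1 c2 h N
    refine this.trans ?_
    have hzc : ((z : ℕ) : ℝ) = 2 ^ 2 ^ J := by rw [hz]; push_cast; rfl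
    rw [hzc]
    refine add_le_add ?_ le_rfl
    calc K * (N / (Nat.lcm m m' : ℕ)) * _ ≤ K * (N / (Nat.lcm m m' : ℕ)) * W := by
          exact mul_le_mul_of_nonneg_left (prod_pair_le hh) (by positivity)
      _ = K * N * W * (1 / (Nat.lcm m m' : ℕ)) := by ring
      _ ≤ _ := by gcongr
  have hT := sum_inv_insert_primesBelow_le J
  have hT0 : 0 ≤ ∑ m ∈ M, (1 : ℝ) / m := Finset.sum_nonneg fun _ _ => by positivity
  have hcardM : (M.card : ℝ) ≤ z := by exact_mod_cast card_insert_primesBelow_le hz1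
  have hJ1 : (1 : ℝ) ≤ J := by exact_mod_cast hJ
  have hsum : ∑ mm ∈ M ×ˢ M, (1 / (mm.1 : ℝ) * (1 / mm.2) +
      if mm.1 = mm.2 then (1 : ℝ) / mm.1 else 0) ≤ 30 * J ^ 2 := by
    rw [Finset.sum_add_distrib, Finset.sum_product, Finset.sum_product]
    have e1 : ∑ m ∈ M, ∑ m' ∈ M, (1 / (m : ℝ) * (1 / (m' : ℝ))) = (∑ m ∈ M, (1 : ℝ) / m) ^ 2 := by
      rw [sq, Finset.sum_mul_sum]
    have e2 : ∑ m ∈ M, ∑ m' ∈ M, (if m = m' then (1 : ℝ) / m else 0) = ∑ m ∈ M, (1 : ℝ) / m := by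
      refine Finset.sum_congr rfl fun m hm => ?_
      rw [Finset.sum_ite_eq, if_pos hm]
    rw [e1, e2]
    nlinarith
  have hz0 : (1 : ℝ) ≤ z := by exact_mod_cast hz1.le
  have hz10 : (z : ℝ) ^ 10 ≤ N / 4 ^ J := by
    have := pow_le_div_four_pow (e := 10) hN le_rfl
    rw [hz]; push_cast; exact this
  calc (((Finset.range N).filter fun n => P2star n ∧ P2star (n + h)).card : ℝ)
      ≤ z ^ 2 + ∑ mm ∈ M ×ˢ M, ((siftedPairs J mm.1 mm.2 h N).card : ℝ) := by
        have := (Finset.card_le_card hsub).trans ((Finset.card_union_le _ _).trans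
          (Nat.add_le_add_left Finset.card_biUnion_le _))
        rw [Finset.card_range] at this
        exact_mod_cast this
    _ ≤ z ^ 2 + (K * N * W * (30 * J ^ 2) + M.card * M.card * z ^ 8) := by
        refine add_le_add_right ((Finset.sum_le_sum hterm).trans ?_) _
        rw [Finset.sum_add_distrib, ← Finset.mul_sum, Finset.sum_const, Finset.card_product,
          nsmul_eq_mul]
        push_cast
        gcongr
    _ ≤ z ^ 10 + (K * N * W * (30 * J ^ 2) + z ^ 10) := by
        have e1 : (z : ℝ) ^ 2 ≤ z ^ 10 := pow_le_pow_right₀ hz0 (by norm_num)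
        have e2 : (M.card : ℝ) * M.card * z ^ 8 ≤ z * z * z ^ 8 := by gcongr
        have e3 : (z : ℝ) * z * z ^ 8 = z ^ 10 := by ring
        linarith
    _ ≤ _ := by
        have e1 : 1 ≤ Real.exp (2 * oddPrimeSum h) :=
          Real.one_le_exp (by linarith [oddPrimeSum_nonneg h])
        have e2 : (N : ℝ) / 4 ^ J ≤ K * (N * J ^ 2 / 4 ^ J) * Real.exp (2 * oddPrimeSum h) := by
          have hA : 0 ≤ (N : ℝ) / 4 ^ J := by positivity
          have hJ2 : 1 ≤ (J : ℝ) ^ 2 := one_le_pow₀ hJ1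
          have e3 : K * (N * J ^ 2 / 4 ^ J) * Real.exp (2 * oddPrimeSum h) =
            (N / 4 ^ J) * (K * J ^ 2 * Real.exp (2 * oddPrimeSum h)) := by ring
          rw [e3]
          refine le_mul_of_one_le_right hA ?_
          exact one_le_mul_of_one_le_of_one_le (one_le_mul_of_one_le_of_one_le hK1 hJ2) e1
        have e4 : K * N * W * (30 * J ^ 2) =
            7680 * (K * (N * J ^ 2 / 4 ^ J) * Real.exp (2 * oddPrimeSum h)) := by
          rw [hW]; ring
        have e5 : 8000 * K * (N * J ^ 2 / 4 ^ J) * Real.exp (2 * oddPrimeSum h) =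
            8000 * (K * (N * J ^ 2 / 4 ^ J) * Real.exp (2 * oddPrimeSum h)) := by ring
        have e6 : 0 ≤ K * (N * J ^ 2 / 4 ^ J) * Real.exp (2 * oddPrimeSum h) := by positivity
        rw [e4, e5]
        linarith

lemma div_four_pow_le_div_two_pow (J N : ℕ) : (N : ℝ) / 4 ^ J ≤ N / 2 ^ J := by
  have : (2 : ℝ) ^ J ≤ 4 ^ J := pow_le_pow_left₀ (by norm_num) (by norm_num) J
  gcongr

lemma card_P2star_le {J N : ℕ} (hJ : 1 ≤ J) (hN : (2 ^ 2 ^ J) ^ 40 ≤ N) :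
    (((Finset.range N).filter P2star).card : ℝ) ≤
      100 * Real.exp (Real.exp 24) * (N * J / 2 ^ J) := by
  set z := 2 ^ 2 ^ J with hz
  have hz1 : 1 < z := Nat.one_lt_two_pow (by positivity)
  set M := insert 1 (Nat.primesBelow z) with hM
  have hsub : (Finset.range N).filter P2star ⊆
      Finset.range (z ^ 2) ∪ M.biUnion fun m => siftedPairs J m m 0 N := by
    intro n hn
    rw [Finset.mem_filter, Finset.mem_range] at hn
    obtain ⟨hnN, h1⟩ := hn
    rw [Finset.mem_union, Finset.mem_range]
    by_cases hnz : n < z ^ 2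
    · exact Or.inl hnz
    · push Not at hnz
      obtain ⟨m, hm, hmn, hmp⟩ := h1.exists_small_factor hnz hz1
      refine Or.inr (Finset.mem_biUnion.2 ⟨m, hm, ?_⟩)
      simp only [siftedPairs, Finset.mem_filter, Finset.mem_range]
      refine ⟨hnN, hmn, hmn, fun p hp => ?_⟩
      obtain ⟨a1, -, a3, a4, -⟩ := mem_siftPrimes.1 hp
      exact ⟨hmp p a1 a3 a4, hmp p a1 a3 a4⟩
  set K := Real.exp (Real.exp 24) with hK
  have hK1 : 1 ≤ K := Real.one_le_exp (Real.exp_pos _).le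
  have hterm : ∀ m ∈ M, ((siftedPairs J m m 0 N).card : ℝ) ≤
      K * N * (16 / 2 ^ J) * (1 / m) + (z : ℝ) ^ 8 := by
    intro m hm
    have c1 := eq_one_or_prime_of_mem hm
    refine (card_siftedPairs_le (J := J) c1 c1 0 N).trans ?_
    have hzc : ((z : ℕ) : ℝ) = 2 ^ 2 ^ J := by rw [hz]; push_cast; rfl
    rw [hzc, Nat.lcm_self]
    refine add_le_add ?_ le_rfl
    calc K * (N / m) * _ ≤ K * (N / m) * (16 / 2 ^ J) := by
          exact mul_le_mul_of_nonneg_left (prod_pair_zero_le J m m) (by positivity)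
      _ = _ := by ring
  have hT := sum_inv_insert_primesBelow_le J
  have hcardM : (M.card : ℝ) ≤ z := by exact_mod_cast card_insert_primesBelow_le hz1
  have hJ1 : (1 : ℝ) ≤ J := by exact_mod_cast hJ
  have hz0 : (1 : ℝ) ≤ z := by exact_mod_cast hz1.le
  have hz10 : (z : ℝ) ^ 10 ≤ N / 2 ^ J := by
    have := (pow_le_div_four_pow (e := 10) hN le_rfl).trans (div_four_pow_le_div_two_pow J N)
    rw [hz]; push_cast; exact this
  calc (((Finset.range N).filter P2star).card : ℝ)
      ≤ z ^ 2 + ∑ m ∈ M, ((siftedPairs J m m 0 N).card : ℝ) := by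
        have := (Finset.card_le_card hsub).trans ((Finset.card_union_le _ _).trans
          (Nat.add_le_add_left Finset.card_biUnion_le _))
        rw [Finset.card_range] at this
        exact_mod_cast this
    _ ≤ z ^ 2 + (K * N * (16 / 2 ^ J) * (1 + 4 * J) + M.card * z ^ 8) := by
        refine add_le_add_right ((Finset.sum_le_sum hterm).trans ?_) _
        rw [Finset.sum_add_distrib, ← Finset.mul_sum, Finset.sum_const, nsmul_eq_mul]
        gcongr
    _ ≤ z ^ 10 + (K * N * (16 / 2 ^ J) * (5 * J) + z ^ 10) := by
        have e1 : (z : ℝ) ^ 2 ≤ z ^ 10 := pow_le_pow_right₀ hz0 (by norm_num)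
        have e2 : (M.card : ℝ) * z ^ 8 ≤ z * z ^ 8 := by gcongr
        have e3 : (z : ℝ) * z ^ 8 = z ^ 9 := by ring
        have e4 : (z : ℝ) ^ 9 ≤ z ^ 10 := pow_le_pow_right₀ hz0 (by norm_num)
        have e5 : K * N * (16 / 2 ^ J) * (1 + 4 * J) ≤ K * N * (16 / 2 ^ J) * (5 * J) := by
          gcongr; linarith
        linarith
    _ ≤ _ := by
        have hA : 0 ≤ (N : ℝ) / 2 ^ J := by positivity
        have e2 : (N : ℝ) / 2 ^ J ≤ (N / 2 ^ J) * (K * J) :=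
          le_mul_of_one_le_right hA (one_le_mul_of_one_le_of_one_le hK1 hJ1)
        have e4 : K * N * (16 / 2 ^ J) * (5 * J) = 80 * ((N / 2 ^ J) * (K * J)) := by ring
        have e5 : 100 * K * (N * J / 2 ^ J) = 100 * ((N / 2 ^ J) * (K * J)) := by ring
        have e6 : 0 ≤ ((N : ℝ) / 2 ^ J) * (K * J) := by positivity
        rw [e4, e5]
        linarith

lemma card_primes_le_card_siftedPairs {J h N : ℕ} (s : Finset ℕ)
    (hs : ∀ p ∈ s, p < N ∧ p.Prime ∧ (p + h).Prime) :
    (s.card : ℝ) ≤ 2 ^ 2 ^ J + (siftedPairs J 1 1 h N).card := by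
  have hsub : s ⊆ Finset.range (2 ^ 2 ^ J) ∪ siftedPairs J 1 1 h N := by
    intro n hn
    obtain ⟨h0, h1, h2⟩ := hs n hn
    rw [Finset.mem_union, Finset.mem_range]
    by_cases hnz : n < 2 ^ 2 ^ J
    · exact Or.inl hnz
    · refine Or.inr ?_
      simp only [siftedPairs, Finset.mem_filter, Finset.mem_range]
      refine ⟨h0, one_dvd _, one_dvd _, fun p hp => ?_⟩
      obtain ⟨a1, -, a3, -⟩ := mem_siftPrimes.1 hp
      rw [Nat.prime_dvd_prime_iff_eq a1 h1, Nat.prime_dvd_prime_iff_eq a1 h2]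
      omega
  have := (Finset.card_le_card hsub).trans (Finset.card_union_le _ _)
  rw [Finset.card_range] at this
  exact_mod_cast this

lemma card_prime_pairs_le {J h N : ℕ} (hh : h ≠ 0) (hN : (2 ^ 2 ^ J) ^ 40 ≤ N) :
    (((Finset.range N).filter fun p => p.Prime ∧ (p + h).Prime).card : ℝ) ≤
      300 * Real.exp (Real.exp 24) * (N / 4 ^ J) * Real.exp (2 * oddPrimeSum h) := by
  refine (card_primes_le_card_siftedPairs (J := J) (h := h) (N := N) _ fun p hp => by
    simpa using hp).trans ?_
  have h1 := card_siftedPairs_le (J := J) (Or.inl rfl) (Or.inl rfl) h N (m := 1) (m' := 1)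
  have h2 := pow_le_div_four_pow (e := 8) hN (by norm_num)
  have h3 := pow_le_div_four_pow (e := 1) hN (by norm_num)
  have h4 := prod_pair_le (J := J) (m := 1) (m' := 1) hh
  rw [Nat.lcm_self, Nat.cast_one, div_one] at h1
  rw [pow_one] at h3
  set K := Real.exp (Real.exp 24) with hK
  have hK1 : 1 ≤ K := Real.one_le_exp (Real.exp_pos _).le
  have e1 : 1 ≤ Real.exp (2 * oddPrimeSum h) :=
    Real.one_le_exp (by linarith [oddPrimeSum_nonneg h])
  have h5 := mul_le_mul_of_nonneg_left h4 (by positivity : 0 ≤ K * N)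
  have e2 : (N : ℝ) / 4 ^ J ≤ N / 4 ^ J * (K * Real.exp (2 * oddPrimeSum h)) :=
    le_mul_of_one_le_right (by positivity) (one_le_mul_of_one_le_of_one_le hK1 e1)
  have e3 : K * N * (256 / 4 ^ J * Real.exp (2 * oddPrimeSum h)) =
    256 * (N / 4 ^ J * (K * Real.exp (2 * oddPrimeSum h))) := by ring
  have e4 : 300 * K * (N / 4 ^ J) * Real.exp (2 * oddPrimeSum h) =
    300 * (N / 4 ^ J * (K * Real.exp (2 * oddPrimeSum h))) := by ring
  have e5 : 0 ≤ (N : ℝ) / 4 ^ J * (K * Real.exp (2 * oddPrimeSum h)) := by positivity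
  rw [e4]
  linarith

lemma card_primes_le {J N : ℕ} (hN : (2 ^ 2 ^ J) ^ 40 ≤ N) :
    (((Finset.range N).filter Nat.Prime).card : ℝ) ≤
      20 * Real.exp (Real.exp 24) * (N / 2 ^ J) := by
  refine (card_primes_le_card_siftedPairs (J := J) (h := 0) (N := N) _ fun p hp => by
    simpa using hp).trans ?_
  have h1 := card_siftedPairs_le (J := J) (Or.inl rfl) (Or.inl rfl) 0 N (m := 1) (m' := 1)
  have h0 := div_four_pow_le_div_two_pow J N
  have h2 := pow_le_div_four_pow (e := 8) hN (by norm_num)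
  have h3 := pow_le_div_four_pow (e := 1) hN (by norm_num)
  have h4 := prod_pair_zero_le J 1 1
  rw [Nat.lcm_self, Nat.cast_one, div_one] at h1
  rw [pow_one] at h3
  set K := Real.exp (Real.exp 24) with hK
  have hK1 : 1 ≤ K := Real.one_le_exp (Real.exp_pos _).le
  have h5 := mul_le_mul_of_nonneg_left h4 (by positivity : 0 ≤ K * N)
  have e2 : (N : ℝ) / 2 ^ J ≤ N / 2 ^ J * K := le_mul_of_one_le_right (by positivity) hK1
  have e3 : K * N * (16 / 2 ^ J) = 16 * (N / 2 ^ J * K) := by ring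
  have e4 : 20 * K * (N / 2 ^ J) = 20 * (N / 2 ^ J * K) := by ring
  have e5 : 0 ≤ (N : ℝ) / 2 ^ J * K := by positivity
  rw [e4]
  linarith

/-- Weights on the primes whose sum is at most `1`. -/
noncomputable def primeWeight (p : ℕ) : ℝ := 1 / p * ((3 / 4) ^ Nat.log 2 (Nat.log 2 p) / 16)

lemma primeWeight_nonneg (p : ℕ) : 0 ≤ primeWeight p := by
  unfold primeWeight; positivity

lemma log_log_eq_of_block {p i : ℕ} (h1 : 2 ^ 2 ^ i ≤ p) (h2 : p < 2 ^ 2 ^ (i + 1)) :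
    Nat.log 2 (Nat.log 2 p) = i := by
  have hp : p ≠ 0 := by have : 0 < 2 ^ 2 ^ i := by positivity
                        omega
  have h3 : 2 ^ i ≤ Nat.log 2 p := Nat.le_log_of_pow_le (by norm_num) h1
  have h4 : Nat.log 2 p < 2 ^ (i + 1) := Nat.log_lt_of_lt_pow hp h2
  exact Nat.log_eq_of_pow_le_of_lt_pow h3 h4

lemma two_pow_two_pow_log_log_le {p : ℕ} (hp : 2 ≤ p) : 2 ^ 2 ^ Nat.log 2 (Nat.log 2 p) ≤ p := by
  obtain ⟨i, h1, h2⟩ := exists_block hp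
  rwa [log_log_eq_of_block h1 h2]

lemma sum_primeWeight_le (s : Finset ℕ) (hs : ∀ p ∈ s, p.Prime) :
    ∑ p ∈ s, primeWeight p ≤ 1 := by
  set b : ℕ → ℕ := fun p => Nat.log 2 (Nat.log 2 p) with hb
  have hblock : ∀ i ∈ s.image b, ∑ p ∈ s.filter (fun p => b p = i), primeWeight p ≤
      (3 / 4 : ℝ) ^ i / 4 := by
    intro i _
    have h1 := sum_inv_prime_block_le i (s.filter fun p => b p = i) fun p hp => by
      obtain ⟨h1, h2⟩ := Finset.mem_filter.1 hp
      obtain ⟨j, hj1, hj2⟩ := exists_block (hs p h1).two_le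
      have : b p = j := log_log_eq_of_block hj1 hj2
      rw [← h2, this]
      exact ⟨hs p h1, hj1, hj2⟩
    calc ∑ p ∈ s.filter (fun p => b p = i), primeWeight p
        = ∑ p ∈ s.filter (fun p => b p = i), (1 : ℝ) / p * ((3 / 4) ^ i / 16) :=
          Finset.sum_congr rfl fun p hp => by
            rw [primeWeight, ← (Finset.mem_filter.1 hp).2]
      _ = (∑ p ∈ s.filter (fun p => b p = i), (1 : ℝ) / p) * ((3 / 4) ^ i / 16) := by
          rw [Finset.sum_mul]
      _ ≤ 4 * ((3 / 4) ^ i / 16) := by gcongr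
      _ = _ := by ring
  rw [← Finset.sum_fiberwise_of_maps_to (t := s.image b) (g := b)
    fun p hp => Finset.mem_image_of_mem b hp]
  refine (Finset.sum_le_sum hblock).trans ?_
  have hgeo : HasSum (fun i : ℕ => (3 / 4 : ℝ) ^ i / 4) 1 := by
    have := (hasSum_geometric_of_lt_one (r := (3 / 4 : ℝ)) (by norm_num) (by norm_num)).div_const 4
    rwa [show (1 - 3 / 4 : ℝ)⁻¹ / 4 = 1 by norm_num] at this
  exact sum_le_hasSum _ (fun _ _ => by positivity) hgeo

lemma exp_div_primeWeight_le {p : ℕ} (hp : 2 ≤ p) :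
    Real.exp (64 * (4 / 3) ^ Nat.log 2 (Nat.log 2 p)) ≤
      Real.exp 8192 * (p : ℝ) ^ (1 / 4 : ℝ) := by
  set i := Nat.log 2 (Nat.log 2 p) with hi
  have hp0 : (0 : ℝ) < p := by positivity
  have h1 : (2 : ℝ) ^ 2 ^ i ≤ p := by exact_mod_cast two_pow_two_pow_log_log_le hp
  have h2 := Real.log_le_log (by positivity) h1
  rw [Real.log_pow] at h2
  push_cast at h2
  rw [Real.rpow_def_of_pos hp0, ← Real.exp_add]
  refine Real.exp_le_exp.2 ?_
  have h3 : ((4 / 3 : ℝ) ^ i) ^ 2 ≤ 2 ^ i := by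
    rw [← pow_mul, mul_comm, pow_mul]
    gcongr
    norm_num
  have h4 : (1 / 2 : ℝ) ≤ Real.log 2 := by linarith [Real.log_two_gt_d9]
  have h5 : (2 : ℝ) ^ i * (1 / 2) ≤ 2 ^ i * Real.log 2 := by gcongr
  nlinarith [sq_nonneg ((4 / 3 : ℝ) ^ i - 256)]

lemma exp_sum_inv_le (D : Finset ℕ) (hD : ∀ p ∈ D, p.Prime) :
    Real.exp (4 * ∑ p ∈ D, (1 : ℝ) / p) ≤
      1 + Real.exp 8192 * ∑ p ∈ D, (p : ℝ) ^ (-(3 / 4) : ℝ) := by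
  have hsum := sum_primeWeight_le D hD
  have h := convexOn_exp.map_add_sum_le (t := D) (w := primeWeight)
    (p := fun p => 64 * (4 / 3) ^ Nat.log 2 (Nat.log 2 p)) (v := 1 - ∑ p ∈ D, primeWeight p)
    (q := (0 : ℝ)) (fun p _ => primeWeight_nonneg p) (by ring) (fun _ _ => Set.mem_univ _)
    (by linarith) (Set.mem_univ _)
  simp only [smul_eq_mul, mul_zero, zero_add, Real.exp_zero, mul_one] at h
  have e1 : ∑ p ∈ D, primeWeight p * (64 * (4 / 3) ^ Nat.log 2 (Nat.log 2 p)) =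
      4 * ∑ p ∈ D, (1 : ℝ) / p := by
    rw [Finset.mul_sum]
    refine Finset.sum_congr rfl fun p _ => ?_
    rw [primeWeight]
    have : (3 / 4 : ℝ) ^ Nat.log 2 (Nat.log 2 p) * (4 / 3) ^ Nat.log 2 (Nat.log 2 p) = 1 := by
      rw [← mul_pow]; norm_num
    linear_combination 4 * (1 / (p : ℝ)) * this
  rw [e1] at h
  refine h.trans (add_le_add ?_ ?_)
  · linarith [Finset.sum_nonneg fun p (_ : p ∈ D) => primeWeight_nonneg p]
  · rw [Finset.mul_sum]
    refine Finset.sum_le_sum fun p hp => ?_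
    have hp0 : (0 : ℝ) < p := by exact_mod_cast (hD p hp).pos
    have e2 : primeWeight p ≤ 1 / p := by
      rw [primeWeight]
      refine mul_le_of_le_one_right (by positivity) ?_
      have : (3 / 4 : ℝ) ^ Nat.log 2 (Nat.log 2 p) ≤ 1 := pow_le_one₀ (by norm_num) (by norm_num)
      linarith
    have e3 : (p : ℝ) ^ (-(3 / 4) : ℝ) = 1 / p * (p : ℝ) ^ (1 / 4 : ℝ) := by
      rw [one_div, ← Real.rpow_neg_one, ← Real.rpow_add hp0]
      norm_num
    rw [e3]
    calc _ ≤ 1 / (p : ℝ) * (Real.exp 8192 * (p : ℝ) ^ (1 / 4 : ℝ)) :=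
          mul_le_mul e2 (exp_div_primeWeight_le (hD p hp).two_le) (Real.exp_pos _).le
            (by positivity)
      _ = _ := by ring

lemma dvd_two_pow_sub_one_iff (p k : ℕ) : p ∣ 2 ^ k - 1 ↔ orderOf (2 : ZMod p) ∣ k := by
  rw [orderOf_dvd_iff_pow_eq_one, ← ZMod.natCast_eq_zero_iff, Nat.cast_sub Nat.one_le_two_pow,
    sub_eq_zero]
  push_cast
  rfl

lemma orderOf_two_pos {p : ℕ} (hp : p.Prime) (h3 : 3 ≤ p) : 0 < orderOf (2 : ZMod p) ∧
    orderOf (2 : ZMod p) ≤ p := by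
  have : Fact p.Prime := ⟨hp⟩
  have h2 : (2 : ZMod p) ≠ 0 := by
    intro h
    have : p ∣ 2 := by
      rw [← ZMod.natCast_eq_zero_iff]; exact_mod_cast h
    exact absurd (Nat.le_of_dvd (by norm_num) this) (by omega)
  have h4 := orderOf_dvd_of_pow_eq_one (ZMod.pow_card_sub_one_eq_one h2)
  exact ⟨Nat.pos_of_dvd_of_pos h4 (by omega), (Nat.le_of_dvd (by omega) h4).trans (by omega)⟩

lemma card_orderOf_two_eq_le (s : Finset ℕ) (hs : ∀ p ∈ s, p.Prime) {e : ℕ} (he : 0 < e) :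
    (s.filter fun p => orderOf (2 : ZMod p) = e).card ≤ e := by
  have h1 : ∏ p ∈ s.filter (fun p => orderOf (2 : ZMod p) = e), p ∣ 2 ^ e - 1 := by
    refine Finset.prod_primes_dvd _ (fun p hp => (hs p (Finset.mem_filter.1 hp).1).prime)
      fun p hp => ?_
    rw [dvd_two_pow_sub_one_iff, (Finset.mem_filter.1 hp).2]
  have h2 : 0 < 2 ^ e - 1 := by
    have : 1 < 2 ^ e := Nat.one_lt_two_pow he.ne'
    omega
  have h3 : 2 ^ (s.filter fun p => orderOf (2 : ZMod p) = e).card ≤ 2 ^ e := by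
    calc _ ≤ ∏ p ∈ s.filter (fun p => orderOf (2 : ZMod p) = e), p :=
          Finset.pow_card_le_prod _ _ _ fun p hp => (hs p (Finset.mem_filter.1 hp).1).two_le
      _ ≤ 2 ^ e - 1 := Nat.le_of_dvd h2 h1
      _ ≤ _ := Nat.sub_le _ _
  exact (Nat.pow_le_pow_iff_right (by norm_num)).1 h3

lemma exists_sum_rpow_div_orderOf_le : ∃ B : ℝ, 0 < B ∧ ∀ s : Finset ℕ,
    (∀ p ∈ s, p.Prime ∧ 3 ≤ p) →
    ∑ p ∈ s, (p : ℝ) ^ (-(3 / 4) : ℝ) / orderOf (2 : ZMod p) ≤ B := by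
  have s1 : Summable fun n : ℕ => (n : ℝ) ^ (-(13 / 12) : ℝ) :=
    Real.summable_nat_rpow.2 (by norm_num)
  have s2 : Summable fun n : ℕ => (n : ℝ) ^ (-(9 / 4) : ℝ) :=
    Real.summable_nat_rpow.2 (by norm_num)
  have n1 : ∀ n : ℕ, (0 : ℝ) ≤ (n : ℝ) ^ (-(13 / 12) : ℝ) := fun n => by positivity
  have n2 : ∀ n : ℕ, (0 : ℝ) ≤ (n : ℝ) ^ (-(9 / 4) : ℝ) := fun n => by positivity
  have t1 : 0 ≤ ∑' n : ℕ, (n : ℝ) ^ (-(13 / 12) : ℝ) := tsum_nonneg n1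
  have t2 : 0 ≤ ∑' n : ℕ, (n : ℝ) ^ (-(9 / 4) : ℝ) := tsum_nonneg n2
  refine ⟨(∑' n : ℕ, (n : ℝ) ^ (-(13 / 12) : ℝ)) + (∑' n : ℕ, (n : ℝ) ^ (-(9 / 4) : ℝ)) + 1,
    by linarith, fun s hs => ?_⟩
  have hterm : ∀ p ∈ s, (p : ℝ) ^ (-(3 / 4) : ℝ) / orderOf (2 : ZMod p) ≤
      (p : ℝ) ^ (-(13 / 12) : ℝ) + (orderOf (2 : ZMod p) : ℝ) ^ (-(13 / 4) : ℝ) := by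
    intro p hp
    have hp0 : (0 : ℝ) < p := by exact_mod_cast (hs p hp).1.pos
    have he0 : (0 : ℝ) < orderOf (2 : ZMod p) := by
      exact_mod_cast (orderOf_two_pos (hs p hp).1 (hs p hp).2).1
    set e : ℝ := (orderOf (2 : ZMod p) : ℝ)
    rw [div_eq_mul_inv]
    by_cases hle : (p : ℝ) ≤ e ^ (3 : ℝ)
    · have h1 : e⁻¹ ≤ (p : ℝ) ^ (-(1 / 3) : ℝ) := by
        calc e⁻¹ = (e ^ (3 : ℝ)) ^ (-(1 / 3) : ℝ) := by
              rw [← Real.rpow_mul he0.le, ← Real.rpow_neg_one]; norm_num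
          _ ≤ _ := Real.rpow_le_rpow_of_nonpos hp0 hle (by norm_num)
      calc _ ≤ (p : ℝ) ^ (-(3 / 4) : ℝ) * (p : ℝ) ^ (-(1 / 3) : ℝ) := by gcongr
        _ = (p : ℝ) ^ (-(13 / 12) : ℝ) := by rw [← Real.rpow_add hp0]; norm_num
        _ ≤ _ := le_add_of_nonneg_right (by positivity)
    · push Not at hle
      have h1 : (p : ℝ) ^ (-(3 / 4) : ℝ) ≤ e ^ (-(9 / 4) : ℝ) := by
        calc _ ≤ (e ^ (3 : ℝ)) ^ (-(3 / 4) : ℝ) :=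
              Real.rpow_le_rpow_of_nonpos (by positivity) hle.le (by norm_num)
          _ = _ := by rw [← Real.rpow_mul he0.le]; norm_num
      calc _ ≤ e ^ (-(9 / 4) : ℝ) * e⁻¹ := by gcongr
        _ = e ^ (-(13 / 4) : ℝ) := by
          rw [← Real.rpow_neg_one, ← Real.rpow_add he0]; norm_num
        _ ≤ _ := le_add_of_nonneg_left (by positivity)
  have hord : ∑ p ∈ s, (orderOf (2 : ZMod p) : ℝ) ^ (-(13 / 4) : ℝ) ≤
      ∑' n : ℕ, (n : ℝ) ^ (-(9 / 4) : ℝ) := by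
    rw [← Finset.sum_fiberwise_of_maps_to (t := s.image fun p => orderOf (2 : ZMod p))
      (g := fun p => orderOf (2 : ZMod p)) fun p hp => Finset.mem_image_of_mem _ hp]
    refine le_trans (Finset.sum_le_sum fun e he => ?_) (s2.sum_le_tsum _ fun n _ => n2 n)
    obtain ⟨p, hp, rfl⟩ := Finset.mem_image.1 he
    have he0 := (orderOf_two_pos (hs p hp).1 (hs p hp).2).1
    have he0' : (0 : ℝ) < orderOf (2 : ZMod p) := by exact_mod_cast he0
    have hc := card_orderOf_two_eq_le s (fun p hp => (hs p hp).1) he0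
    rw [Finset.sum_congr rfl (g := fun _ => (orderOf (2 : ZMod p) : ℝ) ^ (-(13 / 4) : ℝ))
      fun q hq => by rw [(Finset.mem_filter.1 hq).2], Finset.sum_const, nsmul_eq_mul]
    calc _ ≤ (orderOf (2 : ZMod p) : ℝ) * (orderOf (2 : ZMod p) : ℝ) ^ (-(13 / 4) : ℝ) := by
          gcongr
      _ = (orderOf (2 : ZMod p) : ℝ) ^ (-(9 / 4) : ℝ) := by
          nth_rewrite 1 [← Real.rpow_one (orderOf (2 : ZMod p) : ℝ)]
          rw [← Real.rpow_add he0']; norm_num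
  have hs1 : ∑ p ∈ s, (p : ℝ) ^ (-(13 / 12) : ℝ) ≤ ∑' n : ℕ, (n : ℝ) ^ (-(13 / 12) : ℝ) :=
    s1.sum_le_tsum _ fun n _ => n1 n
  have := Finset.sum_le_sum hterm
  rw [Finset.sum_add_distrib] at this
  linarith

lemma card_multiples_Icc_le (Y d : ℕ) :
    (((Finset.Icc 1 Y).filter fun k => d ∣ k).card : ℝ) ≤ Y / d := by
  have : (Finset.Icc 1 Y).filter (fun k => d ∣ k) = (Finset.Ioc 0 Y).filter fun k => d ∣ k := by
    congr 1
  rw [this, Nat.Ioc_filter_dvd_card_eq_div]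
  exact Nat.cast_div_le

/-- The odd primes dividing `k` or `2 ^ k - 1`. -/
noncomputable def romanoffPrimes (k : ℕ) : Finset ℕ :=
  (k.primeFactors ∪ (2 ^ k - 1).primeFactors).filter fun p => 3 ≤ p

lemma oddPrimeSum_add_le (k : ℕ) : 2 * oddPrimeSum k + 2 * oddPrimeSum (2 ^ k - 1) ≤
    4 * ∑ p ∈ romanoffPrimes k, (1 : ℝ) / p := by
  have h1 : oddPrimeSum k ≤ ∑ p ∈ romanoffPrimes k, (1 : ℝ) / p :=
    Finset.sum_le_sum_of_subset_of_nonneg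
      (Finset.filter_subset_filter _ Finset.subset_union_left) fun _ _ _ => by positivity
  have h2 : oddPrimeSum (2 ^ k - 1) ≤ ∑ p ∈ romanoffPrimes k, (1 : ℝ) / p :=
    Finset.sum_le_sum_of_subset_of_nonneg
      (Finset.filter_subset_filter _ Finset.subset_union_right) fun _ _ _ => by positivity
  linarith

/-- A mean value estimate in the style of Romanoff. -/
theorem exists_sum_exp_oddPrimeSum_le : ∃ C : ℝ, 0 < C ∧ ∀ Y : ℕ,
    ∑ k ∈ Finset.Icc 1 Y, Real.exp (2 * oddPrimeSum k + 2 * oddPrimeSum (2 ^ k - 1)) ≤ C * Y := by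
  obtain ⟨B, hB, hBs⟩ := exists_sum_rpow_div_orderOf_le
  refine ⟨1 + Real.exp 8192 * (2 * B), by positivity, fun Y => ?_⟩
  set S := (Finset.range (2 ^ Y)).filter fun p => p.Prime ∧ 3 ≤ p with hS
  have hSp : ∀ p ∈ S, p.Prime ∧ 3 ≤ p := fun p hp => (Finset.mem_filter.1 hp).2
  have hterm : ∀ k ∈ Finset.Icc 1 Y,
      Real.exp (2 * oddPrimeSum k + 2 * oddPrimeSum (2 ^ k - 1)) ≤
      1 + Real.exp 8192 * ∑ p ∈ S, if p ∣ k ∨ orderOf (2 : ZMod p) ∣ k then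
        (p : ℝ) ^ (-(3 / 4) : ℝ) else 0 := by
    intro k hk
    rw [Finset.mem_Icc] at hk
    refine (Real.exp_le_exp.2 (oddPrimeSum_add_le k)).trans
      ((exp_sum_inv_le _ fun p hp => ?_).trans ?_)
    · have := (Finset.mem_filter.1 hp).1
      rw [Finset.mem_union, Nat.mem_primeFactors, Nat.mem_primeFactors] at this
      tauto
    · rw [← Finset.sum_filter]
      gcongr
      intro p hp
      obtain ⟨h1, h2⟩ := Finset.mem_filter.1 hp
      rw [Finset.mem_union, Nat.mem_primeFactors, Nat.mem_primeFactors] at h1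
      rw [Finset.mem_filter, ← dvd_two_pow_sub_one_iff, hS, Finset.mem_filter, Finset.mem_range]
      have hlt : k < 2 ^ k := Nat.lt_two_pow_self
      have hY : 2 ^ k ≤ 2 ^ Y := Nat.pow_le_pow_right (by norm_num) hk.2
      rcases h1 with ⟨a, b, c⟩ | ⟨a, b, c⟩
      · exact ⟨⟨(Nat.le_of_dvd (by omega) b).trans_lt (by omega), a, h2⟩, Or.inl b⟩
      · exact ⟨⟨(Nat.le_of_dvd (by omega) b).trans_lt (by omega), a, h2⟩, Or.inr b⟩
  refine (Finset.sum_le_sum hterm).trans ?_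
  rw [Finset.sum_add_distrib, ← Finset.mul_sum, Finset.sum_comm, Finset.sum_const, Nat.card_Icc,
    nsmul_eq_mul, mul_one, Nat.add_sub_cancel]
  have hin : ∀ p ∈ S, ∑ k ∈ Finset.Icc 1 Y, (if p ∣ k ∨ orderOf (2 : ZMod p) ∣ k then
      (p : ℝ) ^ (-(3 / 4) : ℝ) else 0) ≤
      2 * Y * ((p : ℝ) ^ (-(3 / 4) : ℝ) / orderOf (2 : ZMod p)) := by
    intro p hp
    obtain ⟨h0, hle⟩ := orderOf_two_pos (hSp p hp).1 (hSp p hp).2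
    rw [← Finset.sum_filter, Finset.sum_const, nsmul_eq_mul, Finset.filter_or]
    have h1 : (((Finset.Icc 1 Y).filter (fun k => p ∣ k) ∪
        (Finset.Icc 1 Y).filter fun k => orderOf (2 : ZMod p) ∣ k).card : ℝ) ≤
        Y / p + Y / orderOf (2 : ZMod p) := by
      refine le_trans (by exact_mod_cast Finset.card_union_le _ _)
        (add_le_add (card_multiples_Icc_le Y p) (card_multiples_Icc_le Y _))
    have h2 : (Y : ℝ) / p ≤ Y / orderOf (2 : ZMod p) := by gcongr
    calc _ ≤ (2 * (Y / orderOf (2 : ZMod p)) : ℝ) * (p : ℝ) ^ (-(3 / 4) : ℝ) := by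
          gcongr; linarith
      _ = _ := by ring
  have h3 := Finset.sum_le_sum hin
  rw [← Finset.mul_sum] at h3
  have h4 : 2 * (Y : ℝ) * ∑ p ∈ S, (p : ℝ) ^ (-(3 / 4) : ℝ) / orderOf (2 : ZMod p) ≤
      2 * Y * B := by gcongr; exact hBs S hSp
  have h5 := mul_le_mul_of_nonneg_left (h3.trans h4) (Real.exp_pos 8192).le
  linarith

lemma exists_sieve_scale {L : ℕ} (hL : 40 ≤ L) : ∃ J, 40 * 2 ^ J ≤ L ∧ L < 80 * 2 ^ J := by
  refine ⟨Nat.log 2 (L / 40), ?_, ?_⟩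
  · have := Nat.pow_log_le_self 2 (x := L / 40) (by omega)
    omega
  · have := Nat.lt_pow_succ_log_self (b := 2) (by norm_num) (L / 40)
    rw [pow_succ] at this
    omega

lemma two_pow_pow_le_of_le_log {J N : ℕ} (hN : N ≠ 0) (h : 40 * 2 ^ J ≤ Nat.log 2 N) :
    (2 ^ 2 ^ J) ^ 40 ≤ N := by
  rw [← pow_mul, mul_comm]
  exact Nat.pow_le_of_le_log hN h

/-- The `n < N` for which `n - 2 ^ p` is a member of `P₂*`. -/
noncomputable def shiftedP2star (N p : ℕ) : Finset ℕ :=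
  (Finset.range N).filter fun n => 2 ^ p ≤ n ∧ P2star (n - 2 ^ p)

lemma r_le_card {N n Y : ℕ} (hn : n < N) (hY : N ≤ 2 ^ Y) :
    r n ≤ (((Finset.range Y).filter Nat.Prime).filter fun p => n ∈ shiftedP2star N p).card := by
  set T := ((Finset.range Y).filter Nat.Prime).filter fun p => n ∈ shiftedP2star N p
  have hsub : {pq : ℕ × ℕ | pq.1.Prime ∧ P2star pq.2 ∧ n = 2 ^ pq.1 + pq.2} ⊆
      (T.image fun p => (p, n - 2 ^ p) : Finset (ℕ × ℕ)) := by
    rintro ⟨p, q⟩ ⟨h1, h2, h3⟩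
    dsimp only at h1 h2 h3
    rw [Finset.mem_coe, Finset.mem_image]
    have hq : n - 2 ^ p = q := by omega
    refine ⟨p, ?_, by rw [hq]⟩
    have hp : p < Y := (Nat.pow_lt_pow_iff_right (by norm_num : 1 < 2)).1 (by omega)
    simp only [T, shiftedP2star, Finset.mem_filter, Finset.mem_range, hq]
    exact ⟨⟨hp, h1⟩, hn, by omega, h2⟩
  calc r n ≤ ((T.image fun p => (p, n - 2 ^ p) : Finset (ℕ × ℕ)) : Set (ℕ × ℕ)).ncard :=
        Set.ncard_le_ncard hsub (Finset.finite_toSet _)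
    _ ≤ T.card := by rw [Set.ncard_coe_finset]; exact Finset.card_image_le

lemma sum_r_sq_le_sum_inter {N Y : ℕ} (hY : N ≤ 2 ^ Y) :
    ∑ n ∈ Finset.range N, r n ^ 2 ≤
      ∑ p ∈ (Finset.range Y).filter Nat.Prime, ∑ q ∈ (Finset.range Y).filter Nat.Prime,
        (shiftedP2star N p ∩ shiftedP2star N q).card := by
  set T := (Finset.range Y).filter Nat.Prime
  calc ∑ n ∈ Finset.range N, r n ^ 2
      ≤ ∑ n ∈ Finset.range N, (∑ p ∈ T, if n ∈ shiftedP2star N p then 1 else 0) ^ 2 := by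
        refine Finset.sum_le_sum fun n hn => Nat.pow_le_pow_left ?_ 2
        rw [← Finset.card_filter]
        exact r_le_card (Finset.mem_range.1 hn) hY
    _ = ∑ n ∈ Finset.range N, ∑ p ∈ T, ∑ q ∈ T,
          if n ∈ shiftedP2star N p ∩ shiftedP2star N q then 1 else 0 := by
        refine Finset.sum_congr rfl fun n _ => ?_
        rw [sq, Finset.sum_mul_sum]
        refine Finset.sum_congr rfl fun p _ => Finset.sum_congr rfl fun q _ => ?_
        by_cases h1 : n ∈ shiftedP2star N p <;> by_cases h2 : n ∈ shiftedP2star N q <;>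
          simp [h1, h2]
    _ = ∑ p ∈ T, ∑ q ∈ T, ∑ n ∈ Finset.range N,
          if n ∈ shiftedP2star N p ∩ shiftedP2star N q then 1 else 0 := by
        rw [Finset.sum_comm]
        exact Finset.sum_congr rfl fun p _ => Finset.sum_comm
    _ ≤ _ := by
        refine Finset.sum_le_sum fun p _ => Finset.sum_le_sum fun q _ => ?_
        rw [← Finset.card_filter]
        exact Finset.card_le_card fun n hn => (Finset.mem_filter.1 hn).2

lemma sum_sum_eq_diag_add_shifts (T : Finset ℕ) (Y : ℕ) (hT : ∀ p ∈ T, p < Y) (f : ℕ → ℕ → ℝ)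
    (hf : ∀ p q, f p q = f q p) :
    ∑ p ∈ T, ∑ q ∈ T, f p q = ∑ p ∈ T, f p p +
      2 * ∑ k ∈ Finset.Icc 1 Y, ∑ p ∈ T.filter (fun p => p + k ∈ T), f p (p + k) := by
  have hlt : ∑ p ∈ T, ∑ q ∈ T, (if p < q then f p q else 0) =
      ∑ k ∈ Finset.Icc 1 Y, ∑ p ∈ T.filter (fun p => p + k ∈ T), f p (p + k) := by
    simp only [Finset.sum_filter (fun p => _ + _ ∈ T)]
    rw [Finset.sum_comm (s := Finset.Icc 1 Y)]
    refine Finset.sum_congr rfl fun p hp => ?_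
    rw [← Finset.sum_filter, ← Finset.sum_filter]
    have : T.filter (fun q => p < q) =
        ((Finset.Icc 1 Y).filter fun k => p + k ∈ T).image fun k => p + k := by
      ext q
      simp only [Finset.mem_filter, Finset.mem_image, Finset.mem_Icc]
      constructor
      · rintro ⟨h1, h2⟩
        have := hT q h1
        exact ⟨q - p, ⟨⟨by omega, by omega⟩, by rwa [Nat.add_sub_cancel' h2.le]⟩, by omega⟩
      · rintro ⟨k, ⟨⟨h1, -⟩, h2⟩, rfl⟩
        exact ⟨h2, by omega⟩
    rw [this, Finset.sum_image fun a _ b _ h => by simpa using h]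
  have hgt : ∑ p ∈ T, ∑ q ∈ T, (if q < p then f p q else 0) =
      ∑ p ∈ T, ∑ q ∈ T, (if p < q then f p q else 0) := by
    rw [Finset.sum_comm]
    exact Finset.sum_congr rfl fun p _ => Finset.sum_congr rfl fun q _ => by rw [hf]
  have hdiag : ∑ p ∈ T, ∑ q ∈ T, (if p = q then f p q else 0) = ∑ p ∈ T, f p p :=
    Finset.sum_congr rfl fun p hp => by rw [Finset.sum_ite_eq, if_pos hp]
  rw [two_mul]
  nth_rewrite 1 [← hlt]
  rw [← hlt]
  nth_rewrite 2 [← hgt]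
  rw [← hdiag, ← Finset.sum_add_distrib, ← Finset.sum_add_distrib]
  refine Finset.sum_congr rfl fun p _ => ?_
  rw [← Finset.sum_add_distrib, ← Finset.sum_add_distrib]
  refine Finset.sum_congr rfl fun q _ => ?_
  rcases lt_trichotomy p q with h | h | h
  · simp [h, h.ne, h.not_gt]
  · simp [h]
  · simp [h, h.ne', h.not_gt]

lemma card_shiftedP2star_le (N p : ℕ) :
    (shiftedP2star N p).card ≤ ((Finset.range N).filter P2star).card := by
  refine Finset.card_le_card_of_injOn (fun n => n - 2 ^ p) (fun n hn => ?_) fun a ha b hb hab => ?_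
  · simp only [shiftedP2star, Finset.coe_filter, Finset.mem_range, Set.mem_ofPred_eq] at hn ⊢
    exact ⟨(Nat.sub_le _ _).trans_lt hn.1, hn.2.2⟩
  · simp only [shiftedP2star, Finset.coe_filter, Finset.mem_range, Set.mem_ofPred_eq] at ha hb hab
    omega

lemma card_shiftedP2star_inter_le (N p k : ℕ) :
    (shiftedP2star N p ∩ shiftedP2star N (p + k)).card ≤
      ((Finset.range N).filter fun n => P2star n ∧ P2star (n + 2 ^ p * (2 ^ k - 1))).card := by
  have h0 : 2 ^ p * (2 ^ k - 1) + 2 ^ p = 2 ^ (p + k) := by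
    have : 1 ≤ 2 ^ k := Nat.one_le_two_pow
    rw [pow_add]
    nth_rewrite 2 [← mul_one (2 ^ p)]
    rw [← mul_add, Nat.sub_add_cancel this]
  refine Finset.card_le_card_of_injOn (fun n => n - 2 ^ (p + k)) (fun n hn => ?_)
    fun a ha b hb hab => ?_
  · simp only [shiftedP2star, Finset.coe_filter, Finset.mem_range, Set.mem_ofPred_eq,
      Finset.coe_inter, Set.mem_inter_iff] at hn ⊢
    obtain ⟨⟨h1, h2, h3⟩, -, h4, h5⟩ := hn
    refine ⟨(Nat.sub_le _ _).trans_lt h1, h5, ?_⟩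
    rwa [show n - 2 ^ (p + k) + 2 ^ p * (2 ^ k - 1) = n - 2 ^ p by omega]
  · simp only [shiftedP2star, Finset.coe_filter, Finset.mem_range, Set.mem_ofPred_eq,
      Finset.coe_inter, Set.mem_inter_iff] at ha hb hab
    omega

lemma oddPrimeSum_two_pow_mul_le (p : ℕ) {m : ℕ} (hm : m ≠ 0) :
    oddPrimeSum (2 ^ p * m) ≤ oddPrimeSum m := by
  refine Finset.sum_le_sum_of_subset_of_nonneg (fun q hq => ?_) fun _ _ _ => by positivity
  simp only [Finset.mem_filter, Nat.mem_primeFactors] at hq ⊢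
  obtain ⟨⟨h1, h2, -⟩, h3⟩ := hq
  refine ⟨⟨h1, ?_, hm⟩, h3⟩
  rcases h1.dvd_mul.1 h2 with h | h
  · have := Nat.le_of_dvd (by norm_num) (h1.dvd_of_dvd_pow h)
    omega
  · exact h

theorem exists_sum_range_r_sq_le : ∃ C : ℝ, 0 < C ∧ ∃ N₀ : ℕ, ∀ N : ℕ, N₀ ≤ N →
    ∑ n ∈ Finset.range N, (r n : ℝ) ^ 2 ≤ C * N := by
  obtain ⟨C, hC, hmean⟩ := exists_sum_exp_oddPrimeSum_le
  set K := Real.exp (Real.exp 24) with hK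
  have hK0 : 0 < K := Real.exp_pos _
  obtain ⟨L₀, hL₀⟩ : ∃ L₀ : ℕ, 2 ^ 40 ≤ L₀ := ⟨_, le_rfl⟩
  refine ⟨2000 * 6400 * K ^ 2 + 4800000 * 6400 ^ 2 * K ^ 2 * C, by positivity, 2 ^ L₀,
    fun N hN => ?_⟩
  have hN0 : N ≠ 0 := by
    have : 0 < 2 ^ L₀ := by positivity
    omega
  have hL : L₀ ≤ Nat.log 2 N := Nat.le_log_of_pow_le (by norm_num) hN
  set Y := Nat.log 2 N + 1 with hYdef
  have hYN : N ≤ 2 ^ Y := (Nat.lt_pow_succ_log_self (by norm_num) N).le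
  have hY40 : 40 ≤ Nat.log 2 Y := Nat.le_log_of_pow_le (by norm_num) (by omega)
  obtain ⟨J, hJ1, hJ2⟩ := exists_sieve_scale (L := Nat.log 2 N) (by omega)
  obtain ⟨J', hJ1', hJ2'⟩ := exists_sieve_scale hY40
  have hJ : 1 ≤ J := by
    by_contra h
    have : J = 0 := by omega
    subst this
    omega
  have hNJ := two_pow_pow_le_of_le_log hN0 hJ1
  have hYJ := two_pow_pow_le_of_le_log (by omega) hJ1'
  have hYle : (Y : ℝ) / 2 ^ J ≤ 80 := by
    rw [div_le_iff₀ (by positivity)]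
    have : Y ≤ 80 * 2 ^ J := by omega
    exact_mod_cast this
  have hJle : (J : ℝ) / 2 ^ J' ≤ 80 := by
    rw [div_le_iff₀ (by positivity)]
    have : J ≤ Nat.log 2 Y := Nat.le_log_of_pow_le (by norm_num) (by omega)
    exact_mod_cast this.trans hJ2'.le
  set T := (Finset.range Y).filter Nat.Prime with hT
  have h1 : ∑ n ∈ Finset.range N, (r n : ℝ) ^ 2 ≤
      ∑ p ∈ T, ∑ q ∈ T, ((shiftedP2star N p ∩ shiftedP2star N q).card : ℝ) := by
    exact_mod_cast sum_r_sq_le_sum_inter hYN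
  rw [sum_sum_eq_diag_add_shifts T Y (fun p hp => by simp [hT] at hp; exact hp.1) _
    fun p q => by rw [Finset.inter_comm]] at h1
  have hdiag : ∑ p ∈ T, ((shiftedP2star N p ∩ shiftedP2star N p).card : ℝ) ≤
      2000 * 6400 * K ^ 2 * N := by
    calc _ ≤ ∑ p ∈ T, 100 * K * ((N : ℝ) * J / 2 ^ J) := by
          refine Finset.sum_le_sum fun p _ => ?_
          rw [Finset.inter_self]
          exact le_trans (by exact_mod_cast card_shiftedP2star_le N p) (card_P2star_le hJ hNJ)
      _ = T.card * (100 * K * ((N : ℝ) * J / 2 ^ J)) := by rw [Finset.sum_const, nsmul_eq_mul]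
      _ ≤ 20 * K * (Y / 2 ^ J') * (100 * K * ((N : ℝ) * J / 2 ^ J)) := by
          gcongr; exact card_primes_le hYJ
      _ = 2000 * K ^ 2 * N * ((Y / 2 ^ J) * (J / 2 ^ J')) := by ring
      _ ≤ 2000 * K ^ 2 * N * (80 * 80) := by gcongr
      _ = _ := by ring
  have hoff : ∀ k ∈ Finset.Icc 1 Y, ∑ p ∈ T.filter (fun p => p + k ∈ T),
      ((shiftedP2star N p ∩ shiftedP2star N (p + k)).card : ℝ) ≤
      2400000 * K ^ 2 * N * (Y / 4 ^ J) * (J ^ 2 / 4 ^ J') *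
        Real.exp (2 * oddPrimeSum k + 2 * oddPrimeSum (2 ^ k - 1)) := by
    intro k hk
    have hk1 := (Finset.mem_Icc.1 hk).1
    have hk0 : 2 ^ k - 1 ≠ 0 := by
      have : 1 < 2 ^ k := Nat.one_lt_two_pow (by omega)
      omega
    have hcard : ((T.filter fun p => p + k ∈ T).card : ℝ) ≤
        300 * K * (Y / 4 ^ J') * Real.exp (2 * oddPrimeSum k) := by
      refine le_trans ?_ (card_prime_pairs_le (by omega) hYJ)
      refine Nat.cast_le.2 (Finset.card_le_card fun p hp => ?_)
      simp only [hT, Finset.mem_filter, Finset.mem_range] at hp ⊢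
      exact ⟨hp.1.1, hp.1.2, hp.2.2⟩
    calc _ ≤ ∑ p ∈ T.filter (fun p => p + k ∈ T), 8000 * K * ((N : ℝ) * J ^ 2 / 4 ^ J) *
          Real.exp (2 * oddPrimeSum (2 ^ k - 1)) := by
          refine Finset.sum_le_sum fun p _ => ?_
          refine le_trans (Nat.cast_le.2 (card_shiftedP2star_inter_le N p k))
            ((card_P2star_pairs_le hJ (mul_ne_zero (by positivity) hk0) hNJ).trans ?_)
          gcongr
          exact oddPrimeSum_two_pow_mul_le p hk0
      _ = (T.filter fun p => p + k ∈ T).card * (8000 * K * ((N : ℝ) * J ^ 2 / 4 ^ J) *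
          Real.exp (2 * oddPrimeSum (2 ^ k - 1))) := by rw [Finset.sum_const, nsmul_eq_mul]
      _ ≤ 300 * K * (Y / 4 ^ J') * Real.exp (2 * oddPrimeSum k) *
          (8000 * K * ((N : ℝ) * J ^ 2 / 4 ^ J) * Real.exp (2 * oddPrimeSum (2 ^ k - 1))) := by
          gcongr
      _ = _ := by rw [Real.exp_add]; ring
  have hoff' := Finset.sum_le_sum hoff
  rw [← Finset.mul_sum] at hoff'
  have hfour : ∀ j : ℕ, (4 : ℝ) ^ j = (2 ^ j) ^ 2 := fun j => by
    rw [← pow_mul, mul_comm, pow_mul]; norm_num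
  have hoff'' : 2400000 * K ^ 2 * N * (Y / 4 ^ J) * (J ^ 2 / 4 ^ J') *
      ∑ k ∈ Finset.Icc 1 Y, Real.exp (2 * oddPrimeSum k + 2 * oddPrimeSum (2 ^ k - 1)) ≤
      2400000 * 6400 ^ 2 * K ^ 2 * C * N := by
    calc _ ≤ 2400000 * K ^ 2 * N * (Y / 4 ^ J) * (J ^ 2 / 4 ^ J') * (C * Y) := by
          gcongr; exact hmean Y
      _ = 2400000 * K ^ 2 * N * C * ((Y / 2 ^ J) ^ 2 * (J / 2 ^ J') ^ 2) := by
          rw [hfour, hfour]; ring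
      _ ≤ 2400000 * K ^ 2 * N * C * (80 ^ 2 * 80 ^ 2) := by gcongr
      _ = _ := by ring
  linarith

/-- `∑_{n ≤ x} r(n)² = O(x)`. -/
theorem sum_r_sq_upper : ∃ C : ℝ, 0 < C ∧ ∃ x₀ : ℝ, ∀ x : ℝ, x₀ ≤ x →
    ∑ n ∈ Finset.Icc 1 ⌊x⌋₊, (r n : ℝ) ^ 2 ≤ C * x := by
  obtain ⟨C, hC, N₀, h⟩ := exists_sum_range_r_sq_le
  refine ⟨2 * C, by positivity, max N₀ 1, fun x hx => ?_⟩
  have hx1 : 1 ≤ x := (le_max_right _ _).trans hx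
  have hN : N₀ ≤ ⌊x⌋₊ := Nat.le_floor ((le_max_left _ _).trans hx)
  calc ∑ n ∈ Finset.Icc 1 ⌊x⌋₊, (r n : ℝ) ^ 2
      ≤ ∑ n ∈ Finset.range (⌊x⌋₊ + 1), (r n : ℝ) ^ 2 :=
        Finset.sum_le_sum_of_subset_of_nonneg (fun n hn => by
          rw [Finset.mem_Icc] at hn
          rw [Finset.mem_range]
          omega) fun _ _ _ => by positivity
    _ ≤ C * (⌊x⌋₊ + 1 : ℕ) := h _ (by omega)
    _ ≤ C * (2 * x) := by
        gcongr
        push_cast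
        linarith [Nat.floor_le (by linarith : 0 ≤ x)]
    _ = 2 * C * x := by ring
end
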